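/- Context reduction: let A be a graph and G[·]_S a context such that G[A]_S is provable in GS. Then there exist a context C[·]_R and a graph K such that: for every graph X there is a GS derivation from C[K ⅋ X]_R to G[X]_S; K ⅋ A is provable in GS; and the graph C (that is, C[∅]_R) is provable in GS. -/

import Mathlib

namespace GSP

/-- Atoms: a propositional variable (coded by a natural number) with a polarity. -/
abbrev Atom := ℕ × Bool

/-- The dual atom. -/
def dualAtom (a : Atom) : Atom := (a.1, !a.2)

/-- A finite, simple, undirected graph whose vertices are labelled by atoms. -/
structure LGraph where
  V : Type
  [fintype : Fintype V]
  adj : V → V → Prop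
  symm : ∀ {v w : V}, adj v w → adj w v
  irrefl : ∀ v : V, ¬ adj v v
  label : V → Atom

attribute [instance] LGraph.fintype

namespace LGraph

/-- An isomorphism of labelled graphs: a vertex bijection preserving labels and
preserving and reflecting edges. -/
structure Iso (G H : LGraph) where
  toEquiv : G.V ≃ H.V
  adj_iff : ∀ v w : G.V, G.adj v w ↔ H.adj (toEquiv v) (toEquiv w)
  label_eq : ∀ v : G.V, H.label (toEquiv v) = G.label v

/-- `G ≅ H` : the graphs `G` and `H` are isomorphic. -/
def iso (G H : LGraph) : Prop := Nonempty (Iso G H)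

/-- The empty graph. -/
def empty : LGraph where
  V := Empty
  adj _ _ := False
  symm h := h.elim
  irrefl v := v.elim
  label v := v.elim

/-- The single-vertex graph labelled by the atom `a`. -/
def single (a : Atom) : LGraph where
  V := Unit
  adj _ _ := False
  symm h := h.elim
  irrefl _ h := h
  label _ := a

def parAdj (G H : LGraph) : G.V ⊕ H.V → G.V ⊕ H.V → Prop
  | .inl a, .inl b => G.adj a b
  | .inr a, .inr b => H.adj a b
  | _, _ => False

/-- The par `G ⅋ H` : disjoint union of `G` and `H`. -/
def par (G H : LGraph) : LGraph where
  V := G.V ⊕ H.V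
  adj := parAdj G H
  symm := by
    rintro (a | a) (b | b) h
    · exact G.symm h
    · exact h.elim
    · exact h.elim
    · exact H.symm h
  irrefl := by
    rintro (a | a) h
    · exact G.irrefl a h
    · exact H.irrefl a h
  label := Sum.elim G.label H.label

def tensorAdj (G H : LGraph) : G.V ⊕ H.V → G.V ⊕ H.V → Prop
  | .inl a, .inl b => G.adj a b
  | .inr a, .inr b => H.adj a b
  | .inl _, .inr _ => True
  | .inr _, .inl _ => True

/-- The tensor `G ⊗ H` : join of `G` and `H` (disjoint union plus all edges in between). -/
def tensor (G H : LGraph) : LGraph where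
  V := G.V ⊕ H.V
  adj := tensorAdj G H
  symm := by
    rintro (a | a) (b | b) h
    · exact G.symm h
    · exact trivial
    · exact trivial
    · exact H.symm h
  irrefl := by
    rintro (a | a) h
    · exact G.irrefl a h
    · exact H.irrefl a h
  label := Sum.elim G.label H.label

/-- The dual graph `Ḡ` : same vertices, complemented edges, dualized labels. -/
def dual (G : LGraph) : LGraph where
  V := G.V
  adj v w := v ≠ w ∧ ¬ G.adj v w
  symm h := ⟨fun e => h.1 e.symm, fun h' => h.2 (G.symm h')⟩
  irrefl _ h := h.1 rfl
  label v := dualAtom (G.label v)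

def plugAdj (C : LGraph) (R : Set C.V) (X : LGraph) : C.V ⊕ X.V → C.V ⊕ X.V → Prop
  | .inl a, .inl b => C.adj a b
  | .inr a, .inr b => X.adj a b
  | .inl a, .inr _ => a ∈ R
  | .inr _, .inl b => b ∈ R

/-- `C[X]_R` : the graph obtained from the context `C[·]_R` by inserting the graph `X`
as a module whose vertices are adjacent exactly to the vertices in `R`. -/
def plug (C : LGraph) (R : Set C.V) (X : LGraph) : LGraph where
  V := C.V ⊕ X.V
  adj := plugAdj C R X
  symm := by
    rintro (a | a) (b | b) h
    · exact C.symm h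
    · exact h
    · exact h
    · exact X.symm h
  irrefl := by
    rintro (a | a) h
    · exact C.irrefl a h
    · exact X.irrefl a h
  label := Sum.elim C.label X.label

def compAdj (G : LGraph) (H : G.V → LGraph) :
    (Σ v : G.V, (H v).V) → (Σ v : G.V, (H v).V) → Prop := fun x y =>
  (∃ (v : G.V) (a b : (H v).V), x = ⟨v, a⟩ ∧ y = ⟨v, b⟩ ∧ (H v).adj a b) ∨
    (x.1 ≠ y.1 ∧ G.adj x.1 y.1)

/-- The composition `G⟨H v₁, …, H vₙ⟩` of the family `H` via the graph `G`:
replace each vertex `v` of `G` by the graph `H v`. -/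
def comp (G : LGraph) (H : G.V → LGraph) : LGraph where
  V := Σ v : G.V, (H v).V
  adj := compAdj G H
  symm := by
    rintro x y (⟨v, a, b, hx, hy, hab⟩ | ⟨hne, hadj⟩)
    · exact Or.inl ⟨v, b, a, hy, hx, (H v).symm hab⟩
    · exact Or.inr ⟨hne.symm, G.symm hadj⟩
  irrefl := by
    rintro ⟨v, a⟩ (⟨w, x, y, hx, hy, hxy⟩ | ⟨hne, _⟩)
    · have h := hx.symm.trans hy
      obtain rfl : x = y := by simpa using h
      exact (H w).irrefl x hxy
    · exact hne rfl
  label x := (H x.1).label x.2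

/-- A module of `G` : a set `M` of vertices such that every vertex outside `M`
is adjacent either to all vertices of `M` or to none of them. -/
def IsModule (G : LGraph) (M : Set G.V) : Prop :=
  ∀ v ∉ M, ∀ x ∈ M, ∀ y ∈ M, (G.adj v x ↔ G.adj v y)

/-- A prime graph: at least 2 vertices and only trivial modules. -/
def Prime (G : LGraph) : Prop :=
  2 ≤ Fintype.card G.V ∧
    ∀ M : Set G.V, G.IsModule M → M = ∅ ∨ (∃ v, M = {v}) ∨ M = Set.univ

/-- `G` is `P₄`-free: no four distinct vertices induce a path on 4 vertices. -/
def P4Free (G : LGraph) : Prop :=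
  ¬ ∃ v₁ v₂ v₃ v₄ : G.V,
      v₁ ≠ v₂ ∧ v₁ ≠ v₃ ∧ v₁ ≠ v₄ ∧ v₂ ≠ v₃ ∧ v₂ ≠ v₄ ∧ v₃ ≠ v₄ ∧
      G.adj v₁ v₂ ∧ G.adj v₂ v₃ ∧ G.adj v₃ v₄ ∧
      ¬ G.adj v₁ v₃ ∧ ¬ G.adj v₁ v₄ ∧ ¬ G.adj v₂ v₄

end LGraph

open LGraph

/-- The `n`-fold tensor `X₁ ⊗ ⋯ ⊗ Xₙ`. -/
def bigTensor : (n : ℕ) → (Fin n → LGraph) → LGraph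
  | 0, _ => LGraph.empty
  | n + 1, F => (F 0).tensor (bigTensor n fun i => F i.succ)

/-- The `n`-fold par `X₁ ⅋ ⋯ ⅋ Xₙ`. -/
def bigPar : (n : ℕ) → (Fin n → LGraph) → LGraph
  | 0, _ => LGraph.empty
  | n + 1, F => (F 0).par (bigPar n fun i => F i.succ)

/-- The inference rules of system GS (premise, conclusion). -/
inductive GSRule : LGraph → LGraph → Prop
  /-- ai↓ : premise `∅`, conclusion `ā ⅋ a`. -/
  | ai (a : Atom) : GSRule LGraph.empty ((single (dualAtom a)).par (single a))
  /-- ss↓ : premise `B[A]_S`, conclusion `B ⅋ A`, for `A ≠ ∅` and `S ≠ ∅`. -/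
  | ss (A B : LGraph) (S : Set B.V) :
      Nonempty A.V → S ≠ ∅ → GSRule (B.plug S A) (B.par A)
  /-- p↓ : premise `(M₁ ⅋ N₁) ⊗ ⋯ ⊗ (Mₙ ⅋ Nₙ)`, conclusion `P̄⟨M₁,…,Mₙ⟩ ⅋ P⟨N₁,…,Nₙ⟩`,
  for `P` prime with `n = |V(P)| ≥ 4` and all `Mᵢ ≠ ∅`. -/
  | p (n : ℕ) (P : LGraph) (e : P.V ≃ Fin n) (M N : Fin n → LGraph) :
      P.Prime → 4 ≤ n → (∀ i, Nonempty (M i).V) →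
      GSRule (bigTensor n fun i => (M i).par (N i))
        ((P.dual.comp fun v => M (e v)).par (P.comp fun v => N (e v)))

/-- The "up" rules ai↑, ss↑, p↑ (premise, conclusion). -/
inductive UpRule : LGraph → LGraph → Prop
  /-- ai↑ : premise `a ⊗ ā`, conclusion `∅`. -/
  | ai (a : Atom) : UpRule ((single a).tensor (single (dualAtom a))) LGraph.empty
  /-- ss↑ : premise `B ⊗ A`, conclusion `B[A]_S`, for `A ≠ ∅` and `S ≠ V(B)`. -/
  | ss (A B : LGraph) (S : Set B.V) :
      Nonempty A.V → S ≠ Set.univ → UpRule (B.tensor A) (B.plug S A)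
  /-- p↑ : premise `P⟨M₁,…,Mₙ⟩ ⊗ P̄⟨N₁,…,Nₙ⟩`, conclusion `(M₁ ⊗ N₁) ⅋ ⋯ ⅋ (Mₙ ⊗ Nₙ)`,
  for `P` prime with `n = |V(P)| ≥ 4` and all `Mᵢ ≠ ∅`. -/
  | p (n : ℕ) (P : LGraph) (e : P.V ≃ Fin n) (M N : Fin n → LGraph) :
      P.Prime → 4 ≤ n → (∀ i, Nonempty (M i).V) →
      UpRule ((P.comp fun v => M (e v)).tensor (P.dual.comp fun v => N (e v)))
        (bigPar n fun i => (M i).tensor (N i))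

/-- The rules of system SGS : the rules of GS together with their duals. -/
def SGSRule (G H : LGraph) : Prop := GSRule G H ∨ UpRule G H

/-- A single inference step in a system: inside some context, replace a module
isomorphic to the premise of a rule by the corresponding conclusion. -/
def Step (Rules : LGraph → LGraph → Prop) (G H : LGraph) : Prop :=
  ∃ (C : LGraph) (R : Set C.V) (p c : LGraph),
    Rules p c ∧ G.iso (C.plug R p) ∧ H.iso (C.plug R c)

/-- A derivation in a system from `G` to `H` : a finite sequence of inference steps
and isomorphisms leading from `G` to `H`. -/
def Deriv (Rules : LGraph → LGraph → Prop) (G H : LGraph) : Prop :=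
  Relation.ReflTransGen (fun X Y => X.iso Y ∨ Step Rules X Y) G H

/-- A graph is provable in a system if there is a derivation from `∅` to it. -/
def Provable (Rules : LGraph → LGraph → Prop) (G : LGraph) : Prop :=
  Deriv Rules LGraph.empty G

/-- Formulas: unit, positive and negative atoms, par and tensor. -/
inductive Formula where
  | unit : Formula
  | pos (a : ℕ) : Formula
  | neg (a : ℕ) : Formula
  | par (φ ψ : Formula) : Formula
  | tens (φ ψ : Formula) : Formula

/-- The graph `[φ]` of a formula `φ`. -/
def Formula.graph : Formula → LGraph
  | .unit => LGraph.empty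
  | .pos a => single (a, true)
  | .neg a => single (a, false)
  | .par φ ψ => φ.graph.par ψ.graph
  | .tens φ ψ => φ.graph.tensor ψ.graph

/-- Structural equivalence of formulas: the smallest congruence making `⅋` and `⊗`
associative and commutative with unit `∘`. -/
inductive Formula.equiv : Formula → Formula → Prop
  | refl (φ) : Formula.equiv φ φ
  | symm {φ ψ} : Formula.equiv φ ψ → Formula.equiv ψ φ
  | trans {φ ψ χ} : Formula.equiv φ ψ → Formula.equiv ψ χ → Formula.equiv φ χ
  | parComm (φ ψ) : Formula.equiv (.par φ ψ) (.par ψ φ)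
  | parAssoc (φ ψ χ) : Formula.equiv (.par φ (.par ψ χ)) (.par (.par φ ψ) χ)
  | parUnit (φ) : Formula.equiv (.par φ .unit) φ
  | tensComm (φ ψ) : Formula.equiv (.tens φ ψ) (.tens ψ φ)
  | tensAssoc (φ ψ χ) : Formula.equiv (.tens φ (.tens ψ χ)) (.tens (.tens φ ψ) χ)
  | tensUnit (φ) : Formula.equiv (.tens φ .unit) φ
  | parCongr {φ φ' ψ ψ'} : Formula.equiv φ φ' → Formula.equiv ψ ψ' →
      Formula.equiv (.par φ ψ) (.par φ' ψ')
  | tensCongr {φ φ' ψ ψ'} : Formula.equiv φ φ' → Formula.equiv ψ ψ' →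
      Formula.equiv (.tens φ ψ) (.tens φ' ψ')

/-- A formula is unit-free if it contains no occurrence of the unit `∘`. -/
def Formula.UnitFree : Formula → Prop
  | .unit => False
  | .pos _ => True
  | .neg _ => True
  | .par φ ψ => φ.UnitFree ∧ ψ.UnitFree
  | .tens φ ψ => φ.UnitFree ∧ ψ.UnitFree

/-- The sequent calculus MLL° (multiplicative linear logic with mix) on multisets
of formulas. -/
inductive MLL : Multiset Formula → Prop
  | ax (a : ℕ) : MLL {Formula.pos a, Formula.neg a}
  | tens {Γ Δ : Multiset Formula} (φ ψ : Formula) :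
      MLL (φ ::ₘ Γ) → MLL (ψ ::ₘ Δ) → MLL (Formula.tens φ ψ ::ₘ (Γ + Δ))
  | par {Γ : Multiset Formula} (φ ψ : Formula) :
      MLL (φ ::ₘ ψ ::ₘ Γ) → MLL (Formula.par φ ψ ::ₘ Γ)
  | mix {Γ Δ : Multiset Formula} : MLL Γ → MLL Δ → MLL (Γ + Δ)


/-! ### Basic toolkit -/

abbrev Dv (G H : LGraph) : Prop := Deriv GSRule G H
abbrev Pv (G : LGraph) : Prop := Provable GSRule G

namespace LGraph

theorem iso.refl (G : LGraph) : G.iso G :=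
  ⟨⟨Equiv.refl _, fun _ _ => Iff.rfl, fun _ => rfl⟩⟩

theorem iso.symm {G H : LGraph} (h : G.iso H) : H.iso G := by
  obtain ⟨⟨e, ha, hl⟩⟩ := h
  refine ⟨⟨e.symm, fun v w => ?_, fun v => ?_⟩⟩
  · rw [ha]; simp
  · rw [← hl]; simp

theorem iso.trans {G H K : LGraph} (h : G.iso H) (h' : H.iso K) : G.iso K := by
  obtain ⟨⟨e, ha, hl⟩⟩ := h
  obtain ⟨⟨e', ha', hl'⟩⟩ := h'
  refine ⟨⟨e.trans e', fun v w => ?_, fun v => ?_⟩⟩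
  · rw [ha, ha']; rfl
  · simp only [Equiv.trans_apply]; rw [hl', hl]

/-- Graphs with injections to a common type with the same image and agreeing
structure are isomorphic. -/
theorem iso_of_maps {X Y : LGraph} {T : Type*} (φ : X.V → T) (ψ : Y.V → T)
    (hφ : ∀ x x', φ x = φ x' → x = x') (hψ : ∀ y y', ψ y = ψ y' → y = y')
    (h1 : ∀ x, ∃ y, ψ y = φ x) (h2 : ∀ y, ∃ x, φ x = ψ y)
    (ha : ∀ x y x' y', φ x = ψ y → φ x' = ψ y' → (X.adj x x' ↔ Y.adj y y'))
    (hl : ∀ x y, φ x = ψ y → X.label x = Y.label y) : X.iso Y := by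
  choose u hu using h1
  choose w hw using h2
  refine ⟨⟨⟨u, w, fun x => hφ _ _ ?_, fun y => hψ _ _ ?_⟩, fun x x' => ?_, fun x => ?_⟩⟩
  · rw [hw, hu]
  · rw [hu, hw]
  · exact ha _ _ _ _ (hu x).symm (hu x').symm
  · exact (hl _ _ (hu x).symm).symm

/-- Gluing two graphs along a relation. -/
def glue (G H : LGraph) (r : G.V → H.V → Prop) : LGraph where
  V := G.V ⊕ H.V
  adj x y := match x, y with
    | .inl a, .inl b => G.adj a b
    | .inr a, .inr b => H.adj a b
    | .inl a, .inr b => r a b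
    | .inr b, .inl a => r a b
  symm := by
    rintro (a | a) (b | b) h
    · exact G.symm h
    · exact h
    · exact h
    · exact H.symm h
  irrefl := by
    rintro (a | a) h
    · exact G.irrefl a h
    · exact H.irrefl a h
  label := Sum.elim G.label H.label

abbrev pp (G H : LGraph) : LGraph := glue G H (fun _ _ => False)
abbrev plg (C : LGraph) (R : Set C.V) (X : LGraph) : LGraph := glue C X (fun a _ => a ∈ R)
abbrev tn (G H : LGraph) : LGraph := glue G H (fun _ _ => True)

theorem par_eq (G H : LGraph) : G.par H = pp G H := by
  unfold par pp glue
  congr 1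
  funext x y
  rcases x with (a | a) <;> rcases y with (b | b) <;> rfl
theorem plug_eq (G : LGraph) (R : Set G.V) (H : LGraph) : G.plug R H = plg G R H := by
  unfold plug plg glue
  congr 1
theorem tensor_eq (G H : LGraph) : G.tensor H = tn G H := by
  unfold tensor tn glue
  congr 1

section glue
variable {G H : LGraph} {r : G.V → H.V → Prop}
def gl (a : G.V) : (glue G H r).V := Sum.inl a
def gr (a : H.V) : (glue G H r).V := Sum.inr a
def gelim {T : Sort*} (f : G.V → T) (g : H.V → T) : (glue G H r).V → T
  | .inl a => f a
  | .inr a => g a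
@[simp, grind =] theorem gelim_gl {T : Sort*} (f : G.V → T) (g : H.V → T) (a : G.V) :
    gelim (r := r) f g (gl a) = f a := rfl
@[simp, grind =] theorem gelim_gr {T : Sort*} (f : G.V → T) (g : H.V → T) (a : H.V) :
    gelim (r := r) f g (gr a) = g a := rfl
theorem glue_cases (x : (glue G H r).V) : (∃ a, x = gl a) ∨ (∃ a, x = gr a) := by
  rcases x with (a | a)
  exacts [Or.inl ⟨a, rfl⟩, Or.inr ⟨a, rfl⟩]
@[simp, grind =] theorem gl_inj (a b : G.V) : (gl a : (glue G H r).V) = gl b ↔ a = b := Sum.inl.injEq a b ▸ Iff.rfl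
@[simp, grind =] theorem gr_inj (a b : H.V) : (gr a : (glue G H r).V) = gr b ↔ a = b := Sum.inr.injEq a b ▸ Iff.rfl
@[simp] theorem gl_ne_gr (a : G.V) (b : H.V) : (gl a : (glue G H r).V) ≠ gr b := Sum.inl_ne_inr
@[simp] theorem gr_ne_gl (a : H.V) (b : G.V) : (gr a : (glue G H r).V) ≠ gl b := Sum.inr_ne_inl
@[grind =] theorem gl_eq_gr (a : G.V) (b : H.V) : (gl a : (glue G H r).V) = gr b ↔ False := by simp
@[grind =] theorem gr_eq_gl (a : H.V) (b : G.V) : (gr a : (glue G H r).V) = gl b ↔ False := by simp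
@[simp, grind =] theorem glue_ll (a b : G.V) : (glue G H r).adj (gl a) (gl b) ↔ G.adj a b := Iff.rfl
@[simp, grind =] theorem glue_rr (a b : H.V) : (glue G H r).adj (gr a) (gr b) ↔ H.adj a b := Iff.rfl
@[simp, grind =] theorem glue_lr (a : G.V) (b : H.V) : (glue G H r).adj (gl a) (gr b) ↔ r a b := Iff.rfl
@[simp, grind =] theorem glue_rl (a : G.V) (b : H.V) : (glue G H r).adj (gr b) (gl a) ↔ r a b := Iff.rfl
@[simp, grind =] theorem glue_label_l (a : G.V) : (glue G H r).label (gl a) = G.label a := rfl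
@[simp, grind =] theorem glue_label_r (a : H.V) : (glue G H r).label (gr a) = H.label a := rfl
@[simp] theorem glue_exists {p : (glue G H r).V → Prop} :
    (∃ x, p x) ↔ (∃ a, p (gl a)) ∨ (∃ a, p (gr a)) := by
  constructor
  · rintro ⟨x, hx⟩
    rcases glue_cases x with ⟨a, rfl⟩ | ⟨a, rfl⟩
    exacts [Or.inl ⟨a, hx⟩, Or.inr ⟨a, hx⟩]
  · rintro (⟨a, h⟩ | ⟨a, h⟩)
    exacts [⟨_, h⟩, ⟨_, h⟩]
@[simp] theorem glue_forall {p : (glue G H r).V → Prop} :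
    (∀ x, p x) ↔ (∀ a, p (gl a)) ∧ (∀ a, p (gr a)) := by
  constructor
  · exact fun h => ⟨fun a => h _, fun a => h _⟩
  · rintro ⟨h, h'⟩ x
    rcases glue_cases x with ⟨a, rfl⟩ | ⟨a, rfl⟩
    exacts [h _, h' _]
end glue

/-- Induced subgraph. -/
noncomputable def ind (G : LGraph) (s : Set G.V) : LGraph :=
  { V := ↥s
    fintype := Fintype.ofFinite _
    adj := fun x y => G.adj x.1 y.1
    symm := fun h => G.symm h
    irrefl := fun v => G.irrefl v.1
    label := fun v => G.label v.1 }

def iv {G : LGraph} {s : Set G.V} (x : (G.ind s).V) : G.V := Subtype.val (p := (· ∈ s)) x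
def im {G : LGraph} {s : Set G.V} (v : G.V) (h : v ∈ s) : (G.ind s).V := Subtype.mk (p := (· ∈ s)) v h

@[simp, grind =] theorem iv_im {G : LGraph} {s : Set G.V} (v : G.V) (h : v ∈ s) :
    iv (im v h) = v := rfl
@[simp] theorem im_iv {G : LGraph} {s : Set G.V} (v : (G.ind s).V) (h : iv v ∈ s) :
    im (iv v) h = v := rfl
@[simp, grind ←] theorem iv_mem {G : LGraph} {s : Set G.V} (x : (G.ind s).V) : iv x ∈ s :=
  Subtype.property (p := (· ∈ s)) x
theorem iv_inj {G : LGraph} {s : Set G.V} {x y : (G.ind s).V} (h : iv x = iv y) : x = y :=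
  Subtype.ext h
@[simp, grind =] theorem iv_inj_iff {G : LGraph} {s : Set G.V} {x y : (G.ind s).V} :
    iv x = iv y ↔ x = y := ⟨iv_inj, fun h => h ▸ rfl⟩
@[simp, grind =] theorem ind_adj {G : LGraph} {s : Set G.V} {x y : (G.ind s).V} :
    (G.ind s).adj x y ↔ G.adj (iv x) (iv y) := Iff.rfl
@[simp, grind =] theorem ind_label {G : LGraph} {s : Set G.V} {x : (G.ind s).V} :
    (G.ind s).label x = G.label (iv x) := rfl
theorem iv_surj {G : LGraph} {s : Set G.V} {v : G.V} (h : v ∈ s) :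
    ∃ x : (G.ind s).V, iv x = v := ⟨im v h, rfl⟩
theorem exists_iv {G : LGraph} {s : Set G.V} {v : G.V} :
    (∃ x : (G.ind s).V, iv x = v) ↔ v ∈ s := ⟨fun ⟨x, h⟩ => h ▸ iv_mem x, iv_surj⟩

/-- Same vertices, new adjacency. -/
def re (G : LGraph) (r : G.V → G.V → Prop) (hs : ∀ x y, r x y → r y x) (hi : ∀ x, ¬ r x x) :
    LGraph where
  V := G.V
  adj := r
  symm := fun h => hs _ _ h
  irrefl := hi
  label := G.label

end LGraph

theorem Dv.refl (G : LGraph) : Dv G G := Relation.ReflTransGen.refl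
theorem Dv.trans {G H K : LGraph} (h : Dv G H) (h' : Dv H K) : Dv G K :=
  Relation.ReflTransGen.trans h h'
theorem Dv.iso {G H : LGraph} (h : G.iso H) : Dv G H := Relation.ReflTransGen.single (Or.inl h)
theorem Dv.step {G H : LGraph} (h : Step GSRule G H) : Dv G H :=
  Relation.ReflTransGen.single (Or.inr h)

theorem Pv.dv {G H : LGraph} (h : Pv G) (h' : Dv G H) : Pv H := Dv.trans h h'
theorem Pv.iso {G H : LGraph} (h : Pv G) (h' : G.iso H) : Pv H := Dv.trans h (Dv.iso h')

instance : IsEmpty LGraph.empty.V := inferInstanceAs (IsEmpty Empty)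

theorem iso_of_isEmpty {G H : LGraph} (h : IsEmpty G.V) (h' : IsEmpty H.V) : G.iso H :=
  ⟨⟨Equiv.equivOfIsEmpty _ _, fun v => h.elim v, fun v => h.elim v⟩⟩

theorem Pv_of_isEmpty {G : LGraph} (h : IsEmpty G.V) : Pv G :=
  Dv.iso (iso_of_isEmpty inferInstance h)

/-- a direct constructor of isos from bijective functions -/
theorem iso_of_fun {X Y : LGraph} (φ : X.V → Y.V)
    (hφ : ∀ x x', φ x = φ x' → x = x') (h1 : ∀ y, ∃ x, φ x = y)
    (ha : ∀ x x', (X.adj x x' ↔ Y.adj (φ x) (φ x')))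
    (hl : ∀ x, X.label x = Y.label (φ x)) : X.iso Y := by
  refine iso_of_maps φ id hφ (fun _ _ h => h) (fun x => ⟨_, rfl⟩) h1 ?_ ?_
  · rintro x y x' y' rfl rfl; exact ha _ _
  · rintro x y rfl; exact hl _

/-- glued graphs: build an isomorphism out of a gluing -/
theorem glue_iso {G H Y : LGraph} {r : G.V → H.V → Prop} (φ : G.V → Y.V) (ψ : H.V → Y.V)
    (hφ : ∀ x x', φ x = φ x' → x = x') (hψ : ∀ x x', ψ x = ψ x' → x = x')
    (hd : ∀ x y, φ x ≠ ψ y) (hs : ∀ y, (∃ x, φ x = y) ∨ (∃ x, ψ x = y))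
    (h1 : ∀ x y, G.adj x y ↔ Y.adj (φ x) (φ y)) (h2 : ∀ x y, H.adj x y ↔ Y.adj (ψ x) (ψ y))
    (h3 : ∀ x y, r x y ↔ Y.adj (φ x) (ψ y))
    (l1 : ∀ x, G.label x = Y.label (φ x)) (l2 : ∀ x, H.label x = Y.label (ψ x)) :
    (glue G H r).iso Y := by
  refine iso_of_fun (gelim φ ψ) ?_ ?_ ?_ ?_
  · simp only [glue_forall]
    refine ⟨fun a => ⟨fun b h => ?_, fun b h => ?_⟩, fun a => ⟨fun b h => ?_, fun b h => ?_⟩⟩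
    · simpa using hφ _ _ h
    · exact (hd _ _ h).elim
    · exact (hd _ _ h.symm).elim
    · simpa using hψ _ _ h
  · intro y; simpa using hs y
  · simp only [glue_forall]
    refine ⟨fun a => ⟨fun b => ?_, fun b => ?_⟩, fun a => ⟨fun b => ?_, fun b => ?_⟩⟩
    · simp [h1]
    · simp [h3]
    · simp only [glue_rl, h3, gelim_gl, gelim_gr]
      exact ⟨Y.symm, Y.symm⟩
    · simp [h2]
  · simp only [glue_forall]
    exact ⟨fun a => by simp [l1], fun a => by simp [l2]⟩

theorem glue_comm (G H : LGraph) (r : G.V → H.V → Prop) :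
    (glue G H r).iso (glue H G (fun a b => r b a)) := by
  refine glue_iso gr gl ?_ ?_ ?_ ?_ ?_ ?_ ?_ ?_ ?_ <;> simp

theorem par_comm (G H : LGraph) : (pp G H).iso (pp H G) := glue_comm _ _ _

theorem glue_assoc (G H K : LGraph) (r : G.V → H.V → Prop) (s : (glue G H r).V → K.V → Prop) :
    (glue (glue G H r) K s).iso (glue G (glue H K (fun a b => s (gr a) b))
      (fun a => gelim (r a) (s (gl a)))) := by
  refine glue_iso (gelim gl (fun a => gr (gl a))) (fun a => gr (gr a)) ?_ ?_ ?_ ?_ ?_ ?_ ?_ ?_ ?_ <;>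
    simp

theorem par_assoc (G H K : LGraph) : (pp (pp G H) K).iso (pp G (pp H K)) := by
  refine glue_iso (gelim gl (fun a => gr (gl a))) (fun a => gr (gr a)) ?_ ?_ ?_ ?_ ?_ ?_ ?_ ?_ ?_ <;>
    simp

/-- Isomorphisms between glued graphs. -/
theorem iso_glue {G H G' H' : LGraph} {r : G.V → H.V → Prop} {r' : G'.V → H'.V → Prop}
    (φ : Iso G G') (ψ : Iso H H') (h : ∀ x y, r x y ↔ r' (φ.toEquiv x) (ψ.toEquiv y)) :
    (glue G H r).iso (glue G' H' r') := by
  obtain ⟨e, ha, hl⟩ := φ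
  obtain ⟨e', ha', hl'⟩ := ψ
  refine glue_iso (fun x => gl (e x)) (fun x => gr (e' x)) ?_ ?_ ?_ ?_ ?_ ?_ ?_ ?_ ?_ <;>
    simp_all
  exact ⟨fun a => ⟨e.symm a, by simp⟩, fun a => ⟨e'.symm a, by simp⟩⟩

def Iso.refl (G : LGraph) : Iso G G := ⟨Equiv.refl _, fun _ _ => Iff.rfl, fun _ => rfl⟩

theorem glue_congr {G H : LGraph} {r r' : G.V → H.V → Prop} (h : ∀ x y, r x y ↔ r' x y) :
    (glue G H r).iso (glue G H r') := iso_glue (Iso.refl _) (Iso.refl _) h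

theorem glue_empty {G H : LGraph} {r : G.V → H.V → Prop} (h : IsEmpty H.V) : (glue G H r).iso G := by
  refine glue_iso id (fun x => h.elim x) ?_ ?_ ?_ ?_ ?_ ?_ ?_ ?_ ?_ <;> simp
theorem empty_glue {G H : LGraph} {r : G.V → H.V → Prop} (h : IsEmpty G.V) : (glue G H r).iso H :=
  (glue_comm _ _ _).trans (glue_empty h)

theorem iso_plug {G H H' : LGraph} {R : Set G.V} (h : H.iso H') :
    (plg G R H).iso (plg G R H') := by
  obtain ⟨ψ⟩ := h
  exact iso_glue (Iso.refl _) ψ (fun _ _ => Iff.rfl)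

theorem iso_plug_ctx {G G' H : LGraph} {R : Set G.V} {R' : Set G'.V} (φ : Iso G G')
    (hR : ∀ x, x ∈ R ↔ φ.toEquiv x ∈ R') :
    (plg G R H).iso (plg G' R' H) :=
  iso_glue φ (Iso.refl _) (fun x _ => hR x)

theorem iso_par {G G' H H' : LGraph} (h : G.iso G') (h' : H.iso H') : (pp G H).iso (pp G' H') := by
  obtain ⟨φ⟩ := h
  obtain ⟨ψ⟩ := h'
  exact iso_glue φ ψ (fun _ _ => Iff.rfl)

def plugSet {G H : LGraph} {r : G.V → H.V → Prop} (R : Set G.V) (S : Set H.V) : Set (glue G H r).V :=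
  {x | gelim (· ∈ R) (· ∈ S) x}

@[simp, grind =] theorem plugSet_l {G H : LGraph} {r : G.V → H.V → Prop} (R : Set G.V) (S : Set H.V)
    (a : G.V) : (gl a : (glue G H r).V) ∈ plugSet R S ↔ a ∈ R := Iff.rfl
@[simp, grind =] theorem plugSet_r {G H : LGraph} {r : G.V → H.V → Prop} (R : Set G.V) (S : Set H.V)
    (a : H.V) : (gr a : (glue G H r).V) ∈ plugSet R S ↔ a ∈ S := Iff.rfl

theorem plug_plug (C D X : LGraph) (R : Set C.V) (S : Set D.V) :
    (plg (plg C R D) (plugSet R S) X).iso (plg C R (plg D S X)) := by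
  refine glue_iso (gelim gl (fun a => gr (gl a))) (fun a => gr (gr a)) ?_ ?_ ?_ ?_ ?_ ?_ ?_ ?_ ?_ <;>
    simp

theorem Dv.plug {X Y : LGraph} (C : LGraph) (R : Set C.V) (h : Dv X Y) :
    Dv (plg C R X) (plg C R Y) := by
  refine Relation.ReflTransGen.lift' (f := fun X => plg C R X) ?_ _ _ h
  rintro a b (h | ⟨C', R', p, c, hr, h1, h2⟩)
  · exact Dv.iso (iso_plug h)
  · rw [plug_eq] at h1 h2
    refine Dv.step ⟨plg C R C', plugSet R R', p, c, hr, ?_, ?_⟩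
    · rw [plug_eq]; exact (iso_plug h1).trans (plug_plug _ _ _ _ _).symm
    · rw [plug_eq]; exact (iso_plug h2).trans (plug_plug _ _ _ _ _).symm

theorem Dv.par_left {X Y : LGraph} (C : LGraph) (h : Dv X Y) : Dv (pp C X) (pp C Y) :=
  Dv.plug C ∅ h
theorem Dv.par_right {X Y : LGraph} (C : LGraph) (h : Dv X Y) : Dv (pp X C) (pp Y C) :=
  (Dv.iso (par_comm _ _)).trans ((Dv.par_left C h).trans (Dv.iso (par_comm _ _)))
theorem Dv.par {X Y X' Y' : LGraph} (h : Dv X Y) (h' : Dv X' Y') : Dv (pp X X') (pp Y Y') :=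
  (Dv.par_right _ h).trans (Dv.par_left _ h')

theorem Dv.insert {C X : LGraph} (R : Set C.V) (h : Pv X) : Dv C (plg C R X) :=
  (Dv.iso (glue_empty (H := LGraph.empty) inferInstance).symm).trans (Dv.plug C R h)

theorem Pv.plug {C X : LGraph} {R : Set C.V} (hC : Pv C) (h : Pv X) : Pv (plg C R X) :=
  hC.dv (Dv.insert R h)
theorem Pv.par {C X : LGraph} (hC : Pv C) (h : Pv X) : Pv (pp C X) :=
  (hC.plug (R := ∅) h)

theorem Dv.rule {p c : LGraph} (h : GSRule p c) : Dv p c := by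
  refine Dv.step ⟨LGraph.empty, ∅, p, c, h, ?_, ?_⟩ <;> rw [plug_eq] <;>
    exact (empty_glue inferInstance).symm

theorem Dv.ss (B A : LGraph) (S : Set B.V) : Dv (plg B S A) (pp B A) := by
  by_cases hA : Nonempty A.V
  · by_cases hS : S = ∅
    · subst hS; exact Dv.refl _
    · have := Dv.rule (.ss A B S hA hS)
      rwa [plug_eq, par_eq] at this
  · have := not_nonempty_iff.1 hA
    exact Dv.iso ((glue_empty this).trans (glue_empty this).symm)

/-! ### Sizes -/

noncomputable def sz (G : LGraph) : ℕ := Nat.card G.V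

theorem sz_iso {G H : LGraph} (h : G.iso H) : sz G = sz H := by
  obtain ⟨φ⟩ := h
  exact Nat.card_congr φ.toEquiv

theorem sz_glue (G H : LGraph) (r : G.V → H.V → Prop) : sz (glue G H r) = sz G + sz H :=
  Nat.card_sum (α := G.V) (β := H.V)

theorem sz_eq_zero {G : LGraph} : sz G = 0 ↔ IsEmpty G.V := by
  unfold sz; rw [Nat.card_eq_zero]
  exact ⟨fun h => h.resolve_right fun h' => h'.not_finite inferInstance, Or.inl⟩

theorem sz_pos {G : LGraph} : 0 < sz G ↔ Nonempty G.V := by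
  rw [Nat.pos_iff_ne_zero, Ne, sz_eq_zero, not_isEmpty_iff]

theorem sz_bigTensor (n : ℕ) (F : Fin n → LGraph) : sz (bigTensor n F) = ∑ i, sz (F i) := by
  induction n with
  | zero => simp only [Finset.univ_eq_empty, Finset.sum_empty]; exact sz_eq_zero.2 (inferInstanceAs (IsEmpty Empty))
  | succ n ih =>
    rw [bigTensor, tensor_eq, sz_glue, ih, Fin.sum_univ_succ]

theorem sz_comp (G : LGraph) (H : G.V → LGraph) : sz (G.comp H) = ∑ v, sz (H v) :=
  Nat.card_sigma (β := fun v => (H v).V)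

theorem sz_rule {p c : LGraph} (h : GSRule p c) : sz p ≤ sz c := by
  cases h with
  | ai a => exact (sz_eq_zero.2 (inferInstanceAs (IsEmpty Empty))).trans_le (Nat.zero_le _)
  | ss A B S => rw [plug_eq, par_eq, sz_glue, sz_glue]
  | p n P e M N =>
    rw [par_eq, sz_glue, sz_comp, sz_comp, sz_bigTensor]
    simp only [par_eq, sz_glue, Finset.sum_add_distrib]
    apply le_of_eq
    congr 1
    · exact (Equiv.sum_comp e (fun i => sz (M i))).symm
    · exact (Equiv.sum_comp e (fun i => sz (N i))).symm

theorem Step.sz_le {G H : LGraph} (h : Step GSRule G H) : sz G ≤ sz H := by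
  obtain ⟨C, R, p, c, hr, h1, h2⟩ := h
  rw [sz_iso h1, sz_iso h2, plug_eq, plug_eq, sz_glue, sz_glue]
  exact Nat.add_le_add_left (sz_rule hr) _

theorem Dv.sz_le {G H : LGraph} (h : Dv G H) : sz G ≤ sz H := by
  induction h with
  | refl => exact le_rfl
  | tail _ h ih =>
    refine ih.trans ?_
    rcases h with h | h
    exacts [(sz_iso h).le, h.sz_le]

/-! ### Reduction up to provable contexts -/

def URed {α : Type*} (L G : α → LGraph) : Prop :=
  ∃ (C : LGraph) (R : Set C.V), Pv C ∧ ∀ x, Dv (plg C R (L x)) (G x)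

theorem URed.of_dv {α : Type*} {L G : α → LGraph} (h : ∀ x, Dv (L x) (G x)) : URed L G :=
  ⟨LGraph.empty, ∅, Dv.refl _, fun x => (Dv.iso (empty_glue inferInstance)).trans (h x)⟩

theorem URed.plug {α : Type*} (L : α → LGraph) {C : LGraph} (R : Set C.V) (h : Pv C) :
    URed L (fun x => plg C R (L x)) := ⟨C, R, h, fun _ => Dv.refl _⟩

theorem URed.trans {α : Type*} {L G F : α → LGraph} (h : URed L G) (h' : URed G F) : URed L F := by
  obtain ⟨C, R, hC, h⟩ := h
  obtain ⟨C', R', hC', h'⟩ := h'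
  refine ⟨plg C' R' C, plugSet R' R, hC'.plug hC, fun x => ?_⟩
  exact (Dv.iso (plug_plug _ _ _ _ _)).trans ((Dv.plug _ _ (h x)).trans (h' x))

theorem URed.par {α : Type*} {L G : α → LGraph} (h : URed L G) (M : α → LGraph) :
    URed (fun x => pp (L x) (M x)) (fun x => pp (G x) (M x)) := by
  obtain ⟨C, R, hC, h⟩ := h
  refine ⟨C, R, hC, fun x => ?_⟩
  exact (Dv.iso (plug_plug _ _ _ _ ∅).symm).trans ((Dv.ss _ _ _).trans (Dv.par_right _ (h x)))

theorem URed.comp {α β : Type*} {L G : α → LGraph} (h : URed L G) (u : β → α) :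
    URed (fun x => L (u x)) (fun x => G (u x)) := by
  obtain ⟨C, R, hC, h⟩ := h
  exact ⟨C, R, hC, fun x => h _⟩

def Red (K G : LGraph) : Prop := URed (fun _ : Unit => K) (fun _ => G)

theorem Red.of_dv {K G : LGraph} (h : Dv K G) : Red K G := URed.of_dv fun _ => h
theorem Red.iso {K G : LGraph} (h : K.iso G) : Red K G := Red.of_dv (Dv.iso h)
theorem Red.refl (K : LGraph) : Red K K := Red.of_dv (Dv.refl _)
theorem Red.trans {K G H : LGraph} (h : Red K G) (h' : Red G H) : Red K H := URed.trans h h'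
theorem Red.par {K G : LGraph} (h : Red K G) (L : LGraph) : Red (pp K L) (pp G L) :=
  URed.par h _
theorem Red.par' {K G : LGraph} (h : Red K G) (L : LGraph) : Red (pp L K) (pp L G) :=
  (Red.iso (par_comm _ _)).trans ((h.par L).trans (Red.iso (par_comm _ _)))
theorem Red.plug {C K : LGraph} (R : Set C.V) (h : Pv C) : Red K (plg C R K) :=
  URed.plug _ R h
theorem Red.urd {K G : LGraph} {α : Type*} (h : Red K G) (M : α → LGraph) :
    URed (fun x => pp K (M x)) (fun x => pp G (M x)) :=
  URed.par (L := fun _ => K) (G := fun _ => G) (URed.comp h fun _ => ()) M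
theorem URed.red {α : Type*} {L G : α → LGraph} (h : URed L G) (x : α) : Red (L x) (G x) :=
  h.comp fun _ => x

theorem Pv.red {K G : LGraph} (h : Pv K) (h' : Red K G) : Pv G := by
  obtain ⟨C, R, hC, h'⟩ := h'
  exact (hC.plug h).dv (h' ())

theorem Red.of_empty {K G : LGraph} (h : IsEmpty K.V) (h' : Pv G) : Red K G :=
  (Red.plug ∅ h').trans (Red.iso (glue_empty h))

theorem Red.sz_le {K G : LGraph} (h : Red K G) : sz K ≤ sz G := by
  obtain ⟨C, R, _, h⟩ := h
  have := (h ()).sz_le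
  rw [sz_glue] at this
  exact (Nat.le_add_left _ _).trans this

/-! ### Induced subgraphs -/

theorem iso_ind {X Y : LGraph} {t : Set Y.V} (φ : X.V → Y.V)
    (hφ : ∀ x x', φ x = φ x' → x = x') (h0 : ∀ x, φ x ∈ t) (h1 : ∀ y ∈ t, ∃ x, φ x = y)
    (ha : ∀ x x', (X.adj x x' ↔ Y.adj (φ x) (φ x')))
    (hl : ∀ x, X.label x = Y.label (φ x)) : X.iso (Y.ind t) := by
  refine iso_of_fun (fun x => im (φ x) (h0 x)) ?_ ?_ ?_ ?_
  · intro x x' h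
    exact hφ _ _ (by simpa using congrArg iv h)
  · intro y
    obtain ⟨x, hx⟩ := h1 (iv y) (iv_mem y)
    exact ⟨x, iv_inj hx⟩
  · intro x x'; simp [ha]
  · intro x; simp [hl]

theorem ind_iso {X Y : LGraph} {s : Set X.V} {t : Set Y.V} (φ : X.V → Y.V)
    (hφ : ∀ x ∈ s, ∀ x' ∈ s, φ x = φ x' → x = x') (h0 : ∀ x ∈ s, φ x ∈ t)
    (h1 : ∀ y ∈ t, ∃ x ∈ s, φ x = y)
    (ha : ∀ x ∈ s, ∀ x' ∈ s, (X.adj x x' ↔ Y.adj (φ x) (φ x')))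
    (hl : ∀ x ∈ s, X.label x = Y.label (φ x)) : (X.ind s).iso (Y.ind t) := by
  refine iso_ind (fun x => φ (iv x)) ?_ ?_ ?_ ?_ ?_
  · intro x x' h
    exact iv_inj (hφ _ (iv_mem _) _ (iv_mem _) h)
  · intro x; exact h0 _ (iv_mem _)
  · intro y hy
    obtain ⟨x, hx, h⟩ := h1 y hy
    exact ⟨im x hx, h⟩
  · intro x x'; exact ha _ (iv_mem _) _ (iv_mem _)
  · intro x; exact hl _ (iv_mem _)

theorem ind_univ {X : LGraph} {s : Set X.V} (h : ∀ x, x ∈ s) : (X.ind s).iso X :=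
  iso.symm (iso_ind id (fun _ _ h => h) h (fun y _ => ⟨y, rfl⟩) (fun _ _ => Iff.rfl) (fun _ => rfl))

theorem ind_ind {X : LGraph} (s t : Set X.V) :
    ((X.ind s).ind {x | iv x ∈ t}).iso (X.ind (s ∩ t)) := by
  refine iso_ind (fun x => iv (iv x)) ?_ ?_ ?_ ?_ ?_
  · intro x x' h; exact iv_inj (iv_inj h)
  · intro x; exact ⟨iv_mem _, iv_mem x⟩
  · rintro y ⟨h1, h2⟩; exact ⟨im (im y h1) h2, rfl⟩
  · intro x x'; exact Iff.rfl
  · intro x; rfl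

theorem ind_isEmpty {X : LGraph} {s : Set X.V} (h : ∀ x, x ∉ s) : IsEmpty (X.ind s).V :=
  ⟨fun x => h _ (iv_mem x)⟩

theorem ind_nonempty {X : LGraph} {s : Set X.V} {x : X.V} (h : x ∈ s) : Nonempty (X.ind s).V :=
  ⟨im x h⟩

theorem sz_ind (X : LGraph) (s : Set X.V) : sz (X.ind s) = s.ncard := rfl

theorem sz_ind_le {X : LGraph} {s t : Set X.V} (h : s ⊆ t) : sz (X.ind s) ≤ sz (X.ind t) := by
  rw [sz_ind, sz_ind]; exact Set.ncard_le_ncard h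
theorem sz_ind_le' {X : LGraph} {s : Set X.V} : sz (X.ind s) ≤ sz X :=
  (sz_ind_le (Set.subset_univ s)).trans (sz_iso (ind_univ (fun _ => trivial))).le
theorem sz_ind_lt {X : LGraph} {s t : Set X.V} (h : s ⊆ t) {x : X.V} (hx : x ∈ t) (hx' : x ∉ s) :
    sz (X.ind s) < sz (X.ind t) := by
  rw [sz_ind, sz_ind]; exact Set.ncard_lt_ncard ⟨h, fun h' => hx' (h' hx)⟩
theorem sz_ind_lt' {X : LGraph} {s : Set X.V} {x : X.V} (hx' : x ∉ s) :
    sz (X.ind s) < sz X :=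
  (sz_ind_lt (Set.subset_univ s) trivial hx').trans_le (sz_iso (ind_univ (fun _ => trivial))).le

/-- splitting a vertex set -/
theorem ind_glue {X : LGraph} (s t u : Set X.V) (hu : ∀ x, x ∈ u ↔ x ∈ s ∨ x ∈ t)
    (hd : ∀ x ∈ s, x ∉ t) :
    (glue (X.ind s) (X.ind t) (fun x y => X.adj (iv x) (iv y))).iso (X.ind u) := by
  refine glue_iso (fun x => im (iv x) ((hu _).2 (Or.inl (iv_mem _))))
    (fun x => im (iv x) ((hu _).2 (Or.inr (iv_mem _)))) ?_ ?_ ?_ ?_ ?_ ?_ ?_ ?_ ?_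
  · intro x x' h; simpa using congrArg iv h
  · intro x x' h; simpa using congrArg iv h
  · intro x y h; exact hd _ (iv_mem x) ((show iv x = iv y from congrArg iv h) ▸ iv_mem y)
  · intro y
    rcases (hu _).1 (iv_mem y) with h | h
    · exact Or.inl ⟨im _ h, rfl⟩
    · exact Or.inr ⟨im _ h, rfl⟩
  all_goals simp

theorem ind_plug {X : LGraph} (s t u : Set X.V) (hu : ∀ x, x ∈ u ↔ x ∈ s ∨ x ∈ t)
    (hd : ∀ x ∈ s, x ∉ t)
    (hm : ∀ v ∈ s, ∀ x ∈ t, ∀ y ∈ t, X.adj v x → X.adj v y) :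
    (plg (X.ind s) {v | ∃ x ∈ t, X.adj (iv v) x} (X.ind t)).iso (X.ind u) := by
  refine iso.trans (glue_congr ?_) (ind_glue s t u hu hd)
  intro x y
  exact ⟨fun ⟨z, hz, h⟩ => hm _ (iv_mem _) _ hz _ (iv_mem _) h, fun h => ⟨_, iv_mem y, h⟩⟩

theorem ind_par {X : LGraph} (s t u : Set X.V) (hu : ∀ x, x ∈ u ↔ x ∈ s ∨ x ∈ t)
    (hd : ∀ x ∈ s, x ∉ t) (hm : ∀ v ∈ s, ∀ x ∈ t, ¬ X.adj v x) :
    (pp (X.ind s) (X.ind t)).iso (X.ind u) := by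
  refine iso.trans (glue_congr ?_) (ind_glue s t u hu hd)
  intro x y
  exact ⟨False.elim, fun h => hm _ (iv_mem x) _ (iv_mem y) h⟩

/-- inserting a provable module -/
theorem Dv.ins {X : LGraph} (s t u : Set X.V) (hu : ∀ x, x ∈ u ↔ x ∈ s ∨ x ∈ t)
    (hd : ∀ x ∈ s, x ∉ t)
    (hm : ∀ v ∈ s, ∀ x ∈ t, ∀ y ∈ t, X.adj v x → X.adj v y) (h : Pv (X.ind t)) :
    Dv (X.ind s) (X.ind u) :=
  (Dv.insert _ h).trans (Dv.iso (ind_plug s t u hu hd hm))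

theorem Red.ctx {X : LGraph} (s t u : Set X.V) (hu : ∀ x, x ∈ u ↔ x ∈ s ∨ x ∈ t)
    (hd : ∀ x ∈ s, x ∉ t)
    (hm : ∀ v ∈ s, ∀ x ∈ t, ∀ y ∈ t, X.adj v x → X.adj v y) (h : Pv (X.ind s)) :
    Red (X.ind t) (X.ind u) :=
  (Red.plug _ h).trans (Red.iso (ind_plug s t u hu hd hm))

/-- replacing a module -/
theorem Dv.rep {X : LGraph} (s t u : Set X.V) (hu : ∀ x, x ∈ u ↔ x ∈ s ∨ x ∈ t)
    (hd : ∀ x ∈ s, x ∉ t)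
    (hm : ∀ v ∈ s, ∀ x ∈ t, ∀ y ∈ t, X.adj v x → X.adj v y) {Y : LGraph} (h : Dv (X.ind t) Y) :
    Dv (X.ind u) (plg (X.ind s) {v | ∃ x ∈ t, X.adj (iv v) x} Y) :=
  (Dv.iso (ind_plug s t u hu hd hm).symm).trans (Dv.plug _ _ h)

/-- relabelling isomorphisms between graphs on the same vertex set -/
theorem iso_of_equiv {E E' : LGraph} (e : E.V ≃ E'.V) (ha : ∀ x y, E.adj x y ↔ E'.adj (e x) (e y))
    (hl : ∀ x, E'.label (e x) = E.label x) : E.iso E' := ⟨⟨e, ha, hl⟩⟩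

/-- removing all edges between a module and the rest -/
theorem Dv.ssset {E E' : LGraph} (e : E.V ≃ E'.V) (hl : ∀ x, E'.label (e x) = E.label x)
    (t : Set E.V) (ht : ∀ v, v ∉ t → ∀ x ∈ t, ∀ y ∈ t, E.adj v x → E.adj v y)
    (h : ∀ x y, E'.adj (e x) (e y) ↔ E.adj x y ∧ (x ∈ t ↔ y ∈ t)) : Dv E E' := by
  have h1 := ind_plug tᶜ t Set.univ (by intro x; simp; tauto) (by simp) (fun v hv => ht v hv)
  refine (Dv.iso (h1.trans (ind_univ (by simp))).symm).trans ((Dv.ss _ _ _).trans (Dv.iso ?_))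
  refine glue_iso (fun x => e (iv x)) (fun x => e (iv x)) ?_ ?_ ?_ ?_ ?_ ?_ ?_ ?_ ?_
  · intro x x' h; exact iv_inj (e.injective h)
  · intro x x' h; exact iv_inj (e.injective h)
  · intro x y h
    have := e.injective h
    have h2 := iv_mem x
    rw [this] at h2
    exact h2 (iv_mem y)
  · intro y
    by_cases hy : e.symm y ∈ t
    · right; exact ⟨im _ hy, by simp⟩
    · left; exact ⟨im _ hy, by simp⟩
  · intro x y
    have h1 : iv x ∉ t := iv_mem x
    have h2 : iv y ∉ t := iv_mem y
    simp [h, h1, h2]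
  · intro x y; simp [h]
  · intro x y
    have h1 : iv x ∉ t := iv_mem x
    simp [h, h1]
  · intro x; simp [hl]
  · intro x; simp [hl]

def reE (E : LGraph) (r : E.V → E.V → Prop) (hs : ∀ x y, r x y → r y x) (hi : ∀ x, ¬ r x x) :
    E.V ≃ (E.re r hs hi).V := Equiv.refl _
@[simp] theorem re_adj {E : LGraph} {r : E.V → E.V → Prop} {hs : ∀ x y, r x y → r y x}
    {hi : ∀ x, ¬ r x x} (x y : E.V) :
    (E.re r hs hi).adj (reE E r hs hi x) (reE E r hs hi y) ↔ r x y := Iff.rfl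
@[simp] theorem re_label {E : LGraph} {r : E.V → E.V → Prop} {hs : ∀ x y, r x y → r y x}
    {hi : ∀ x, ¬ r x x} (x : E.V) :
    (E.re r hs hi).label (reE E r hs hi x) = E.label x := rfl

theorem Dv.ext_aux {ι : Type*} [DecidableEq ι] (F : Finset ι) : ∀ {E E' : LGraph} (e : E.V ≃ E'.V)
    (_ : ∀ x, E'.label (e x) = E.label x) (k : E.V → Option ι) (_ : ∀ x i, k x = some i → i ∈ F)
    (_ : ∀ i v, k v ≠ some i → ∀ x, k x = some i → ∀ y, k y = some i → E.adj v x → E.adj v y)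
    (_ : ∀ x y, E'.adj (e x) (e y) ↔ E.adj x y ∧ k x = k y), Dv E E' := by
  induction F using Finset.induction_on with
  | empty =>
    intro E E' e hl k hk hm h
    have hk : ∀ x, k x = none := fun x => by
      rw [Option.eq_none_iff_forall_ne_some]; exact fun i hi => by simpa using hk x i hi
    exact Dv.iso (iso_of_equiv e (fun x y => by rw [h]; simp [hk]) hl)
  | insert i F hi ih =>
    intro E E' e hl k hk hm h
    let E1 := E.re (fun x y => E.adj x y ∧ (k x = some i ↔ k y = some i))
      (fun x y h => ⟨E.symm h.1, h.2.symm⟩) (fun x h => E.irrefl x h.1)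
    have d1 : Dv E E1 := by
      refine Dv.ssset (reE _ _ _ _) (fun _ => rfl) {x | k x = some i} (hm i) ?_
      intro x y; exact Iff.rfl
    refine d1.trans (ih (E := E1) (E' := E') e hl (fun x : E.V => if k x = some i then none else k x) ?_ ?_ ?_)
    · intro x j hx
      have : k x ≠ some i ∧ k x = some j := by
        by_cases h : k x = some i
        · simp [h] at hx
        · exact ⟨h, by simpa [h] using hx⟩
      have h2 := hk x j this.2
      rcases Finset.mem_insert.1 h2 with rfl | h
      · exact (this.1 this.2).elim
      · exact h
    · intro j v hv x hx y hy hvx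
      have hx' : k x ≠ some i ∧ k x = some j := by
        by_cases h : k x = some i
        · simp [h] at hx
        · exact ⟨h, by simpa [h] using hx⟩
      have hy' : k y ≠ some i ∧ k y = some j := by
        by_cases h : k y = some i
        · simp [h] at hy
        · exact ⟨h, by simpa [h] using hy⟩
      have hvx' : E.adj v x ∧ (k v = some i ↔ k x = some i) := hvx
      show E.adj v y ∧ (k v = some i ↔ k y = some i)
      have hvi : k v ≠ some i := fun h => hx'.1 (hvx'.2.1 h)
      refine ⟨hm j v ?_ x hx'.2 y hy'.2 hvx'.1, by simp [hvi, hy'.1]⟩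
      simpa [hvi] using hv
    · intro x y
      refine (h x y).trans ?_
      show _ ↔ (E.adj x y ∧ (k x = some i ↔ k y = some i)) ∧ _
      by_cases hx : k x = some i <;> by_cases hy : k y = some i <;> simp [hx, hy]
      · exact fun _ h => hy h.symm

/-- removing all edges between the modules `k ⁻¹ (some i)` and everything else -/
theorem Dv.ext {ι : Type*} {E E' : LGraph} (e : E.V ≃ E'.V)
    (hl : ∀ x, E'.label (e x) = E.label x) (k : E.V → Option ι)
    (hm : ∀ i v, k v ≠ some i → ∀ x, k x = some i → ∀ y, k y = some i → E.adj v x → E.adj v y)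
    (h : ∀ x y, E'.adj (e x) (e y) ↔ E.adj x y ∧ k x = k y) : Dv E E' := by
  classical
  refine Dv.ext_aux ((Finset.univ.image k).biUnion Option.toFinset) e hl k ?_ hm h
  intro x i hx
  simp only [Finset.mem_biUnion, Finset.mem_image, Finset.mem_univ, true_and, Option.mem_toFinset]
  exact ⟨_, ⟨x, rfl⟩, hx⟩

/-- inserting several provable modules -/
theorem Dv.insmulti_aux {ι : Type*} [DecidableEq ι] {E : LGraph} (F : E.V → ι) (Z : Finset ι)
    (hm : ∀ z ∈ Z, ∀ v, F v ≠ z → ∀ x, F x = z → ∀ y, F y = z → E.adj v x → E.adj v y)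
    (hp : ∀ z ∈ Z, Pv (E.ind {x | F x = z})) : Dv (E.ind {x | F x ∉ Z}) E := by
  induction Z using Finset.induction_on with
  | empty => exact Dv.iso (ind_univ (by simp))
  | insert z Z hz ih =>
    refine Dv.trans ?_ (ih (fun z hz => hm z (by simp [hz])) (fun z hz => hp z (by simp [hz])))
    refine Dv.ins _ {x | F x = z} _ ?_ ?_ ?_ (hp z (by simp))
    · intro x
      simp only [Set.mem_ofPred_eq, Finset.mem_insert]
      constructor
      · tauto
      · rintro (h | h)
        · tauto
        · rw [h]; exact hz
    · intro x; simp only [Set.mem_ofPred_eq, Finset.mem_insert]; tauto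
    · intro v hv x hx y hy h
      refine hm z (by simp) v ?_ x hx y hy h
      simp only [Set.mem_ofPred_eq, Finset.mem_insert] at hv; tauto

theorem Dv.insmulti {ι : Type*} {E : LGraph} (F : E.V → ι) (Z : Set ι)
    (hm : ∀ z ∈ Z, ∀ v, F v ≠ z → ∀ x, F x = z → ∀ y, F y = z → E.adj v x → E.adj v y)
    (hp : ∀ z ∈ Z, Pv (E.ind {x | F x = z})) : Dv (E.ind {x | F x ∉ Z}) E := by
  classical
  have := Dv.insmulti_aux F ((Finset.univ.image F).filter (· ∈ Z)) (fun z hz => hm z (by simp at hz; exact hz.2))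
    (fun z hz => hp z (by simp at hz; exact hz.2))
  convert this using 3
  ext x; simp

theorem Pv.insmulti {ι : Type*} {E : LGraph} (F : E.V → ι)
    (hm : ∀ z, ∀ v, F v ≠ z → ∀ x, F x = z → ∀ y, F y = z → E.adj v x → E.adj v y)
    (hp : ∀ z, Pv (E.ind {x | F x = z})) : Pv E :=
  Pv.dv (Pv_of_isEmpty (ind_isEmpty (by simp)))
    (Dv.insmulti F Set.univ (fun z _ => hm z) (fun z _ => hp z))

/-! ### Tensors along a map, and the rule p -/

def tens {ι : Type*} (E : LGraph) (f : E.V → ι) : LGraph :=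
  E.re (fun x y => (f x = f y ∧ E.adj x y) ∨ f x ≠ f y)
    (fun x y h => by
      rcases h with ⟨h, h'⟩ | h
      exacts [Or.inl ⟨h.symm, E.symm h'⟩, Or.inr h.symm])
    (fun x h => by
      rcases h with ⟨_, h⟩ | h
      exacts [E.irrefl x h, h rfl])

def tv {ι : Type*} (E : LGraph) (f : E.V → ι) : E.V ≃ (tens E f).V := Equiv.refl _
@[simp] theorem tens_adj {ι : Type*} {E : LGraph} {f : E.V → ι} (x y : E.V) :
    (tens E f).adj (tv E f x) (tv E f y) ↔ (f x = f y ∧ E.adj x y) ∨ f x ≠ f y := Iff.rfl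
@[simp] theorem tens_label {ι : Type*} {E : LGraph} {f : E.V → ι} (x : E.V) :
    (tens E f).label (tv E f x) = E.label x := rfl

theorem tens_bigTensor (n : ℕ) : ∀ (F : Fin n → LGraph) (E : LGraph) (f : E.V → Fin n)
    (_ : ∀ i, (F i).iso (E.ind {x | f x = i})), (bigTensor n F).iso (tens E f) := by
  induction n with
  | zero =>
    intro F E f h
    exact iso_of_isEmpty (inferInstanceAs (IsEmpty Empty)) ⟨fun x => (f x).elim0⟩
  | succ n ih =>
    intro F E f h
    rw [bigTensor, tensor_eq]
    have hne : ∀ x : (E.ind {x | f x ≠ 0}).V, f (iv x) ≠ 0 := fun x => iv_mem x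
    have h2 := ih (fun i => F i.succ) (E.ind {x | f x ≠ 0}) (fun x => (f (iv x)).pred (hne x)) ?_
    · obtain ⟨φ⟩ := h 0
      obtain ⟨ψ⟩ := h2
      refine (iso_glue φ ψ (r' := fun _ _ => True) (fun _ _ => Iff.rfl)).trans ?_
      refine glue_iso (fun x => tv E f (iv x)) (fun x => tv E f (iv ((tv _ _).symm x))) ?_ ?_ ?_ ?_ ?_ ?_ ?_ ?_ ?_
      · intro x x' h; simpa using h
      · intro x x' h; simpa using h
      · intro x y h
        have h1 : iv x = iv ((tv _ _).symm y) := by simpa using h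
        have h2 := hne ((tv _ _).symm y)
        rw [← h1] at h2
        exact h2 (iv_mem x)
      · intro y
        by_cases hy : f ((tv _ _).symm y) = 0
        · exact Or.inl ⟨im _ hy, by simp⟩
        · exact Or.inr ⟨tv _ _ (im _ hy), by simp⟩
      · intro x y
        have h1 : f (iv x) = 0 := iv_mem x
        have h2 : f (iv y) = 0 := iv_mem y
        simp [h1, h2]
      · intro x y
        obtain ⟨x, rfl⟩ := (tv _ _).surjective x
        obtain ⟨y, rfl⟩ := (tv _ _).surjective y
        simp
      · intro x y
        obtain ⟨y, rfl⟩ := (tv _ _).surjective y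
        have h1 : f (iv x) = 0 := iv_mem x
        have h2 := hne y
        simp [h1, h2.symm]
      · intro x; simp
      · intro x
        obtain ⟨x, rfl⟩ := (tv _ _).surjective x
        simp
    · intro i
      refine (h i.succ).trans ?_
      refine iso.trans ?_ (iso.symm (iso.trans ?_ (ind_ind {x | f x ≠ 0} {x | f x = i.succ})))
      · refine ind_iso id (fun _ _ _ _ h => h) ?_ ?_ (fun _ _ _ _ => Iff.rfl) (fun _ _ => rfl)
        · intro x hx
          have hx : f x = i.succ := hx
          refine ⟨?_, hx⟩
          show f x ≠ 0
          rw [hx]; exact Fin.succ_ne_zero i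
        · rintro x ⟨_, hx⟩; exact ⟨x, hx, rfl⟩
      · refine ind_iso id (fun _ _ _ _ h => h) ?_ ?_ (fun _ _ _ _ => Iff.rfl) (fun _ _ => rfl)
        · intro x hx
          have hx : (f (iv x)).pred (hne x) = i := hx
          show f (iv x) = i.succ
          rw [← hx]; simp
        · intro x hx
          have hx : f (iv x) = i.succ := hx
          refine ⟨x, ?_, rfl⟩
          show (f (iv x)).pred (hne x) = i
          rw [Fin.pred_eq_iff_eq_succ]; exact hx

/-- Coloured graphs: two graphs (coloured by a Boolean) in parallel, whose adjacency across the
fibres of `f` is given by `q` (colour `true`) resp. `¬ q` (colour `false`). -/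
structure CG {ι : Type*} (E : LGraph) (col : E.V → Bool) (f : E.V → ι) (q : ι → ι → Prop) : Prop where
  qs : ∀ i j, q i j → q j i
  nc : ∀ x y, E.adj x y → col x = col y
  cr : ∀ x y, f x ≠ f y → (E.adj x y ↔ col x = col y ∧ (q (f x) (f y) ↔ col x = true))

theorem pset_aux {ι : Type} [Finite ι] {E : LGraph} {col : E.V → Bool} {f : E.V → ι}
    {q : ι → ι → Prop} (h : CG E col f q) (hc : 4 ≤ Nat.card ι)
    (hpr : ∀ M : Set ι, (∀ v ∉ M, ∀ x ∈ M, ∀ y ∈ M, q v x → q v y) →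
      M = ∅ ∨ (∃ v, M = {v}) ∨ M = Set.univ)
    (hne : ∀ i, ∃ x, f x = i ∧ col x = false) : Dv (tens E f) E := by
  classical
  have : Fintype ι := Fintype.ofFinite ι
  obtain ⟨n, ⟨e⟩⟩ := Finite.exists_equiv_fin ι
  have hn : n = Nat.card ι := by
    rw [Nat.card_congr e]; simp
  let P : LGraph :=
    { V := ι
      adj := fun i j => i ≠ j ∧ q i j
      symm := fun hh => ⟨hh.1.symm, h.qs _ _ hh.2⟩
      irrefl := fun v hh => hh.1 rfl
      label := fun _ => (0, true) }
  let M : Fin n → LGraph := fun i => E.ind {x | f x = e.symm i ∧ col x = false}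
  let N : Fin n → LGraph := fun i => E.ind {x | f x = e.symm i ∧ col x = true}
  have hP : P.Prime := by
    refine ⟨?_, fun m hm => hpr m ?_⟩
    · show 2 ≤ Fintype.card ι
      rw [← Nat.card_eq_fintype_card]; omega
    · intro v hv x hx y hy hq
      exact ((hm v hv x hx y hy).1 ⟨fun h => hv (h ▸ hx), hq⟩).2
  have hM : ∀ i, Nonempty (M i).V := by
    intro i
    obtain ⟨x, hx⟩ := hne (e.symm i)
    exact ⟨im x hx⟩
  have hr := Dv.rule (GSRule.p n P e M N hP (hn ▸ hc) hM)
  refine Dv.trans (Dv.iso (iso.symm ?_)) (Dv.trans hr (Dv.iso ?_))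
  · refine (tens_bigTensor n _ E (fun x => e (f x)) ?_).trans ?_
    · intro i
      rw [par_eq]
      refine ind_par _ _ _ ?_ ?_ ?_
      · intro x
        simp only [Set.mem_ofPred_eq, Equiv.eq_symm_apply]
        cases col x <;> simp
      · rintro x ⟨_, h1⟩ ⟨_, h2⟩; simp [h1] at h2
      · rintro x ⟨_, h1⟩ y ⟨_, h2⟩ ha
        have := h.nc _ _ ha
        simp [h1, h2] at this
    · refine iso_of_equiv ((tv _ _).symm.trans (tv _ _)) ?_ ?_
      · intro x y
        obtain ⟨x, rfl⟩ := (tv _ _).surjective x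
        obtain ⟨y, rfl⟩ := (tv _ _).surjective y
        simp
      · intro x
        obtain ⟨x, rfl⟩ := (tv _ _).surjective x
        simp
  · rw [par_eq]
    have key : ∀ (b : Bool) (v : ι) (x : (E.ind {x | f x = e.symm (e v) ∧ col x = b}).V), f (iv x) = v :=
      fun b v x => (iv_mem x).1.trans (e.symm_apply_apply v)
    have keyc : ∀ (b : Bool) (v : ι) (x : (E.ind {x | f x = e.symm (e v) ∧ col x = b}).V), col (iv x) = b :=
      fun b v x => (iv_mem x).2
    have inj : ∀ (b : Bool) (v w : ι) (x : (E.ind {x | f x = e.symm (e v) ∧ col x = b}).V)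
      (y : (E.ind {x | f x = e.symm (e w) ∧ col x = b}).V), iv x = iv y →
      (⟨v, x⟩ : Σ v : ι, (E.ind {x | f x = e.symm (e v) ∧ col x = b}).V) = ⟨w, y⟩ := by
      intro b v w x y hxy
      obtain rfl : v = w := by rw [← key b v x, ← key b w y, hxy]
      rw [iv_inj hxy]
    have ad : ∀ (b : Bool) (v w : ι) (x : (E.ind {x | f x = e.symm (e v) ∧ col x = b}).V)
      (y : (E.ind {x | f x = e.symm (e w) ∧ col x = b}).V), v = w →
       ((∃ (u : ι) (a c : (E.ind {x | f x = e.symm (e u) ∧ col x = b}).V),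
        (⟨v, x⟩ : Σ v : ι, (E.ind {x | f x = e.symm (e v) ∧ col x = b}).V) = ⟨u, a⟩ ∧
        (⟨w, y⟩ : Σ v : ι, (E.ind {x | f x = e.symm (e v) ∧ col x = b}).V) = ⟨u, c⟩ ∧
        (E.ind {x | f x = e.symm (e u) ∧ col x = b}).adj a c) ↔ E.adj (iv x) (iv y)) := by
      rintro b v w x y rfl
      constructor
      · rintro ⟨u, a, c, h1, h2, h3⟩
        cases h1; cases h2; exact h3
      · intro h3; exact ⟨v, x, y, rfl, rfl, h3⟩
    refine glue_iso (fun x : (Σ v : ι, (M (e v)).V) => iv x.2) (fun x : (Σ v : ι, (N (e v)).V) => iv x.2)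
      ?_ ?_ ?_ ?_ ?_ ?_ ?_ ?_ ?_
    · rintro ⟨v, x⟩ ⟨w, y⟩ hxy; exact inj false v w x y hxy
    · rintro ⟨v, x⟩ ⟨w, y⟩ hxy; exact inj true v w x y hxy
    · rintro ⟨v, x⟩ ⟨w, y⟩ hxy
      have h1 := keyc false v x
      have h2 := keyc true w y
      rw [show iv x = iv y from hxy, h2] at h1
      simp at h1
    · intro y
      rcases hy : col y with _ | _
      · left; exact ⟨⟨f y, im y ⟨by simp, hy⟩⟩, rfl⟩
      · right; exact ⟨⟨f y, im y ⟨by simp, hy⟩⟩, rfl⟩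
    · rintro ⟨v, x⟩ ⟨w, y⟩
      have hx := key false v x
      have hy := key false w y
      by_cases hvw : v = w
      · refine Iff.trans ?_ (ad false v w x y hvw)
        exact ⟨fun h => h.resolve_right fun h' => h'.1 hvw, Or.inl⟩
      · have h1 := h.cr (iv x) (iv y) (by rw [hx, hy]; exact hvw)
        rw [hx, hy, keyc false v x, keyc false w y] at h1
        refine Iff.trans ?_ h1.symm
        constructor
        · rintro (⟨u, a, c, h1, h2, h3⟩ | ⟨_, _, h4⟩)
          · exact (hvw ((congrArg Sigma.fst h1).trans (congrArg Sigma.fst h2).symm)).elim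
          · have : ¬ (v ≠ w ∧ q v w) := h4
            simp; tauto
        · intro h4
          refine Or.inr ⟨hvw, hvw, ?_⟩
          show ¬ (v ≠ w ∧ q v w)
          simp at h4; tauto
    · rintro ⟨v, x⟩ ⟨w, y⟩
      have hx := key true v x
      have hy := key true w y
      by_cases hvw : v = w
      · refine Iff.trans ?_ (ad true v w x y hvw)
        exact ⟨fun h => h.resolve_right fun h' => h'.1 hvw, Or.inl⟩
      · have h1 := h.cr (iv x) (iv y) (by rw [hx, hy]; exact hvw)
        rw [hx, hy, keyc true v x, keyc true w y] at h1
        refine Iff.trans ?_ h1.symm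
        constructor
        · rintro (⟨u, a, c, h1, h2, h3⟩ | ⟨_, _, h4⟩)
          · exact (hvw ((congrArg Sigma.fst h1).trans (congrArg Sigma.fst h2).symm)).elim
          · have : q v w := h4
            simp; tauto
        · intro h4
          exact Or.inr ⟨hvw, hvw, by simpa using h4⟩
    · rintro ⟨v, x⟩ ⟨w, y⟩
      refine ⟨False.elim, fun ha => ?_⟩
      have := h.nc _ _ ha
      rw [show col (iv x) = false from keyc false v x, show col (iv y) = true from keyc true w y] at this
      simp at this
    · rintro ⟨v, x⟩; rfl
    · rintro ⟨v, x⟩; rfl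

theorem CG.not {ι : Type*} {E : LGraph} {col : E.V → Bool} {f : E.V → ι} {q : ι → ι → Prop}
    (h : CG E col f q) : CG E (fun x => !(col x)) f (fun i j => ¬ q i j) := by
  refine ⟨fun i j hij hji => hij (h.qs _ _ hji), fun x y hxy => by rw [h.nc _ _ hxy], ?_⟩
  intro x y hxy
  rw [h.cr x y hxy]
  cases col x <;> cases col y <;> simp

theorem pset {ι : Type} [Finite ι] {E : LGraph} {col : E.V → Bool} {f : E.V → ι}
    {q : ι → ι → Prop} (h : CG E col f q) (hc : 4 ≤ Nat.card ι)
    (hpr : ∀ M : Set ι, (∀ v ∉ M, ∀ x ∈ M, ∀ y ∈ M, q v x → q v y) →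
      M = ∅ ∨ (∃ v, M = {v}) ∨ M = Set.univ)
    (b : Bool) (hne : ∀ i, ∃ x, f x = i ∧ col x = b) : Dv (tens E f) E := by
  cases b
  · exact pset_aux h hc hpr hne
  · refine pset_aux h.not hc ?_ ?_
    · intro M hM
      refine hpr M fun v hv x hx y hy hq => ?_
      by_contra h'
      exact hM v hv y hy x hx h' hq
    · intro i
      obtain ⟨x, h1, h2⟩ := hne i
      exact ⟨x, h1, by simp [h2]⟩

/-! ### Provability of coloured graphs -/

abbrev plugC {ι : Type} (E : LGraph) (col : E.V → Bool) (f : E.V → ι) (r : ι → Prop)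
    (Z : LGraph) (cz : Z.V → Bool) : LGraph :=
  glue E Z (fun a z => col a = cz z ∧ (r (f a) ↔ cz z = true))

def NC (Z : LGraph) (cz : Z.V → Bool) : Prop := ∀ x y, Z.adj x y → cz x = cz y

def L1cS (m : ℕ) : Prop := ∀ (ι : Type) (E : LGraph) (col : E.V → Bool) (f : E.V → ι)
  (q : ι → ι → Prop), CG E col f q → (∀ i, Pv (E.ind {x | f x = i})) → (Set.range f).ncard < m →
  ∀ r : ι → Prop, ∃ (C : LGraph) (R : Set C.V), Pv C ∧ ∀ (Z : LGraph) (cz : Z.V → Bool), NC Z cz →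
    Nonempty Z.V → Dv (plg C R Z) (plugC E col f r Z cz)

theorem CG.ind {ι : Type*} {E : LGraph} {col : E.V → Bool} {f : E.V → ι} {q : ι → ι → Prop}
    (h : CG E col f q) (s : Set E.V) :
    CG (E.ind s) (fun x => col (iv x)) (fun x => f (iv x)) q :=
  ⟨h.qs, fun x y hxy => h.nc _ _ hxy, fun x y hxy => h.cr _ _ hxy⟩

theorem fib_ind {ι : Type*} {E : LGraph} {f : E.V → ι} (h : ∀ i, Pv (E.ind {x | f x = i}))
    (J : Set ι) (i : ι) : Pv ((E.ind {x | f x ∈ J}).ind {x | f (iv x) = i}) := by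
  by_cases hi : i ∈ J
  · refine (h i).iso (iso.symm ((ind_ind {x | f x ∈ J} {x | f x = i}).trans ?_))
    have : {x | f x ∈ J} ∩ {x | f x = i} = {x | f x = i} := by
      ext x; simp; rintro rfl; exact hi
    rw [this]; exact iso.refl _
  · refine Pv_of_isEmpty (ind_isEmpty fun x hx => hi ?_)
    have h1 : f (iv x) ∈ J := iv_mem x
    rwa [show f (iv x) = i from hx] at h1

theorem ncard_range_ind {ι : Type*} {E : LGraph} {f : E.V → ι} (s : Set E.V) {j : ι}
    (hj : j ∈ Set.range f) (hs : ∀ x ∈ s, f x ≠ j) :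
    (Set.range (fun x : (E.ind s).V => f (iv x))).ncard < (Set.range f).ncard := by
  refine Set.ncard_lt_ncard ⟨?_, fun h => ?_⟩ (Set.finite_range f)
  · rintro _ ⟨x, rfl⟩; exact ⟨_, rfl⟩
  · obtain ⟨x, hx⟩ := h hj
    exact hs _ (iv_mem x) hx

theorem L1_of {m : ℕ} (hm : L1cS m) {ι : Type} {E : LGraph} {col : E.V → Bool} {f : E.V → ι}
    {q : ι → ι → Prop} (h : CG E col f q) (hp : ∀ i, Pv (E.ind {x | f x = i}))
    (hc : (Set.range f).ncard ≤ m) : Pv E := by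
  by_cases hE : Nonempty E.V
  · obtain ⟨x0⟩ := hE
    obtain ⟨C, R, hC, hZ⟩ := hm ι (E.ind {x | f x ∈ ({f x0}ᶜ : Set ι)}) _ _ q (h.ind _) (fib_ind hp _)
      ((ncard_range_ind _ (j := f x0) ⟨x0, rfl⟩ (fun x hx => hx)).trans_le hc) (fun i => q i (f x0))
    have h1 := hZ (E.ind {x | f x = f x0}) (fun x => col (iv x)) (fun x y hxy => h.nc _ _ hxy) ⟨im x0 rfl⟩
    refine ((hC.plug (hp (f x0))).dv h1).iso ?_
    refine iso.trans (glue_congr ?_) ((ind_glue {x | f x ∈ ({f x0}ᶜ : Set ι)} {x | f x = f x0} Set.univ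
      ?_ ?_).trans (ind_univ (by simp)))
    · intro x y
      have h1 : f (iv x) ≠ f x0 := iv_mem x
      have h2 : f (iv y) = f x0 := iv_mem y
      rw [h.cr (iv x) (iv y) (by rw [h2]; exact h1), h2]
      refine and_congr_right fun h3 => ?_
      have h3 : col (iv x) = col (iv y) := h3
      show (q (f (iv x)) (f x0) ↔ col (iv y) = true) ↔ _
      rw [h3]
    · intro x; simp; tauto
    · intro x hx hx'; exact hx hx'
  · exact Pv_of_isEmpty (not_nonempty_iff.1 hE)

theorem L1c_e {m : ℕ} (hm : L1cS m) {ι : Type} {E : LGraph} {col : E.V → Bool} {f : E.V → ι}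
    {q : ι → ι → Prop} (h : CG E col f q) (hp : ∀ i, Pv (E.ind {x | f x = i}))
    (hc : (Set.range f).ncard ≤ m) (r : ι → Prop) (j : ι) (hj : j ∈ Set.range f) (b : Bool)
    (hb : ∀ x, f x = j → col x = b) :
    ∃ (C : LGraph) (R : Set C.V), Pv C ∧ ∀ (Z : LGraph) (cz : Z.V → Bool), NC Z cz →
    Nonempty Z.V → Dv (plg C R Z) (plugC E col f r Z cz) := by
  obtain ⟨C, R, hC, hZ⟩ := hm ι (E.ind {x | f x ∈ ({j}ᶜ : Set ι)}) _ _ q (h.ind _) (fib_ind hp _)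
      ((ncard_range_ind _ hj (fun x hx => hx)).trans_le hc) r
  refine ⟨C, R, hC, fun Z cz hnc hne => (hZ Z cz hnc hne).trans ?_⟩
  let t : Set (plugC E col f r Z cz).V := {y | ∃ x, y = gl x ∧ f x = j}
  have h1 : (plugC (E.ind {x | f x ∈ ({j}ᶜ : Set ι)}) (fun x => col (iv x)) (fun x => f (iv x)) r Z cz).iso
      ((plugC E col f r Z cz).ind tᶜ) := by
    refine iso_ind (gelim (fun x => gl (iv x)) gr) ?_ ?_ ?_ ?_ ?_
    · simp
    · rw [glue_forall]
      refine ⟨fun a => ?_, fun a => ?_⟩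
      · rintro ⟨x, h1, h2⟩
        have h1 : iv a = x := by simpa using h1
        have h3 : f (iv a) ≠ j := iv_mem a
        exact h3 (h1 ▸ h2)
      · rintro ⟨x, h1, h2⟩; simp at h1
    · rw [glue_forall]
      refine ⟨fun a ha => ?_, fun a ha => ⟨gr a, rfl⟩⟩
      refine ⟨gl (im a fun hh => ha ⟨a, rfl, hh⟩), rfl⟩
    · simp
    · simp
  have h2 : (E.ind {x | f x = j}).iso ((plugC E col f r Z cz).ind t) := by
    refine iso_ind (fun x => gl (iv x)) ?_ ?_ ?_ ?_ ?_
    · simp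
    · intro x; exact ⟨_, rfl, iv_mem x⟩
    · rintro _ ⟨x, rfl, hx⟩; exact ⟨im x hx, rfl⟩
    · simp
    · simp
  refine (Dv.iso h1).trans (Dv.trans (Dv.ins tᶜ t Set.univ ?_ ?_ ?_ ((hp j).iso h2)) (Dv.iso (ind_univ (by simp))))
  · intro x; simp; tauto
  · intro x hx; exact hx
  · rw [glue_forall]
    refine ⟨fun v hv => ?_, fun v hv => ?_⟩
    · rintro _ ⟨x, rfl, hx⟩ _ ⟨y, rfl, hy⟩
      have hv : f v ≠ j := fun h => hv ⟨v, rfl, h⟩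
      simp only [glue_ll]
      rw [h.cr v x (by rw [hx]; exact hv), h.cr v y (by rw [hy]; exact hv), hx, hy, hb x hx, hb y hy]
      exact id
    · rintro _ ⟨x, rfl, hx⟩ _ ⟨y, rfl, hy⟩
      simp only [glue_rl]
      rw [hx, hy, hb x hx, hb y hy]
      exact id

theorem L1c_a {m : ℕ} (hm : L1cS m) {ι : Type} {E : LGraph} {col : E.V → Bool} {f : E.V → ι}
    {q : ι → ι → Prop} (h : CG E col f q) (hp : ∀ i, Pv (E.ind {x | f x = i}))
    (hc : (Set.range f).ncard ≤ m) (r : ι → Prop) (Z0 : Set ι) (hZ0 : Z0 ⊆ Set.range f) (z0 z1 : ι)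
    (hz0 : z0 ∈ Z0) (hz1 : z1 ∈ Z0) (hz : z0 ≠ z1) (hr : ∀ z ∈ Z0, ∀ z' ∈ Z0, r z → r z')
    (hq : ∀ j ∈ Set.range f, j ∉ Z0 → ∀ z ∈ Z0, ∀ z' ∈ Z0, q j z → q j z') :
    ∃ (C : LGraph) (R : Set C.V), Pv C ∧ ∀ (Z : LGraph) (cz : Z.V → Bool), NC Z cz →
    Nonempty Z.V → Dv (plg C R Z) (plugC E col f r Z cz) := by
  classical
  let f' : E.V → ι := fun x => if f x ∈ Z0 then z0 else f x
  have f1 : ∀ x, f x ∈ Z0 → f' x = z0 := fun x hx => by simp [f', hx]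
  have f2 : ∀ x, f x ∉ Z0 → f' x = f x := fun x hx => by simp [f', hx]
  have h' : CG E col f' q := by
    refine ⟨h.qs, h.nc, fun x y hxy => ?_⟩
    have hxy' : f x ≠ f y := fun h => hxy (by simp [f', h])
    have e1 : q (f x) (f y) ↔ q (f' x) (f' y) := by
      by_cases hx : f x ∈ Z0 <;> by_cases hy : f y ∈ Z0
      · exact (hxy (by rw [f1 x hx, f1 y hy])).elim
      · rw [f1 x hx, f2 y hy]
        constructor
        · intro hh; exact h.qs _ _ (hq _ ⟨y, rfl⟩ hy _ hx _ hz0 (h.qs _ _ hh))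
        · intro hh; exact h.qs _ _ (hq _ ⟨y, rfl⟩ hy _ hz0 _ hx (h.qs _ _ hh))
      · rw [f2 x hx, f1 y hy]
        exact ⟨hq _ ⟨x, rfl⟩ hx _ hy _ hz0, hq _ ⟨x, rfl⟩ hx _ hz0 _ hy⟩
      · rw [f2 x hx, f2 y hy]
    rw [h.cr x y hxy', e1]
  have hp' : ∀ i, Pv (E.ind {x | f' x = i}) := by
    intro i
    by_cases hi : i = z0
    · subst hi
      have e1 : {x | f' x = i} = {x | f x ∈ Z0} := by
        ext x
        show f' x = i ↔ f x ∈ Z0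
        constructor
        · intro hx
          by_contra hn
          rw [f2 x hn] at hx
          exact hn (hx ▸ hz0)
        · exact f1 x
      rw [e1]
      refine L1_of hm (h.ind _) (fib_ind hp Z0) (le_trans ?_ hc)
      refine Set.ncard_le_ncard ?_ (Set.finite_range f)
      rintro _ ⟨x, rfl⟩; exact ⟨_, rfl⟩
    · by_cases hi2 : i ∈ Z0
      · refine Pv_of_isEmpty (ind_isEmpty fun x hx => ?_)
        have hx : f' x = i := hx
        by_cases hn : f x ∈ Z0
        · rw [f1 x hn] at hx; exact hi hx.symm
        · rw [f2 x hn] at hx; exact hn (hx ▸ hi2)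
      · have e1 : {x | f' x = i} = {x | f x = i} := by
          ext x
          show f' x = i ↔ f x = i
          constructor
          · intro hx
            by_cases hn : f x ∈ Z0
            · rw [f1 x hn] at hx; exact (hi hx.symm).elim
            · rwa [f2 x hn] at hx
          · intro hx; rw [f2 x (hx ▸ hi2)]; exact hx
        rw [e1]; exact hp i
  have hcard : (Set.range f').ncard < m := by
    refine lt_of_lt_of_le (Set.ncard_lt_ncard ⟨?_, fun hh => ?_⟩ (Set.finite_range f)) hc
    · rintro _ ⟨x, rfl⟩
      by_cases hn : f x ∈ Z0
      · rw [f1 x hn]; exact hZ0 hz0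
      · rw [f2 x hn]; exact ⟨x, rfl⟩
    · obtain ⟨x, hx⟩ := hh (hZ0 hz1)
      by_cases hn : f x ∈ Z0
      · rw [f1 x hn] at hx; exact hz hx
      · rw [f2 x hn] at hx; exact hn (hx ▸ hz1)
  obtain ⟨C, R, hC, hZ⟩ := hm ι E col f' q h' hp' hcard r
  refine ⟨C, R, hC, fun Z cz hnc hne => (hZ Z cz hnc hne).trans (Dv.iso (glue_congr ?_))⟩
  intro x z
  have : r (f' x) ↔ r (f x) := by
    by_cases hn : f x ∈ Z0
    · rw [f1 x hn]; exact ⟨hr _ hz0 _ hn, hr _ hn _ hz0⟩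
    · rw [f2 x hn]
  rw [this]

theorem L1c_b {m : ℕ} (hm : L1cS m) {ι : Type} {E : LGraph} {col : E.V → Bool} {f : E.V → ι}
    {q : ι → ι → Prop} (h : CG E col f q) (hp : ∀ i, Pv (E.ind {x | f x = i}))
    (hc : (Set.range f).ncard ≤ m) (r : ι → Prop) (Z0 : Set ι) (z0 z1 : ι)
    (hz0 : z0 ∈ Z0) (hz0' : z0 ∈ Set.range f) (hz1 : z1 ∉ Z0) (hz1' : z1 ∈ Set.range f)
    (hq : ∀ j ∈ Set.range f, j ∉ Z0 → ∀ z ∈ Set.range f, z ∈ Z0 → (q j z ↔ r j)) :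
    ∃ (C : LGraph) (R : Set C.V), Pv C ∧ ∀ (Z : LGraph) (cz : Z.V → Bool), NC Z cz →
    Nonempty Z.V → Dv (plg C R Z) (plugC E col f r Z cz) := by
  obtain ⟨C1, R1, hC1, hZ1⟩ := hm ι (E.ind {x | f x ∈ Z0}) _ _ q (h.ind _) (fib_ind hp _)
      ((ncard_range_ind _ hz1' (fun x hx hh => hz1 (hh ▸ hx))).trans_le hc) r
  obtain ⟨C2, R2, hC2, hZ2⟩ := hm ι (E.ind {x | f x ∈ Z0ᶜ}) _ _ q (h.ind _) (fib_ind hp _)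
      ((ncard_range_ind {x | f x ∈ Z0ᶜ} hz0' (fun x hx hh => hx (show f x ∈ Z0 from hh ▸ hz0))).trans_le hc) r
  refine ⟨plg C2 R2 C1, plugSet R2 R1, hC2.plug hC1, fun Z cz hnc hne => ?_⟩
  have d1 := hZ1 Z cz hnc hne
  have d2 := hZ2 (plugC (E.ind {x | f x ∈ Z0}) (fun x => col (iv x)) (fun x => f (iv x)) r Z cz)
    (gelim (fun x => col (iv x)) cz) (by
      unfold NC
      rw [glue_forall]
      refine ⟨fun a => ?_, fun a => ?_⟩ <;> rw [glue_forall] <;> refine ⟨fun b => ?_, fun b => ?_⟩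
      · exact h.nc _ _
      · exact fun h => h.1
      · exact fun h => h.1.symm
      · exact hnc _ _) (by obtain ⟨z⟩ := hne; exact ⟨gr z⟩)
  refine (Dv.iso (plug_plug _ _ _ _ _)).trans ((Dv.plug _ _ d1).trans (d2.trans (Dv.iso ?_)))
  refine glue_iso (fun x => gl (iv x)) (gelim (fun x => gl (iv x)) gr) ?_ ?_ ?_ ?_ ?_ ?_ ?_ ?_ ?_
  · simp
  · simp
  · intro x
    rw [glue_forall]
    refine ⟨fun y hy => ?_, by simp⟩
    have h1 : f (iv x) ∉ Z0 := iv_mem x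
    have h2 : f (iv y) ∈ Z0 := iv_mem y
    have : iv x = iv y := by simpa using hy
    exact h1 (this ▸ h2)
  · rw [glue_forall]
    refine ⟨fun y => ?_, fun z => Or.inr ⟨gr z, rfl⟩⟩
    by_cases hy : f y ∈ Z0
    · exact Or.inr ⟨gl (im y hy), rfl⟩
    · exact Or.inl ⟨im y hy, rfl⟩
  · simp
  · simp
  · intro x
    rw [glue_forall]
    refine ⟨fun y => ?_, fun y => ?_⟩
    · have h1 : f (iv x) ∉ Z0 := iv_mem x
      have h2 : f (iv y) ∈ Z0 := iv_mem y
      simp only [gelim_gl, glue_ll]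
      rw [h.cr (iv x) (iv y) (fun hh => h1 (hh ▸ h2)), hq _ ⟨_, rfl⟩ h1 _ ⟨_, rfl⟩ h2]
      exact and_congr_right fun h3 => by rw [h3]
    · simp
  · simp
  · simp

theorem L1c_1 {ι : Type} {E : LGraph} {col : E.V → Bool} {f : E.V → ι}
    (hp : Pv E) (r : ι → Prop) (j : ι) (hj : ∀ x, f x = j) :
    ∃ (C : LGraph) (R : Set C.V), Pv C ∧ ∀ (Z : LGraph) (cz : Z.V → Bool), NC Z cz →
    Nonempty Z.V → Dv (plg C R Z) (plugC E col f r Z cz) := by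
  refine ⟨E, {x | col x = true ↔ r j}, hp, fun Z cz hnc hne => ?_⟩
  refine Dv.ssset (Equiv.refl _) (fun _ => rfl) {y | ∃ z, y = gr z ∧ ¬ (cz z = true ↔ r j)} ?_ ?_
  · rw [glue_forall]
    refine ⟨fun a _ => ?_, fun z hz => ?_⟩
    · rintro _ ⟨x, rfl, hx⟩ _ ⟨y, rfl, hy⟩
      simp
    · rintro _ ⟨x, rfl, hx⟩ _ ⟨y, rfl, hy⟩ ha
      have := hnc _ _ (show Z.adj z x from ha)
      exact (hz ⟨z, rfl, by rw [this]; exact hx⟩).elim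
  · have e1 : ∀ a : E.V, (gl a : (plg E {x | col x = true ↔ r j} Z).V) ∉
      ({y | ∃ z, y = gr z ∧ ¬ (cz z = true ↔ r j)} : Set (plg E {x | col x = true ↔ r j} Z).V) := by
      rintro a ⟨z, h, _⟩; simp at h
    have e2 : ∀ a : Z.V, (gr a : (plg E {x | col x = true ↔ r j} Z).V) ∈
      ({y | ∃ z, y = gr z ∧ ¬ (cz z = true ↔ r j)} : Set (plg E {x | col x = true ↔ r j} Z).V) ↔
      ¬ (cz a = true ↔ r j) := by
      intro a
      constructor
      · rintro ⟨z, h, h'⟩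
        obtain rfl : a = z := by simpa using h
        exact h'
      · intro h; exact ⟨a, rfl, h⟩
    rw [glue_forall]
    refine ⟨fun a => ?_, fun a => ?_⟩ <;> rw [glue_forall] <;> refine ⟨fun b => ?_, fun b => ?_⟩ <;>
      simp only [e1, e2]
    · show E.adj a b ↔ E.adj a b ∧ _
      simp
    · show (col a = cz b ∧ (r (f a) ↔ cz b = true)) ↔ ((col a = true ↔ r j) ∧ _)
      rw [hj a]
      cases col a <;> cases cz b <;> simp
    · show (col b = cz a ∧ (r (f b) ↔ cz a = true)) ↔ ((col b = true ↔ r j) ∧ _)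
      rw [hj b]
      cases col b <;> cases cz a <;> simp
    · show Z.adj a b ↔ Z.adj a b ∧ _
      refine ⟨fun h => ⟨h, ?_⟩, fun h => h.1⟩
      rw [hnc _ _ h]

theorem L1c_c {ι : Type} {E : LGraph} {col : E.V → Bool} {f : E.V → ι}
    {q : ι → ι → Prop} (h : CG E col f q) (hp : ∀ i, Pv (E.ind {x | f x = i}))
    (hc : 3 ≤ (Set.range f).ncard) (r : ι → Prop)
    (he : ∀ j ∈ Set.range f, ∀ b, ∃ x, f x = j ∧ col x = b)
    (ha : ∀ Z0 : Set ι, Z0 ⊆ Set.range f → (∀ z ∈ Z0, ∀ z' ∈ Z0, r z → r z') →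
      (∀ j ∈ Set.range f, j ∉ Z0 → ∀ z ∈ Z0, ∀ z' ∈ Z0, q j z → q j z') →
      ∀ z0 ∈ Z0, ∀ z1 ∈ Z0, z0 = z1)
    (hb : ∀ Z0 : Set ι, (∀ j ∈ Set.range f, j ∉ Z0 → ∀ z ∈ Set.range f, z ∈ Z0 → (q j z ↔ r j)) →
      ∀ z0 ∈ Z0, z0 ∈ Set.range f → ∀ z1 ∉ Z0, z1 ∉ Set.range f) :
    ∃ (C : LGraph) (R : Set C.V), Pv C ∧ ∀ (Z : LGraph) (cz : Z.V → Bool), NC Z cz →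
    Nonempty Z.V → Dv (plg C R Z) (plugC E col f r Z cz) := by
  classical
  refine ⟨tens E f, Set.univ, ?_, fun Z cz hnc hne => ?_⟩
  · refine Pv.insmulti (fun x => f ((tv E f).symm x)) ?_ ?_
    · intro z v hv x hx y hy _
      exact Or.inr (by rw [show f y = z from hy]; exact hv)
    · intro i
      refine (hp i).iso (ind_iso (tv E f) ?_ ?_ ?_ ?_ ?_)
      · intro x _ x' _ h; simpa using h
      · intro x hx; exact hx
      · intro x hx; exact ⟨(tv E f).symm x, hx, by simp⟩
      · intro x hx y hy
        have hx : f x = i := hx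
        have hy : f y = i := hy
        simp [hx, hy]
      · intro x _; simp
  · let J := ↥(Set.range f)
    let F : (plugC E col f r Z cz).V → Option J := gelim (fun x => some ⟨f x, x, rfl⟩) (fun _ => none)
    let cc : (plugC E col f r Z cz).V → Bool := gelim col cz
    let q' : Option J → Option J → Prop := fun i j =>
      match i, j with
      | some i, some j => q i.1 j.1
      | some i, none => r i.1
      | none, some j => r j.1
      | none, none => False
    have hfin : Finite J := Set.finite_range f
    have h' : CG (plugC E col f r Z cz) cc F q' := by
      refine ⟨?_, ?_, ?_⟩
      · rintro (_ | i) (_ | j) hh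
        · exact hh
        · exact hh
        · exact hh
        · exact h.qs _ _ hh
      · rw [glue_forall]
        refine ⟨fun a => ?_, fun a => ?_⟩ <;> rw [glue_forall] <;> refine ⟨fun b => ?_, fun b => ?_⟩
        · exact h.nc _ _
        · exact fun h => h.1
        · exact fun h => h.1.symm
        · exact hnc _ _
      · rw [glue_forall]
        refine ⟨fun a => ?_, fun a => ?_⟩ <;> rw [glue_forall] <;> refine ⟨fun b hne => ?_, fun b hne => ?_⟩
        · exact h.cr a b (fun hh => hne (by simp [F, hh]))
        · show (col a = cz b ∧ (r (f a) ↔ cz b = true)) ↔ (col a = cz b ∧ (r (f a) ↔ col a = true))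
          exact and_congr_right fun hh => by rw [hh]
        · show (col b = cz a ∧ (r (f b) ↔ cz a = true)) ↔ (cz a = col b ∧ (r (f b) ↔ cz a = true))
          rw [eq_comm]
        · exact (hne rfl).elim
    have hcard : 4 ≤ Nat.card (Option J) := by
      rw [Finite.card_option]
      have : Nat.card J = (Set.range f).ncard := rfl
      omega
    obtain ⟨z0⟩ := hne
    refine Dv.trans (Dv.iso ?_) (pset h' hcard ?_ (cz z0) ?_)
    · refine glue_iso (fun x => tv (plugC E col f r Z cz) F (gl ((tv E f).symm x)))
        (fun z => tv (plugC E col f r Z cz) F (gr z)) ?_ ?_ ?_ ?_ ?_ ?_ ?_ ?_ ?_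
      · intro x y hh; simpa using hh
      · intro x y hh; simpa using hh
      · intro x y hh; simp at hh
      · intro y
        obtain ⟨y, rfl⟩ := (tv _ _).surjective y
        rcases glue_cases y with ⟨a, rfl⟩ | ⟨a, rfl⟩
        · exact Or.inl ⟨tv E f a, by simp⟩
        · exact Or.inr ⟨a, rfl⟩
      · intro x y
        obtain ⟨x, rfl⟩ := (tv _ _).surjective x
        obtain ⟨y, rfl⟩ := (tv _ _).surjective y
        have eF : F (gl x) = F (gl y) ↔ f x = f y := by
          show some _ = some _ ↔ _
          rw [Option.some.injEq]
          exact Subtype.ext_iff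
        simp [eF]
      · intro x y; simp [F]
      · intro x y; simp [F]
      · intro x
        obtain ⟨x, rfl⟩ := (tv _ _).surjective x
        simp
      · simp
    · intro M hM
      by_cases hn : none ∈ M
      · by_cases hall : ∀ j : J, some j ∈ M
        · right; right
          ext x; cases x <;> simp [hn, hall]
        · right; left
          push Not at hall
          obtain ⟨j1, hj1⟩ := hall
          refine ⟨none, ?_⟩
          ext x
          rcases x with _ | x
          · simp [hn]
          · simp only [Set.mem_singleton_iff, reduceCtorEq, iff_false]
            intro hx
            refine hb {i | ∃ hi : i ∈ Set.range f, some (⟨i, hi⟩ : J) ∈ M} ?_ x.1 ⟨x.2, hx⟩ x.2 j1.1 ?_ j1.2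
            · rintro j hj hjn z hz ⟨_, hz'⟩
              have hjM : some (⟨j, hj⟩ : J) ∉ M := fun hh => hjn ⟨hj, hh⟩
              exact ⟨hM _ hjM _ hz' _ hn, hM _ hjM _ hn _ hz'⟩
            · rintro ⟨_, hh⟩; exact hj1 hh
      · by_cases hem : ∃ x : J, some x ∈ M
        · obtain ⟨x, hx⟩ := hem
          right; left
          refine ⟨some x, ?_⟩
          ext y
          rcases y with _ | y
          · simp [hn]
          · simp only [Set.mem_singleton_iff, Option.some.injEq]
            refine ⟨fun hy => ?_, fun hy => hy ▸ hx⟩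
            refine Subtype.ext (ha {i | ∃ hi : i ∈ Set.range f, some (⟨i, hi⟩ : J) ∈ M} ?_ ?_ ?_ _ ⟨y.2, hy⟩ _ ⟨x.2, hx⟩)
            · rintro _ ⟨hh, _⟩; exact hh
            · rintro z ⟨_, hz⟩ z' ⟨_, hz'⟩
              exact hM _ hn _ hz _ hz'
            · rintro j hj hjn z ⟨_, hz⟩ z' ⟨_, hz'⟩
              have hjM : some (⟨j, hj⟩ : J) ∉ M := fun hh => hjn ⟨hj, hh⟩
              exact hM _ hjM _ hz _ hz'
        · left
          ext y
          rcases y with _ | y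
          · simp [hn]
          · simp; exact fun hy => hem ⟨y, hy⟩
    · rintro (_ | ⟨j, hj⟩)
      · exact ⟨gr z0, rfl, rfl⟩
      · obtain ⟨x, hx, hx'⟩ := he j hj (cz z0)
        exact ⟨gl x, by simp [F, hx], hx'⟩

theorem L1cS_all : ∀ m, L1cS m := by
  intro m
  induction m with
  | zero => intro ι E col f q _ _ hh; exact (Nat.not_lt_zero _ hh).elim
  | succ m hm =>
    intro ι E col f q h hp hc r
    have hc : (Set.range f).ncard ≤ m := by omega
    by_cases he : ∃ j ∈ Set.range f, ∃ b, ∀ x, f x = j → col x = b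
    · obtain ⟨j, hj, b, hb⟩ := he
      exact L1c_e hm h hp hc r j hj b hb
    push Not at he
    by_cases ha : ∀ Z0 : Set ι, Z0 ⊆ Set.range f → (∀ z ∈ Z0, ∀ z' ∈ Z0, r z → r z') →
      (∀ j ∈ Set.range f, j ∉ Z0 → ∀ z ∈ Z0, ∀ z' ∈ Z0, q j z → q j z') →
      ∀ z0 ∈ Z0, ∀ z1 ∈ Z0, z0 = z1
    swap
    · push Not at ha
      obtain ⟨Z0, h1, h2, h3, z0, hz0, z1, hz1, hne⟩ := ha
      exact L1c_a hm h hp hc r Z0 h1 z0 z1 hz0 hz1 hne h2 h3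
    by_cases hb : ∀ Z0 : Set ι, (∀ j ∈ Set.range f, j ∉ Z0 → ∀ z ∈ Set.range f, z ∈ Z0 → (q j z ↔ r j)) →
      ∀ z0 ∈ Z0, z0 ∈ Set.range f → ∀ z1 ∉ Z0, z1 ∉ Set.range f
    swap
    · push Not at hb
      obtain ⟨Z0, h1, z0, hz0, hz0', z1, hz1, hz1'⟩ := hb
      exact L1c_b hm h hp hc r Z0 z0 z1 hz0 hz0' hz1 hz1' h1
    by_cases h3 : 3 ≤ (Set.range f).ncard
    · refine L1c_c h hp h3 r ?_ ha hb
      intro j hj b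
      obtain ⟨x, hx, hx'⟩ := he j hj (!b)
      exact ⟨x, hx, by simpa using hx'⟩
    by_cases hE : Nonempty E.V
    swap
    · have hE := not_nonempty_iff.1 hE
      refine ⟨E, ∅, Pv_of_isEmpty hE, fun Z cz _ _ => Dv.iso ?_⟩
      exact (empty_glue hE).trans (empty_glue hE).symm
    obtain ⟨x0⟩ := hE
    by_cases h1 : ∀ x, f x = f x0
    · exact L1c_1 ((hp (f x0)).iso (ind_univ h1)) r _ h1
    exfalso
    push Not at h1
    obtain ⟨x1, hx1⟩ := h1
    have hr : ∀ i ∈ Set.range f, i = f x0 ∨ i = f x1 := by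
      by_contra hh
      push Not at hh
      obtain ⟨i, hi, h4, h5⟩ := hh
      refine h3 ?_
      rw [← Nat.lt_iff_add_one_le]
      refine (Set.two_lt_ncard (Set.finite_range f)).2 ⟨i, hi, f x0, ⟨x0, rfl⟩, f x1, ⟨x1, rfl⟩, h4, h5, hx1.symm⟩
    by_cases hrr : r (f x0) ↔ r (f x1)
    · refine hx1.symm (ha (Set.range f) subset_rfl ?_ ?_ _ ⟨x0, rfl⟩ _ ⟨x1, rfl⟩)
      · intro z hz z' hz' hzr
        rcases hr z hz with rfl | rfl <;> rcases hr z' hz' with rfl | rfl <;> tauto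
      · intro j hj hj'; exact (hj' hj).elim
    · by_cases hq : q (f x0) (f x1) ↔ r (f x0)
      · refine hb {f x1} ?_ _ rfl ⟨x1, rfl⟩ (f x0) hx1.symm ⟨x0, rfl⟩
        rintro j hj hj' z hz rfl
        rcases hr j hj with rfl | rfl
        · exact hq
        · exact (hj' rfl).elim
      · refine hb {f x0} ?_ _ rfl ⟨x0, rfl⟩ (f x1) hx1 ⟨x1, rfl⟩
        rintro j hj hj' z hz rfl
        rcases hr j hj with rfl | rfl
        · exact (hj' rfl).elim
        · have : q (f x0) (f x1) ↔ q (f x1) (f x0) := ⟨h.qs _ _, h.qs _ _⟩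
          tauto

/-- A coloured graph all of whose fibres are provable is provable. -/
theorem L1 {ι : Type} {E : LGraph} {col : E.V → Bool} {f : E.V → ι}
    {q : ι → ι → Prop} (h : CG E col f q) (hp : ∀ i, Pv (E.ind {x | f x = i})) : Pv E :=
  L1_of (L1cS_all _) h hp le_rfl

theorem L1c {ι : Type} {E : LGraph} {col : E.V → Bool} {f : E.V → ι}
    {q : ι → ι → Prop} (h : CG E col f q) (hp : ∀ i, Pv (E.ind {x | f x = i})) (r : ι → Prop) :
    ∃ (C : LGraph) (R : Set C.V), Pv C ∧ ∀ (Z : LGraph) (cz : Z.V → Bool), NC Z cz →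
      Nonempty Z.V → Dv (plg C R Z) (plugC E col f r Z cz) :=
  L1cS_all _ ι E col f q h hp (Nat.lt_succ_self _) r

/-! ### Modules, connectedness, splitting -/

theorem ind_congr {X : LGraph} {s t : Set X.V} (h : ∀ x, x ∈ s ↔ x ∈ t) : (X.ind s).iso (X.ind t) := by
  obtain rfl : s = t := Set.ext h
  exact iso.refl _

theorem ind_ind' {X : LGraph} (s : Set X.V) (t : Set (X.ind s).V) (u : Set X.V)
    (hu : ∀ x, x ∈ u → x ∈ s) (ht : ∀ x, x ∈ t ↔ iv x ∈ u) :
    ((X.ind s).ind t).iso (X.ind u) := by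
  refine iso_ind (fun x => iv (iv x)) ?_ ?_ ?_ ?_ ?_
  · intro x x' h; exact iv_inj (iv_inj h)
  · intro x; exact (ht _).1 (iv_mem x)
  · rintro y hy; exact ⟨im (im y (hu y hy)) ((ht _).2 hy), rfl⟩
  · intro x x'; exact Iff.rfl
  · intro x; rfl

theorem glue_ind {X Y : LGraph} {r : X.V → Y.V → Prop} (s : Set X.V) (t : Set Y.V)
    (u : Set (glue X Y r).V) (hs : ∀ x, gl x ∈ u ↔ x ∈ s) (ht : ∀ y, gr y ∈ u ↔ y ∈ t)
    {r' : (X.ind s).V → (Y.ind t).V → Prop} (hr : ∀ a b, r' a b ↔ r (iv a) (iv b)) :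
    (glue (X.ind s) (Y.ind t) r').iso ((glue X Y r).ind u) := by
  refine iso_ind (gelim (fun x => gl (iv x)) (fun y => gr (iv y))) ?_ ?_ ?_ ?_ ?_
  · simp
  · simp [hs, ht]
  · rw [glue_forall]
    exact ⟨fun a ha => ⟨gl (im a ((hs a).1 ha)), rfl⟩, fun a ha => ⟨gr (im a ((ht a).1 ha)), rfl⟩⟩
  · simp [hr]
  · simp

def Mod (H : LGraph) (s : Set H.V) : Prop :=
  ∀ v, v ∉ s → ∀ x ∈ s, ∀ y ∈ s, H.adj v x → H.adj v y

def Conn (H : LGraph) : Prop :=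
  ∀ s : Set H.V, (∃ x, x ∈ s) → (∃ y, y ∉ s) → ∃ x ∈ s, ∃ y, y ∉ s ∧ H.adj x y

theorem Conn.iso {H H' : LGraph} (h : Conn H) (φ : H.iso H') : Conn H' := by
  obtain ⟨φ⟩ := φ
  intro s ⟨x, hx⟩ ⟨y, hy⟩
  obtain ⟨a, ha, b, hb, hab⟩ := h {z | φ.toEquiv z ∈ s} ⟨φ.toEquiv.symm x, by simpa using hx⟩
    ⟨φ.toEquiv.symm y, by simpa using hy⟩
  exact ⟨_, ha, _, hb, (φ.adj_iff _ _).1 hab⟩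

/-- the piece `X` of a module `X ⅋ T` can be moved outside -/
theorem Dv.float (B : LGraph) (R : Set B.V) (X T : LGraph) :
    Dv (plg B R (pp X T)) (pp X (plg B R T)) := by
  refine (Dv.plug _ _ (Dv.iso (par_comm _ _))).trans ?_
  refine (Dv.iso (plug_plug B T X R ∅).symm).trans ((Dv.ss _ _ _).trans (Dv.iso (par_comm _ _)))

theorem ABS {H : LGraph} {X Y : LGraph} (s t u : Set H.V) (hu : ∀ x, x ∈ u ↔ x ∈ s ∨ x ∈ t)
    (hd : ∀ x ∈ s, x ∉ t) (hm : ∀ v ∈ s, ∀ x ∈ t, ∀ y ∈ t, H.adj v x → H.adj v y)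
    (hX : Pv (pp X (H.ind t))) (hY : Pv (pp Y (H.ind s))) : Pv (pp (pp X Y) (H.ind u)) := by
  have h1 : Pv (plg (pp Y (H.ind s)) (plugSet ∅ {v | ∃ x ∈ t, H.adj (iv v) x}) (pp X (H.ind t))) :=
    hY.plug hX
  refine (h1.dv (Dv.float _ _ _ _)).iso ?_
  refine iso.trans (iso_par (iso.refl _) (iso.trans (plug_plug _ _ _ _ _) ?_)) (par_assoc _ _ _).symm
  refine iso.trans (iso_plug (ind_plug s t u hu hd hm)) (glue_congr (fun _ _ => Iff.rfl))

/-- same, with an arbitrary surrounding graph -/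
theorem Conn.comp (D : LGraph) (a : D.V) :
    ∃ h : Set D.V, a ∈ h ∧ (∀ x ∈ h, ∀ y, D.adj x y → y ∈ h) ∧ Conn (D.ind h) := by
  refine ⟨{x | Relation.ReflTransGen D.adj a x}, Relation.ReflTransGen.refl, ?_, ?_⟩
  · intro x hx y hxy
    exact Relation.ReflTransGen.tail hx hxy
  · have hcl : ∀ (s : Set (D.ind {x | Relation.ReflTransGen D.adj a x}).V),
        im a Relation.ReflTransGen.refl ∈ s → (∀ x ∈ s, ∀ y, D.adj (iv x) (iv y) → y ∈ s) →
        ∀ y, y ∈ s := by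
      intro s hs hc
      have : ∀ x, Relation.ReflTransGen D.adj a x → ∃ y ∈ s, iv y = x := by
        intro x hx
        induction hx with
        | refl => exact ⟨_, hs, rfl⟩
        | tail h1 h2 ih =>
          obtain ⟨y, hy, rfl⟩ := ih
          exact ⟨im _ (Relation.ReflTransGen.tail h1 h2), hc y hy _ h2, rfl⟩
      intro y
      obtain ⟨z, hz, hzy⟩ := this (iv y) (iv_mem y)
      rwa [← iv_inj hzy]
    intro s ⟨x, hx⟩ ⟨y, hy⟩
    by_contra hcon
    push Not at hcon
    by_cases ha : im a Relation.ReflTransGen.refl ∈ s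
    · refine hy (hcl s ha ?_ y)
      intro u hu v huv
      by_contra hv
      exact hcon u hu v hv huv
    · refine hcl sᶜ ha ?_ x hx
      intro u hu v huv hv
      exact hcon v hv u hu (D.symm huv)

/-! ### Good decompositions -/

def kc {K H : LGraph} : (pp K H).V → Bool := gelim (fun _ => false) (fun _ => true)
@[simp] theorem kc_l {K H : LGraph} (a : K.V) : (kc (gl a : (pp K H).V)) = false := rfl
@[simp] theorem kc_r {K H : LGraph} (a : H.V) : (kc (gr a : (pp K H).V)) = true := rfl

theorem CG_pp {ι : Type*} {K H : LGraph} {f : (pp K H).V → ι} {q : ι → ι → Prop}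
    (qs : ∀ i j, q i j → q j i)
    (hK : ∀ a b : K.V, f (gl a) ≠ f (gl b) → (K.adj a b ↔ ¬ q (f (gl a)) (f (gl b))))
    (hH : ∀ a b : H.V, f (gr a) ≠ f (gr b) → (H.adj a b ↔ q (f (gr a)) (f (gr b)))) :
    CG (pp K H) kc f q := by
  refine ⟨qs, ?_, ?_⟩
  · simp
  · simp only [glue_forall]
    refine ⟨fun a => ⟨fun b h => ?_, fun b h => ?_⟩, fun a => ⟨fun b h => ?_, fun b h => ?_⟩⟩
    · simp [hK a b h]
    · simp
    · simp
    · simp [hH a b h]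

theorem CG.K {ι : Type*} {K H : LGraph} {f : (pp K H).V → ι} {q : ι → ι → Prop}
    (h : CG (pp K H) kc f q) (a b : K.V) (hab : f (gl a) ≠ f (gl b)) :
    K.adj a b ↔ ¬ q (f (gl a)) (f (gl b)) := by
  have := h.cr (gl a) (gl b) hab
  simpa using this

theorem CG.H {ι : Type*} {K H : LGraph} {f : (pp K H).V → ι} {q : ι → ι → Prop}
    (h : CG (pp K H) kc f q) (a b : H.V) (hab : f (gr a) ≠ f (gr b)) :
    H.adj a b ↔ q (f (gr a)) (f (gr b)) := by
  have := h.cr (gr a) (gr b) hab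
  simpa using this

def GoodA (G H : LGraph) (A0 : Set H.V) : Prop :=
  ∃ (ι : Type) (K : LGraph) (f : (pp K H).V → ι) (q : ι → ι → Prop), CG (pp K H) kc f q ∧
    (∀ i, Pv ((pp K H).ind {x | f x = i})) ∧ Red K G ∧
    (∃ x y : H.V, f (gr x) ≠ f (gr y)) ∧ (∀ a : K.V, ∃ x : H.V, f (gl a) = f (gr x)) ∧
    (∀ x ∈ A0, ∀ y ∈ A0, f (gr x) = f (gr y))

def GoodB (G H : LGraph) (A0 : Set H.V) : Prop :=
  ∃ (s : Set H.V) (X Y : LGraph), Mod H s ∧ (∃ x, x ∈ s) ∧ (∃ y, y ∉ s) ∧ Red (pp X Y) G ∧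
    Pv (pp X (H.ind s)) ∧ Pv (pp Y (H.ind sᶜ)) ∧ ((∀ x ∈ A0, x ∈ s) ∨ (∀ x ∈ A0, x ∉ s))

def Good (G H : LGraph) (A0 : Set H.V) : Prop := GoodA G H A0 ∨ GoodB G H A0

theorem Good.red {G G' H : LGraph} {A0 : Set H.V} (h : Good G H A0) (h' : Red G G') : Good G' H A0 := by
  rcases h with ⟨ι, K, f, q, h1, h2, h3, h4⟩ | ⟨s, X, Y, h1, h2, h3, h4, h5⟩
  · exact Or.inl ⟨ι, K, f, q, h1, h2, h3.trans h', h4⟩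
  · exact Or.inr ⟨s, X, Y, h1, h2, h3, h4.trans h', h5⟩

/-- dropping the fibres which do not meet `H` -/
theorem mkGoodA {G H : LGraph} {A0 : Set H.V} {ι : Type} {K : LGraph} {f : (pp K H).V → ι}
    {q : ι → ι → Prop} (h : CG (pp K H) kc f q)
    (hp : ∀ i, Pv ((pp K H).ind {x | f x = i})) (hr : Red K G)
    (h2 : ∃ x y : H.V, f (gr x) ≠ f (gr y))
    (h4 : ∀ x ∈ A0, ∀ y ∈ A0, f (gr x) = f (gr y)) : GoodA G H A0 := by
  let J : Set K.V := {a | ∃ x : H.V, f (gl a) = f (gr x)}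
  refine ⟨ι, K.ind J, gelim (fun a => f (gl (iv a))) (fun x => f (gr x)), q, ?_, ?_, ?_, h2, ?_, h4⟩
  · refine CG_pp h.qs ?_ ?_
    · intro a b hab; exact h.K _ _ hab
    · intro a b hab; exact h.H _ _ hab
  · intro i
    by_cases hi : ∃ x : H.V, f (gr x) = i
    · obtain ⟨x0, hx0⟩ := hi
      refine (hp i).iso (iso.symm (ind_iso (gelim (fun a => gl (iv a)) (fun x => gr x)) ?_ ?_ ?_ ?_ ?_))
      · simp
      · simp only [glue_forall]; exact ⟨fun a ha => ha, fun a ha => ha⟩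
      · simp only [glue_forall]
        refine ⟨fun a ha => ⟨gl (im a ⟨x0, ?_⟩), ha, rfl⟩, fun a ha => ⟨gr a, ha, rfl⟩⟩
        rw [hx0]; exact ha
      · simp
      · simp
    · refine Pv_of_isEmpty (ind_isEmpty ?_)
      rw [glue_forall]
      refine ⟨fun a ha => ?_, fun a ha => hi ⟨a, ha⟩⟩
      obtain ⟨x, hx⟩ := iv_mem a
      exact hi ⟨x, hx.symm.trans ha⟩
  · refine Red.trans (Red.of_dv ?_) hr
    have hd := Dv.insmulti (E := K) (fun a => f (gl a)) {i | ∀ x : H.V, f (gr x) ≠ i} ?_ ?_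
    · refine (Dv.iso (ind_congr ?_)).trans hd
      intro a
      simp only [J, Set.mem_ofPred_eq]
      push Not
      exact ⟨fun ⟨x, h⟩ => ⟨x, h.symm⟩, fun ⟨x, h⟩ => ⟨x, h.symm⟩⟩
    · intro z hz v hv x hx y hy
      rw [h.K v x (by rw [hx]; exact hv), h.K v y (by rw [hy]; exact hv), hx, hy]
      exact id
    · intro z hz
      refine (hp z).iso (iso.symm (iso_ind (fun a => gl (iv a)) ?_ ?_ ?_ ?_ ?_))
      · simp
      · intro a; exact iv_mem a
      · rw [glue_forall]
        exact ⟨fun a ha => ⟨im a ha, rfl⟩, fun a ha => (hz a ha).elim⟩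
      · simp
      · simp
  · intro a
    exact iv_mem a

theorem Good.iso {G H H' : LGraph} (h : Good G H ∅) (φ : H.iso H') : Good G H' ∅ := by
  obtain ⟨φ⟩ := φ
  have hs : ∀ s : Set H.V, (H.ind s).iso (H'.ind {x | φ.toEquiv.symm x ∈ s}) := by
    intro s
    refine ind_iso φ.toEquiv ?_ ?_ ?_ ?_ ?_
    · intro x _ y _ h; exact φ.toEquiv.injective h
    · intro x hx; simpa using hx
    · intro y hy; exact ⟨_, hy, by simp⟩
    · intro x _ y _; exact φ.adj_iff _ _
    · intro x _; exact (φ.label_eq _).symm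
  have had : ∀ x y, H'.adj x y ↔ H.adj (φ.toEquiv.symm x) (φ.toEquiv.symm y) := by
    intro x y; rw [φ.adj_iff]; simp
  rcases h with ⟨ι, K, f, q, h1, h2, h3, ⟨x, y, h4⟩, h5, h6⟩ | ⟨s, X, Y, h1, ⟨x, h2⟩, ⟨y, h3⟩, h4, h5, h6, h7⟩
  · left
    refine ⟨ι, K, gelim (fun a => f (gl a)) (fun a => f (gr (φ.toEquiv.symm a))), q, ?_, ?_, h3, ⟨φ.toEquiv x, φ.toEquiv y, ?_⟩, ?_, by simp⟩
    · refine CG_pp h1.qs ?_ ?_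
      · intro a b hab; exact h1.K _ _ hab
      · intro a b hab
        rw [had]; exact h1.H _ _ hab
    · intro i
      refine (h2 i).iso ?_
      refine ind_iso (gelim gl (fun a => gr (φ.toEquiv a))) ?_ ?_ ?_ ?_ ?_
      · simp
      · simp
      · simp only [glue_forall]
        refine ⟨fun a ha => ⟨gl a, ha, rfl⟩, fun a ha => ⟨gr (φ.toEquiv.symm a), ha, by simp⟩⟩
      · simp [had]
      · simp [φ.label_eq]
    · simpa using h4
    · intro a
      obtain ⟨x, hx⟩ := h5 a
      exact ⟨φ.toEquiv x, by simpa using hx⟩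
  · right
    refine ⟨{x | φ.toEquiv.symm x ∈ s}, X, Y, ?_, ⟨φ.toEquiv x, by simpa using h2⟩, ⟨φ.toEquiv y, by simpa using h3⟩, h4,
      h5.iso (iso_par (iso.refl _) (hs s)), h6.iso (iso_par (iso.refl _) (hs sᶜ)), Or.inl (by simp)⟩
    intro v hv x hx y hy
    rw [had, had]
    exact h1 _ hv _ hx _ hy

def WS (D : LGraph) : Prop := ∀ G H : LGraph, D.iso (pp G H) → Conn H → (∃ x y : H.V, x ≠ y) → Good G H ∅
def TS (D : LGraph) : Prop := ∀ (G H : LGraph) (a : Set H.V), D.iso (pp G H) →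
  (∀ x ∈ a, ∀ y, y ∉ a → H.adj x y) →
  ∃ KA KB, Red (pp KA KB) G ∧ Pv (pp KA (H.ind a)) ∧ Pv (pp KB (H.ind aᶜ))
def SWS (D : LGraph) : Prop := ∀ (G H : LGraph) (A0 : Set H.V), D.iso (pp G H) → Conn H → Mod H A0 →
  (∃ x, x ∈ A0) → (∃ y, y ∉ A0) → Good G H A0
def CRS (D : LGraph) : Prop := ∀ (G : LGraph) (S : Set G.V) (A : LGraph), D.iso (plg G S A) →
  ∃ K, URed (fun X : LGraph => pp K X) (fun X => plg G S X) ∧ Pv (pp K A) ∧ sz K ≤ sz G ∧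
    (S.Nonempty → sz K < sz G)
def Psi (D : LGraph) : Prop := WS D ∧ TS D ∧ SWS D ∧ CRS D
def Lt (n : ℕ) : Prop := ∀ D, Pv D → sz D < n → Psi D

theorem Lt.W {n : ℕ} (h : Lt n) {G H : LGraph} (hp : Pv (pp G H)) (hn : sz G + sz H < n)
    (hc : Conn H) (h2 : ∃ x y : H.V, x ≠ y) : Good G H ∅ :=
  (h _ hp (by rwa [sz_glue])).1 G H (iso.refl _) hc h2
theorem Lt.T {n : ℕ} (h : Lt n) {G H : LGraph} (hp : Pv (pp G H)) (hn : sz G + sz H < n) (a : Set H.V)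
    (ha : ∀ x ∈ a, ∀ y, y ∉ a → H.adj x y) :
    ∃ KA KB, Red (pp KA KB) G ∧ Pv (pp KA (H.ind a)) ∧ Pv (pp KB (H.ind aᶜ)) :=
  (h _ hp (by rwa [sz_glue])).2.1 G H a (iso.refl _) ha
theorem Lt.SW {n : ℕ} (h : Lt n) {G H : LGraph} (hp : Pv (pp G H)) (hn : sz G + sz H < n) (A0 : Set H.V)
    (hc : Conn H) (hm : Mod H A0) (h1 : ∃ x, x ∈ A0) (h2 : ∃ y, y ∉ A0) : Good G H A0 :=
  (h _ hp (by rwa [sz_glue])).2.2.1 G H A0 (iso.refl _) hc hm h1 h2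
theorem Lt.CR {n : ℕ} (h : Lt n) {G : LGraph} {S : Set G.V} {A : LGraph} (hp : Pv (plg G S A))
    (hn : sz G + sz A < n) :
    ∃ K, URed (fun X : LGraph => pp K X) (fun X => plg G S X) ∧ Pv (pp K A) ∧ sz K ≤ sz G ∧
    (S.Nonempty → sz K < sz G) :=
  (h _ hp (by rwa [sz_glue])).2.2.2 G S A (iso.refl _)

theorem L1sub {ι : Type} {E : LGraph} {col : E.V → Bool} {f : E.V → ι}
    {q : ι → ι → Prop} (h : CG E col f q) (hp : ∀ i, Pv (E.ind {x | f x = i})) (J : Set ι) :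
    Pv (E.ind {x | f x ∈ J}) := L1 (h.ind _) (fib_ind hp J)

theorem Red.sz_l {X Y G : LGraph} (h : Red (pp X Y) G) : sz X + sz Y ≤ sz G := by
  have := h.sz_le
  rwa [sz_glue] at this

theorem iso_pp_swap (A B C D : LGraph) : (pp (pp A B) (pp C D)).iso (pp (pp A C) (pp B D)) := by
  refine iso_of_fun (gelim (gelim (fun a => gl (gl a)) (fun a => gr (gl a)))
    (gelim (fun a => gl (gr a)) (fun a => gr (gr a)))) ?_ ?_ ?_ ?_ <;> simp

theorem T_B {n : ℕ} (hlt : Lt n) {G H X Y : LGraph} (hn : sz G + sz H ≤ n) (a s : Set H.V)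
    (ha : ∀ x ∈ a, ∀ y, y ∉ a → H.adj x y) (hs : Mod H s) (h1 : ∃ x, x ∈ s) (h2 : ∃ y, y ∉ s)
    (hr : Red (pp X Y) G) (hX : Pv (pp X (H.ind s))) (hY : Pv (pp Y (H.ind sᶜ))) :
    ∃ KA KB, Red (pp KA KB) G ∧ Pv (pp KA (H.ind a)) ∧ Pv (pp KB (H.ind aᶜ)) := by
  have hsz := hr.sz_l
  obtain ⟨x1, h1⟩ := h1
  obtain ⟨x2, h2⟩ := h2
  obtain ⟨XA, XB, hX1, hX2, hX3⟩ := hlt.T hX (by have := sz_ind_lt' (s := s) h2; omega) {x | iv x ∈ a}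
    (fun x hx y hy => ha _ hx _ hy)
  obtain ⟨YA, YB, hY1, hY2, hY3⟩ := hlt.T hY (by have := sz_ind_lt' (s := sᶜ) (x := x1) (fun h => h h1); omega) {x | iv x ∈ a}
    (fun x hx y hy => ha _ hx _ hy)
  refine ⟨pp XA YA, pp XB YB, ?_, ?_, ?_⟩
  · exact (Red.iso (iso_pp_swap _ _ _ _)).trans (((hX1.par _).trans (hY1.par' _)).trans hr)
  · refine ABS (sᶜ ∩ a) (s ∩ a) a ?_ ?_ ?_ (hX2.iso (iso_par (iso.refl _) (ind_ind s a)))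
      (hY2.iso (iso_par (iso.refl _) (ind_ind sᶜ a)))
    · intro x; by_cases x ∈ s <;> simp_all
    · rintro x ⟨h, _⟩ ⟨h', _⟩; exact h h'
    · rintro v ⟨hv, _⟩ x ⟨hx, _⟩ y ⟨hy, _⟩; exact hs v hv x hx y hy
  · refine ABS (sᶜ ∩ aᶜ) (s ∩ aᶜ) aᶜ ?_ ?_ ?_ (hX3.iso (iso_par (iso.refl _) (ind_ind s aᶜ)))
      (hY3.iso (iso_par (iso.refl _) (ind_ind sᶜ aᶜ)))
    · intro x; by_cases x ∈ s <;> simp_all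
    · rintro x ⟨h, _⟩ ⟨h', _⟩; exact h h'
    · rintro v ⟨hv, _⟩ x ⟨hx, _⟩ y ⟨hy, _⟩; exact hs v hv x hx y hy

/-- splitting `K ⅋ H` along a set of fibres -/
theorem fib_pp {ι : Type} {K H : LGraph} (f : (pp K H).V → ι) (J : Set ι) :
    (pp (K.ind {a | f (gl a) ∈ J}) (H.ind {a | f (gr a) ∈ J})).iso ((pp K H).ind {x | f x ∈ J}) :=
  glue_ind (r := fun _ _ => False) {a | f (gl a) ∈ J} {a | f (gr a) ∈ J} {x | f x ∈ J} (fun _ => Iff.rfl) (fun _ => Iff.rfl) (fun _ _ => Iff.rfl)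
theorem fib_pp1 {ι : Type} {K H : LGraph} (f : (pp K H).V → ι) (i : ι) :
    (pp (K.ind {a | f (gl a) = i}) (H.ind {a | f (gr a) = i})).iso ((pp K H).ind {x | f x = i}) :=
  glue_ind (r := fun _ _ => False) {a | f (gl a) = i} {a | f (gr a) = i} {x | f x = i} (fun _ => Iff.rfl) (fun _ => Iff.rfl) (fun _ _ => Iff.rfl)

theorem conn_of_join {H : LGraph} (a : Set H.V) (ha : ∀ x ∈ a, ∀ y, y ∉ a → H.adj x y)
    {x1 x2 : H.V} (h1 : x1 ∈ a) (h2 : x2 ∉ a) : Conn H := by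
  rintro s ⟨x, hx⟩ ⟨y, hy⟩
  by_contra hc
  push Not at hc
  have hc' : ∀ x ∈ s, ∀ y, y ∉ s → ¬ H.adj y x := fun x hx y hy h => hc x hx y hy (H.symm h)
  have key : ∀ u ∈ a, ∀ v, v ∉ a → (u ∈ s ↔ v ∈ s) := by
    intro u hu v hv
    have := ha u hu v hv
    constructor
    · intro h; by_contra h'; exact hc _ h _ h' this
    · intro h; by_contra h'; exact hc' _ h _ h' this
  have all : ∀ u, u ∈ s ↔ x1 ∈ s := by
    intro u
    by_cases hu : u ∈ a
    · rw [key u hu _ h2, key x1 h1 _ h2]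
    · rw [key x1 h1 u hu]
  exact hy ((all y).2 ((all x).1 hx))

theorem T_of_W {D : LGraph} (hp : Pv D) (hlt : Lt (sz D)) (hw : WS D) : TS D := by
  intro G H a φ ha
  have hn : sz G + sz H ≤ sz D := by rw [sz_iso φ, sz_glue]
  have hp' := hp.iso φ
  by_cases h1 : ∃ x, x ∈ a
  swap
  · push Not at h1
    refine ⟨LGraph.empty, G, Red.iso (empty_glue inferInstance), ?_, ?_⟩
    · exact Pv.par (Dv.refl _) (Pv_of_isEmpty (ind_isEmpty h1))
    · exact hp'.iso (iso_par (iso.refl _) (ind_univ h1).symm)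
  by_cases h2 : ∃ x, x ∉ a
  swap
  · push Not at h2
    refine ⟨G, LGraph.empty, Red.iso (glue_empty inferInstance), ?_, ?_⟩
    · exact hp'.iso (iso_par (iso.refl _) (ind_univ h2).symm)
    · exact Pv.par (Dv.refl _) (Pv_of_isEmpty (ind_isEmpty (fun x hx => hx (h2 x))))
  obtain ⟨x1, h1⟩ := h1
  obtain ⟨x2, h2⟩ := h2
  rcases hw G H φ (conn_of_join a ha h1 h2) ⟨x1, x2, fun h => h2 (h ▸ h1)⟩ with
    ⟨ι, K, f, q, hCG, hfib, hred, ⟨y1, y2, hy⟩, him, -⟩ | ⟨s, X, Y, g1, g2, g3, g4, g5, g6, -⟩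
  swap
  · exact T_B hlt hn a s ha g1 g2 g3 g4 g5 g6
  by_cases hpure : ∀ x ∈ a, ∀ y, y ∉ a → f (gr x) ≠ f (gr y)
  · let J : Set ι := {i | ∃ x ∈ a, f (gr x) = i}
    have hJ : ∀ x : H.V, f (gr x) ∈ J ↔ x ∈ a := by
      intro x
      refine ⟨fun ⟨y, hy, h⟩ => ?_, fun h => ⟨x, h, rfl⟩⟩
      by_contra hx
      exact hpure y hy x hx h
    refine ⟨K.ind {a | f (gl a) ∈ J}, K.ind {a | f (gl a) ∈ Jᶜ}, Red.trans (Red.iso ?_) hred, ?_, ?_⟩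
    · refine (ind_par _ _ Set.univ ?_ ?_ ?_).trans (ind_univ (fun _ => trivial))
      · intro x; simp; tauto
      · intro x hx hx'; exact hx' hx
      · intro v hv x hx hvx
        obtain ⟨v', hv'⟩ := him v
        obtain ⟨x', hx'⟩ := him x
        have hv : f (gl v) ∈ J := hv
        have hx : f (gl x) ∉ J := hx
        have hne : f (gl v) ≠ f (gl x) := fun h => hx (h ▸ hv)
        rw [hCG.K v x hne, hv', hx'] at hvx
        rw [hv', hJ] at hv
        rw [hx', hJ] at hx
        rw [hv', hx'] at hne
        exact hvx ((hCG.H v' x' hne).1 (ha _ hv _ hx))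
    · refine (L1sub hCG hfib J).iso (iso.trans (fib_pp f J).symm (iso_par (iso.refl _) (ind_congr hJ)))
    · refine (L1sub hCG hfib Jᶜ).iso (iso.trans (fib_pp f Jᶜ).symm (iso_par (iso.refl _) (ind_congr ?_)))
      intro x
      exact not_congr (hJ x)
  · push Not at hpure
    obtain ⟨x, hx, y, hyn, hxy⟩ := hpure
    let i := f (gr x)
    have hq : ∀ z : H.V, f (gr z) ≠ i → q (f (gr z)) i := by
      intro z hz
      by_cases hza : z ∈ a
      · have := (hCG.H z y (by rw [← hxy]; exact hz)).1 (ha z hza y hyn)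
        rwa [← hxy] at this
      · exact (hCG.H z x hz).1 (H.symm (ha x hx z hza))
    refine T_B hlt hn (X := K.ind {a | f (gl a) ∈ ({i} : Set ι)}) (Y := K.ind {a | f (gl a) ∈ ({i}ᶜ : Set ι)}) a
      {z | f (gr z) ∈ ({i} : Set ι)} ha ?_ ⟨x, rfl⟩ ?_ ?_ ?_ ?_
    · intro v hv u hu w hw _
      have hv : f (gr v) ≠ i := hv
      have hw : f (gr w) = i := hw
      rw [hCG.H v w (by rw [hw]; exact hv), hw]
      exact hq v hv
    · by_cases h : f (gr y1) = i
      · exact ⟨y2, fun h' => hy (h.trans (Eq.symm h'))⟩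
      · exact ⟨y1, h⟩
    · refine Red.trans (Red.iso ?_) hred
      refine (ind_par _ _ Set.univ ?_ ?_ ?_).trans (ind_univ (fun _ => trivial))
      · intro x; simp; tauto
      · intro x hx hx'; exact hx' hx
      · intro v hv x hx hvx
        have hv : f (gl v) = i := hv
        have hx : f (gl x) ≠ i := hx
        rw [hCG.K v x (by rw [hv]; exact hx.symm), hv] at hvx
        obtain ⟨x', hx'⟩ := him x
        rw [hx'] at hvx hx
        exact hvx (hCG.qs _ _ (hq x' hx))
    · exact (L1sub hCG hfib {i}).iso (fib_pp f {i}).symm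
    · exact (L1sub hCG hfib {i}ᶜ).iso (fib_pp f {i}ᶜ).symm

theorem par_lcomm (X Y Z : LGraph) : (pp X (pp Y Z)).iso (pp Y (pp X Z)) := by
  refine iso_of_fun (gelim (fun a => gr (gl a)) (gelim (fun a => gl a) (fun a => gr (gr a)))) ?_ ?_ ?_ ?_ <;> simp
theorem par_rcomm (X Y Z : LGraph) : (pp (pp X Y) Z).iso (pp (pp X Z) Y) := by
  refine iso_of_fun (gelim (gelim (fun a => gl (gl a)) (fun a => gr a)) (fun a => gl (gr a))) ?_ ?_ ?_ ?_ <;> simp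

theorem SW_T {D G H : LGraph} (hT : TS D) (A0 : Set H.V) (φ : D.iso (pp G H))
    (ha : ∀ x ∈ A0, ∀ y, y ∉ A0 → H.adj x y) (h1 : ∃ x, x ∈ A0) (h2 : ∃ y, y ∉ A0) : Good G H A0 := by
  obtain ⟨KA, KB, hr, hA, hB⟩ := hT G H A0 φ ha
  exact Or.inr ⟨A0, KA, KB, fun v hv x hx y hy _ => H.symm (ha y hy v hv), h1, h2, hr, hA, hB, Or.inl fun _ h => h⟩

theorem SW_A {G H : LGraph} {A0 : Set H.V} (hA : GoodA G H ∅) (hc : Conn H) (hm : Mod H A0)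
    (h1 : ∃ x, x ∈ A0) : Good G H A0 ∨ (∀ x ∈ A0, ∀ y, y ∉ A0 → H.adj x y) := by
  classical
  obtain ⟨ι, K, f, q, hCG, hfib, hred, ⟨y1, y2, hy⟩, him, -⟩ := hA
  obtain ⟨x0, h1⟩ := h1
  let I : Set ι := {i | ∃ x ∈ A0, f (gr x) = i}
  have hI : ∀ x ∈ A0, f (gr x) ∈ I := fun x hx => ⟨x, hx, rfl⟩
  by_cases hz : ∃ z : H.V, f (gr z) ∉ I
  · left; left
    obtain ⟨z, hz⟩ := hz
    have huni : ∀ b : H.V, f (gr b) ∉ I → ∀ i ∈ I, ∀ i' ∈ I, q i (f (gr b)) → q i' (f (gr b)) := by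
      rintro b hb i ⟨u, hu, rfl⟩ i' ⟨u', hu', rfl⟩ hq
      have hbA : b ∉ A0 := fun h => hb (hI b h)
      have e1 : f (gr u) ≠ f (gr b) := fun h => hb (h ▸ hI u hu)
      have e2 : f (gr u') ≠ f (gr b) := fun h => hb (h ▸ hI u' hu')
      rw [← hCG.H u b e1] at hq
      rw [← hCG.H u' b e2]
      exact H.symm (hm b hbA u hu u' hu' (H.symm hq))
    have huni' : ∀ c : (pp K H).V, f c ∉ I → ∀ i ∈ I, (q i (f c) ↔ ∃ i' ∈ I, q i' (f c)) := by
      intro c hcI i hi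
      obtain ⟨b, hb⟩ : ∃ b : H.V, f c = f (gr b) := by
        rcases glue_cases c with ⟨a, rfl⟩ | ⟨a, rfl⟩
        · exact him a
        · exact ⟨a, rfl⟩
      rw [hb] at hcI ⊢
      exact ⟨fun h => ⟨i, hi, h⟩, fun ⟨i', hi', h⟩ => huni b hcI i' hi' i hi h⟩
    let q' : Option ι → Option ι → Prop := fun a b => match a, b with
      | none, none => False
      | none, some j => ∃ i ∈ I, q i j
      | some j, none => ∃ i ∈ I, q i j
      | some i, some j => q i j
    let f' : (pp K H).V → Option ι := fun x => if f x ∈ I then none else some (f x)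
    have f'n : ∀ x, f x ∈ I → f' x = none := fun x hx => if_pos hx
    have f's : ∀ x, f x ∉ I → f' x = some (f x) := fun x hx => if_neg hx
    have hq' : ∀ x y, f' x ≠ f' y → (q' (f' x) (f' y) ↔ q (f x) (f y)) ∧ f x ≠ f y := by
      intro x y hxy
      refine ⟨?_, fun h => hxy (by simp only [f', h])⟩
      by_cases hx : f x ∈ I <;> by_cases hy : f y ∈ I
      · rw [f'n x hx, f'n y hy] at hxy; exact (hxy rfl).elim
      · rw [f'n x hx, f's y hy]; exact (huni' y hy _ hx).symm
      · rw [f's x hx, f'n y hy]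
        refine (huni' x hx _ hy).symm.trans ⟨hCG.qs _ _, hCG.qs _ _⟩
      · rw [f's x hx, f's y hy]
    refine ⟨Option ι, K, f', q', CG_pp ?_ ?_ ?_, ?_, hred, ⟨x0, z, ?_⟩, ?_, ?_⟩
    · rintro (_ | i) (_ | j) h
      · exact h
      · exact h
      · exact h
      · exact hCG.qs _ _ h
    · intro a b hab
      rw [(hq' _ _ hab).1]; exact hCG.K _ _ (hq' _ _ hab).2
    · intro a b hab
      rw [(hq' _ _ hab).1]; exact hCG.H _ _ (hq' _ _ hab).2
    · rintro (_ | j)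
      · refine (L1sub hCG hfib I).iso (ind_congr fun x => ?_)
        by_cases hx : f x ∈ I
        · simp [f'n x hx, hx]
        · simp [f's x hx, hx]
      · by_cases hj : j ∈ I
        · refine Pv_of_isEmpty (ind_isEmpty fun x hx => ?_)
          have hx : f' x = some j := hx
          by_cases hxI : f x ∈ I
          · simp [f'n x hxI] at hx
          · rw [f's x hxI] at hx; obtain rfl := Option.some.inj hx; exact hxI hj
        · refine (hfib j).iso (ind_congr fun x => ?_)
          by_cases hx : f x ∈ I
          · simp only [Set.mem_ofPred_eq, f'n x hx]
            exact ⟨fun h => (hj (h ▸ hx)).elim, fun h => by cases h⟩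
          · simp [f's x hx]
    · rw [f'n _ (hI _ h1), f's _ hz]; simp
    · intro a
      obtain ⟨x, hx⟩ := him a
      exact ⟨x, by simp only [f', hx]⟩
    · intro x hx y hy
      rw [f'n _ (hI _ hx), f'n _ (hI _ hy)]
  · right
    push Not at hz
    intro x hx v hv
    by_contra hcon
    have hno : ∀ u ∈ A0, ¬ H.adj v u := fun u hu h => hcon (H.symm (hm v hv u hu x hx h))
    have hy' : ∃ y, f (gr y) ≠ f (gr v) := by
      by_cases h : f (gr y1) = f (gr v)
      · exact ⟨y2, fun h' => hy (h.trans h'.symm)⟩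
      · exact ⟨y1, h⟩
    obtain ⟨a, ha, b, hb, hab⟩ := hc {w | f (gr w) = f (gr v)} ⟨v, rfl⟩ hy'
    have ha : f (gr a) = f (gr v) := ha
    have hb : f (gr b) ≠ f (gr v) := hb
    obtain ⟨u, hu, hub⟩ := hz b
    rw [hCG.H a b (by rw [ha]; exact hb.symm), ha, ← hub] at hab
    exact hno u hu ((hCG.H v u (by rw [hub]; exact hb.symm)).2 hab)

theorem SW_B {n : ℕ} (hlt : Lt n) {G H X Y : LGraph} (hn : sz G + sz H ≤ n) (A0 s : Set H.V)
    (hc : Conn H) (hm : Mod H A0) (hs : Mod H s) (hr : Red (pp X Y) G)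
    (hX : Pv (pp X (H.ind s))) (hY : Pv (pp Y (H.ind sᶜ)))
    {r t w : H.V} (hrA : r ∈ A0) (hrs : r ∉ s) (htA : t ∈ A0) (hts : t ∈ s) (hwA : w ∉ A0) (hws : w ∉ s) :
    Good G H A0 := by
  classical
  have hsz := hr.sz_l
  have hA : ∀ v, v ∉ A0 → ∀ x ∈ A0, ∀ y ∈ A0, (H.adj v x ↔ H.adj v y) := fun v hv x hx y hy =>
    ⟨hm v hv x hx y hy, hm v hv y hy x hx⟩
  have hS : ∀ v, v ∉ s → ∀ x ∈ s, ∀ y ∈ s, (H.adj v x ↔ H.adj v y) := fun v hv x hx y hy =>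
    ⟨hs v hv x hx y hy, hs v hv y hy x hx⟩
  have hvr : ∀ v, v ∉ A0 → v ∉ s → ∀ x ∈ s, (H.adj v x ↔ H.adj v r) := by
    intro v h1 h2 x hx
    rw [hS v h2 x hx t hts, hA v h1 t htA r hrA]
  have key : ∀ U : Set H.V, (∃ u, u ∈ U) → (∀ u ∈ U, u ∉ A0 ∧ u ∉ s) →
      (∀ u ∈ U, ∀ y, y ∉ U → y ∉ s → ¬ H.adj u y) → False := by
    intro U h1 h2 h3
    have hrU : r ∉ U := fun h => (h2 r h).1 hrA
    obtain ⟨x, hx, y, hy, hxy⟩ := hc U h1 ⟨r, hrU⟩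
    by_cases hys : y ∈ s
    · rw [hvr x (h2 x hx).1 (h2 x hx).2 y hys] at hxy
      exact h3 x hx r hrU hrs hxy
    · exact h3 x hx y hy hys hxy
  have hconn : Conn (H.ind sᶜ) := by
    intro U ⟨u, hu⟩ ⟨u', hu'⟩
    by_contra hcon
    push Not at hcon
    by_cases e1 : ∃ x ∈ U, iv x ∈ A0
    · by_cases e2 : ∃ x, x ∉ U ∧ iv x ∈ A0
      · obtain ⟨x1, e1, e1'⟩ := e1
        obtain ⟨x2, e2, e2'⟩ := e2
        refine key {v | v ∉ A0 ∧ v ∉ s} ⟨w, hwA, hws⟩ (fun u h => h) ?_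
        rintro v ⟨hv1, hv2⟩ y hy hys hvy
        have hyA : y ∈ A0 := by by_contra h; exact hy ⟨h, hys⟩
        by_cases hvU : im v hv2 ∈ U
        · exact hcon _ hvU _ e2 ((hA v hv1 y hyA _ e2').1 hvy)
        · exact hcon _ e1 _ hvU (H.symm ((hA v hv1 y hyA _ e1').1 hvy))
      · push Not at e2
        refine key {v | ∃ x, x ∉ U ∧ iv x = v} ⟨_, u', hu', rfl⟩ ?_ ?_
        · rintro _ ⟨x, hx, rfl⟩; exact ⟨e2 x hx, iv_mem x⟩
        · rintro _ ⟨x, hx, rfl⟩ y hy hys hxy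
          have : im y hys ∈ U := by by_contra h; exact hy ⟨_, h, rfl⟩
          exact hcon _ this _ hx (H.symm hxy)
    · push Not at e1
      refine key {v | ∃ x, x ∈ U ∧ iv x = v} ⟨_, u, hu, rfl⟩ ?_ ?_
      · rintro _ ⟨x, hx, rfl⟩; exact ⟨e1 x hx, iv_mem x⟩
      · rintro _ ⟨x, hx, rfl⟩ y hy hys hxy
        have : im y hys ∉ U := by intro h; exact hy ⟨_, h, rfl⟩
        exact hcon _ hx _ this hxy
  have hlt2 : sz (H.ind sᶜ) < sz H := sz_ind_lt' (x := t) (fun h => h hts)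
  rcases hlt.SW hY (by omega) {x | iv x ∈ A0} hconn (fun v hv x hx y hy => hm _ hv _ hx _ hy)
    ⟨im r hrs, hrA⟩ ⟨im w hws, hwA⟩ with
    ⟨ι, K, f, q, hCG, hfib, hred, ⟨y1, y2, hy⟩, him, hA0⟩ | ⟨s2, X2, Y2, g1, ⟨x1, g2⟩, ⟨x2, g3⟩, g4, g5, g6, g7⟩
  · left
    let i0 := f (gr (im r hrs))
    have hi0 : ∀ x : (H.ind sᶜ).V, iv x ∈ A0 → f (gr x) = i0 := fun x hx => hA0 x hx _ hrA
    let f' : H.V → ι := fun x => if h : x ∈ s then i0 else f (gr (im x h))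
    have f1 : ∀ x ∈ s, f' x = i0 := fun x hx => dif_pos hx
    have f2 : ∀ x : (H.ind sᶜ).V, f' (iv x) = f (gr x) := fun x => dif_neg (iv_mem x)
    let Rs : Set K.V := {a | f (gl a) ≠ i0 ∧ ¬ q (f (gl a)) i0}
    have hvs : ∀ v : (H.ind sᶜ).V, f (gr v) ≠ i0 → ∀ x ∈ s, (H.adj (iv v) x ↔ q (f (gr v)) i0) := by
      intro v hv x hx
      rw [hvr (iv v) (fun h => hv (hi0 v h)) (iv_mem v) x hx]
      exact hCG.H v (im r hrs) hv
    have cG : CG (pp (plg K Rs X) H) kc (gelim (gelim (fun a => f (gl a)) (fun _ => i0)) f') q := by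
      refine CG_pp hCG.qs ?_ ?_
      · simp only [glue_forall]
        refine ⟨fun a => ⟨fun b h => hCG.K a b h, fun b h => ?_⟩, fun a => ⟨fun b h => ?_, fun b h => (h rfl).elim⟩⟩
        · have h : f (gl a) ≠ i0 := h
          exact ⟨fun h' => h'.2, fun h' => ⟨h, h'⟩⟩
        · have h : i0 ≠ f (gl b) := h
          refine ⟨fun h' h2 => h'.2 (hCG.qs _ _ h2), fun h' => ⟨h.symm, fun h2 => h' (hCG.qs _ _ h2)⟩⟩
      · intro a b hab
        have hab : f' a ≠ f' b := hab
        show H.adj a b ↔ q (f' a) (f' b)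
        by_cases ha : a ∈ s <;> by_cases hb : b ∈ s
        · rw [f1 a ha, f1 b hb] at hab; exact (hab rfl).elim
        · obtain ⟨b, rfl⟩ : ∃ b' : (H.ind sᶜ).V, iv b' = b := ⟨im b hb, rfl⟩
          rw [f1 a ha, f2] at hab ⊢
          exact ⟨fun h => hCG.qs _ _ ((hvs b hab.symm a ha).1 (H.symm h)), fun h => H.symm ((hvs b hab.symm a ha).2 (hCG.qs _ _ h))⟩
        · obtain ⟨a, rfl⟩ : ∃ b' : (H.ind sᶜ).V, iv b' = a := ⟨im a ha, rfl⟩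
          rw [f1 b hb, f2] at hab ⊢
          exact hvs a hab b hb
        · obtain ⟨a, rfl⟩ : ∃ b' : (H.ind sᶜ).V, iv b' = a := ⟨im a ha, rfl⟩
          obtain ⟨b, rfl⟩ : ∃ b' : (H.ind sᶜ).V, iv b' = b := ⟨im b hb, rfl⟩
          rw [f2, f2] at hab ⊢
          exact hCG.H a b hab
    refine ⟨ι, plg K Rs X, _, q, cG, ?_, ?_, ⟨iv y1, iv y2, ?_⟩, ?_, ?_⟩
    · intro j
      by_cases hj : j = i0
      · subst hj
        have k1 : Pv (pp (K.ind {a | f (gl a) = i0}) (H.ind {x | x ∉ s ∧ f' x = i0})) := by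
          refine (hfib i0).iso ((fib_pp1 f i0).symm.trans (iso_par (iso.refl _) (ind_ind' _ _ _ ?_ ?_)))
          · intro x hx; exact hx.1
          · intro x
            simp only [Set.mem_ofPred_eq, f2]
            exact ⟨fun h => ⟨iv_mem x, h⟩, fun h => h.2⟩
        have k2 := ABS {x | x ∉ s ∧ f' x = i0} s {x | f' x = i0} ?_ (fun x hx => hx.1)
          (fun v hv => hs v hv.1) hX k1
        · refine k2.iso ?_
          refine iso_ind (gelim (gelim (fun a => gl (gr a)) (fun a => gl (gl (iv a)))) (fun a => gr (iv a))) ?_ ?_ ?_ ?_ ?_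
          · simp
          · simp only [glue_forall]
            exact ⟨⟨fun _ => rfl, fun a => iv_mem a⟩, fun a => iv_mem a⟩
          · simp only [glue_forall]
            exact ⟨⟨fun a ha => ⟨gl (gr (im a ha)), rfl⟩, fun a ha => ⟨gl (gl a), rfl⟩⟩, fun a ha => ⟨gr (im a ha), rfl⟩⟩
          · simp only [glue_forall]
            have hRs : ∀ a : (K.ind {a | f (gl a) = i0}).V, iv a ∉ Rs := fun a ha => ha.1 (iv_mem a)
            simp [hRs]
          · simp
        · intro x
          by_cases hx : x ∈ s
          · simp [hx, f1 x hx]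
          · simp [hx]
      · refine (hfib j).iso ?_
        refine ind_iso (gelim (fun a => gl (gl a)) (fun a => gr (iv a))) ?_ ?_ ?_ ?_ ?_
        · simp
        · simp only [glue_forall]
          refine ⟨fun a ha => ha, fun a ha => ?_⟩
          have ha : f (gr a) = j := ha
          show f' (iv a) = j
          rw [f2, ha]
        · simp only [glue_forall]
          refine ⟨⟨fun a ha => ⟨gl a, ha, rfl⟩, fun a ha => (hj (Eq.symm ha)).elim⟩, fun a ha => ?_⟩
          have ha : f' a = j := ha
          by_cases has : a ∈ s
          · rw [f1 a has] at ha; exact (hj ha.symm).elim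
          · refine ⟨gr (im a has), ?_, rfl⟩
            rw [← ha]; exact (f2 (im a has)).symm
        · simp
        · simp
    · refine (Red.of_dv (Dv.ss _ _ _)).trans ?_
      exact (hred.par X).trans ((Red.iso (par_comm _ _)).trans hr)
    · show f' _ ≠ f' _
      rw [f2, f2]; exact hy
    · rw [glue_forall]
      refine ⟨fun a => ?_, fun a => ⟨t, (f1 t hts).symm⟩⟩
      obtain ⟨x, hx⟩ := him a
      exact ⟨iv x, hx.trans (f2 x).symm⟩
    · have : ∀ x ∈ A0, f' x = i0 := by
        intro x hx
        by_cases hxs : x ∈ s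
        · exact f1 x hxs
        · exact (f2 (im x hxs)).trans (hi0 _ hx)
      intro x hx y hy
      exact (this x hx).trans (this y hy).symm
  · right
    have g1' : ∀ v : (H.ind sᶜ).V, v ∉ s2 → ∀ x ∈ s2, ∀ y ∈ s2, (H.adj (iv v) (iv x) → H.adj (iv v) (iv y)) := g1
    rcases g7 with g7 | g7
    · have hrs2 := g7 (im r hrs) hrA
      refine ⟨{x | x ∈ s ∨ ∃ y ∈ s2, iv y = x}, pp X X2, Y2, ?_, ⟨t, Or.inl hts⟩, ⟨iv x2, ?_⟩, ?_, ?_, ?_, Or.inl ?_⟩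
      · intro v hv x hx y hy
        have hvs : v ∉ s := fun h => hv (Or.inl h)
        have hv2 : im v hvs ∉ s2 := fun h => hv (Or.inr ⟨_, h, rfl⟩)
        have hvA : v ∉ A0 := fun h => hv2 (g7 _ h)
        have : ∀ x, (x ∈ s ∨ ∃ y ∈ s2, iv y = x) → (H.adj v x ↔ H.adj v r) := by
          rintro x (hx | ⟨y, hy, rfl⟩)
          · exact hvr v hvA hvs x hx
          · exact ⟨g1' _ hv2 y hy _ hrs2, g1' _ hv2 _ hrs2 y hy⟩
        rw [this x hx, this y hy]; exact id
      · rintro (h | ⟨y, hy, h⟩)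
        · exact iv_mem x2 h
        · exact g3 (iv_inj h ▸ hy)
      · exact (Red.iso (par_assoc _ _ _)).trans ((g4.par' X).trans hr)
      · refine ABS {x | ∃ y ∈ s2, iv y = x} s _ (fun x => or_comm) ?_ ?_ hX (g5.iso (iso_par (iso.refl _) (ind_ind' _ _ _ ?_ ?_)))
        · rintro _ ⟨y, hy, rfl⟩; exact iv_mem y
        · rintro _ ⟨y, hy, rfl⟩; exact hs _ (iv_mem y)
        · rintro _ ⟨y, hy, rfl⟩; exact iv_mem y
        · intro x; exact ⟨fun h => ⟨x, h, rfl⟩, fun ⟨y, hy, h⟩ => iv_inj h ▸ hy⟩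
      · refine g6.iso (iso_par (iso.refl _) (ind_ind' _ _ _ ?_ ?_))
        · intro x hx h; exact hx (Or.inl h)
        · intro x
          refine not_congr ⟨fun h => Or.inr ⟨x, h, rfl⟩, ?_⟩
          rintro (h | ⟨y, hy, h⟩)
          · exact (iv_mem x h).elim
          · exact iv_inj h ▸ hy
      · intro x hx
        by_cases hxs : x ∈ s
        · exact Or.inl hxs
        · exact Or.inr ⟨im x hxs, g7 _ hx, rfl⟩
    · have hrs2 := g7 (im r hrs) hrA
      refine ⟨{x | ∃ y ∈ s2, iv y = x}, X2, pp X Y2, ?_, ⟨_, x1, g2, rfl⟩, ⟨iv x2, ?_⟩, ?_, ?_, ?_, Or.inr ?_⟩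
      · rintro v hv _ ⟨x, hx, rfl⟩ _ ⟨y, hy, rfl⟩
        by_cases hvs : v ∈ s
        · have hx' := hvr (iv x) (fun h => g7 x h hx) (iv_mem x) v hvs
          have hy' := hvr (iv y) (fun h => g7 y h hy) (iv_mem y) v hvs
          intro h
          exact H.symm (hy'.2 (H.symm (g1' _ hrs2 x hx y hy (H.symm (hx'.1 (H.symm h))))))
        · exact g1' (im v hvs) (fun h => hv ⟨_, h, rfl⟩) x hx y hy
      · rintro ⟨y, hy, h⟩
        exact g3 (iv_inj h ▸ hy)
      · exact (Red.iso (par_lcomm _ _ _)).trans ((g4.par' X).trans hr)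
      · refine g5.iso (iso_par (iso.refl _) (ind_ind' _ _ _ ?_ ?_))
        · rintro _ ⟨y, hy, rfl⟩; exact iv_mem y
        · intro x; exact ⟨fun h => ⟨x, h, rfl⟩, fun ⟨y, hy, h⟩ => iv_inj h ▸ hy⟩
      · refine ABS {x | x ∉ s ∧ ¬ ∃ y ∈ s2, iv y = x} s _ ?_ (fun x hx => hx.1) (fun v hv => hs v hv.1) hX
          (g6.iso (iso_par (iso.refl _) (ind_ind' _ _ _ (fun x hx => hx.1) ?_)))
        · intro x
          show (¬ ∃ y ∈ s2, iv y = x) ↔ (x ∉ s ∧ ¬ ∃ y ∈ s2, iv y = x) ∨ x ∈ s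
          by_cases hx : x ∈ s
          · refine ⟨fun _ => Or.inr hx, ?_⟩
            rintro _ ⟨y, hy, rfl⟩
            exact iv_mem y hx
          · simp [hx]
        · intro x
          refine ⟨fun h => ⟨iv_mem x, fun ⟨y, hy, h'⟩ => h (iv_inj h' ▸ hy)⟩, fun h h' => h.2 ⟨x, h', rfl⟩⟩
      · rintro _ hx ⟨y, hy, rfl⟩
        exact g7 y hx hy

theorem SW_of {D : LGraph} (hlt : Lt (sz D)) (hw : WS D) (hT : TS D) : SWS D := by
  intro G H A0 φ hc hm h1 h2
  have hn : sz G + sz H ≤ sz D := by rw [sz_iso φ, sz_glue]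
  have h12 : ∃ x y : H.V, x ≠ y := by
    obtain ⟨x, hx⟩ := h1
    obtain ⟨y, hy⟩ := h2
    exact ⟨x, y, fun h => hy (h ▸ hx)⟩
  rcases hw G H φ hc h12 with hA | ⟨s, X, Y, g1, g2, g3, g4, g5, g6, -⟩
  · rcases SW_A hA hc hm h1 with h | h
    · exact h
    · exact SW_T hT A0 φ h h1 h2
  · by_cases e1 : ∀ x ∈ A0, x ∈ s
    · exact Or.inr ⟨s, X, Y, g1, g2, g3, g4, g5, g6, Or.inl e1⟩
    by_cases e2 : ∀ x ∈ A0, x ∉ s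
    · exact Or.inr ⟨s, X, Y, g1, g2, g3, g4, g5, g6, Or.inr e2⟩
    push Not at e1 e2
    obtain ⟨r, hr, hrs⟩ := e1
    obtain ⟨t, ht, hts⟩ := e2
    by_cases e3 : ∃ w, w ∉ A0 ∧ w ∉ s
    · obtain ⟨w, hw1, hw2⟩ := e3
      exact SW_B hlt hn A0 s hc hm g1 g4 g5 g6 hr hrs ht hts hw1 hw2
    · push Not at e3
      refine SW_T hT A0 φ ?_ h1 h2
      obtain ⟨a, ha, b, hb, hab⟩ := hc A0 h1 h2
      have hrb : H.adj r b := H.symm (hm b hb a ha r hr (H.symm hab))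
      intro x hx y hy
      have hry : H.adj r y := g1 r hrs b (e3 b hb) y (e3 y hy) hrb
      exact H.symm (hm y hy r hr x hx (H.symm hry))

/-- a set of vertices of the right component of a par -/
def pT {K G : LGraph} (S : Set G.V) : Set (pp K G).V := {x | ∃ v ∈ S, x = gr v}
@[simp] theorem pT_l {K G : LGraph} (S : Set G.V) (a : K.V) : (gl a : (pp K G).V) ∈ pT S ↔ False := by
  simp [pT]
@[simp] theorem pT_r {K G : LGraph} (S : Set G.V) (a : G.V) : (gr a : (pp K G).V) ∈ pT S ↔ a ∈ S := by
  simp [pT]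
theorem plug_pp (K G : LGraph) (S : Set G.V) (X : LGraph) :
    (plg (pp K G) (pT S) X).iso (pp K (plg G S X)) := by
  refine iso_of_fun (gelim (gelim gl (fun a => gr (gl a))) (fun a => gr (gr a))) ?_ ?_ ?_ ?_ <;> simp

def GPA (G H : LGraph) (S : Set H.V) (A : LGraph) : Prop :=
  ∃ (ι : Type) (K : LGraph) (f : (pp K H).V → ι) (i0 : ι) (q : ι → ι → Prop), CG (pp K H) kc f q ∧ Red K G ∧
    (∃ v : H.V, f (gr v) ≠ i0) ∧ (∀ v : H.V, f (gr v) ≠ i0 → (v ∈ S ↔ q (f (gr v)) i0)) ∧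
    (∀ j, j ≠ i0 → Pv ((pp K H).ind {x | f x = j})) ∧
    Pv (plg ((pp K H).ind {x | f x = i0}) {x | iv x ∈ (pT S : Set (pp K H).V)} A) ∧
    (∀ a : K.V, f (gl a) = i0 ∨ ∃ x : H.V, f (gl a) = f (gr x))

def GPB1 (G H : LGraph) (S : Set H.V) (A : LGraph) : Prop :=
  ∃ (s : Set H.V) (X Y : LGraph), (∀ v, v ∉ s → ∀ x ∈ s, (H.adj v x ↔ v ∈ S)) ∧ (∃ v, v ∉ s) ∧ Red (pp X Y) G ∧
    Pv (pp X (plg (H.ind s) {x | iv x ∈ S} A)) ∧ Pv (pp Y (H.ind sᶜ))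

def GPB2 (G H : LGraph) (S : Set H.V) (A : LGraph) : Prop :=
  ∃ (s : Set H.V) (X Y : LGraph), Mod H s ∧ (∀ x ∈ s, ∀ y ∈ s, x ∈ S → y ∈ S) ∧ (∃ v, v ∈ s) ∧ Red (pp X Y) G ∧
    Pv (pp X (H.ind s)) ∧ Pv (pp Y (plg (H.ind sᶜ) {x | iv x ∈ S} A))

def GoodP (G H : LGraph) (S : Set H.V) (A : LGraph) : Prop := GPA G H S A ∨ GPB1 G H S A ∨ GPB2 G H S A

theorem GoodP.mono {G H : LGraph} {S : Set H.V} {A A' : LGraph} (h : GoodP G H S A) (hd : Dv A A') :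
    GoodP G H S A' := by
  rcases h with ⟨ι, K, f, i0, q, h1, h2, h3, h4, h5, h6, h7⟩ | ⟨s, X, Y, h1, h2, h3, h4, h5⟩ | ⟨s, X, Y, h1, h2, h3, h4, h5, h6⟩
  · exact Or.inl ⟨ι, K, f, i0, q, h1, h2, h3, h4, h5, h6.dv (Dv.plug _ _ hd), h7⟩
  · exact Or.inr (Or.inl ⟨s, X, Y, h1, h2, h3, h4.dv (Dv.par_left _ (Dv.plug _ _ hd)), h5⟩)
  · exact Or.inr (Or.inr ⟨s, X, Y, h1, h2, h3, h4, h5, h6.dv (Dv.par_left _ (Dv.plug _ _ hd))⟩)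

theorem plg_ind_l {H A : LGraph} {S : Set H.V} (s : Set (plg H S A).V) (t : Set H.V)
    (h1 : ∀ v, gl v ∈ s ↔ v ∈ t) (h2 : ∀ a, gr a ∈ s) :
    (plg (H.ind t) {x | iv x ∈ S} A).iso ((plg H S A).ind s) := by
  refine iso_ind (gelim (fun a => gl (iv a)) gr) ?_ ?_ ?_ ?_ ?_
  · simp
  · rw [glue_forall]; exact ⟨fun a => (h1 _).2 (iv_mem a), h2⟩
  · rw [glue_forall]; exact ⟨fun a ha => ⟨gl (im a ((h1 _).1 ha)), rfl⟩, fun a ha => ⟨gr a, rfl⟩⟩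
  · simp
  · simp

theorem plg_ind_r {H A : LGraph} {S : Set H.V} (s : Set (plg H S A).V) (t : Set H.V)
    (h1 : ∀ v, gl v ∈ s ↔ v ∈ t) (h2 : ∀ a, gr a ∉ s) :
    (H.ind t).iso ((plg H S A).ind s) := by
  refine iso_ind (fun a => gl (iv a)) ?_ ?_ ?_ ?_ ?_
  · simp
  · exact fun a => (h1 _).2 (iv_mem a)
  · rw [glue_forall]; exact ⟨fun a ha => ⟨im a ((h1 _).1 ha), rfl⟩, fun a ha => (h2 a ha).elim⟩
  · simp
  · simp

theorem fibA {ι : Type} {K H A : LGraph} {S : Set H.V} (f : (pp K (plg H S A)).V → ι) (f0 : (pp K H).V → ι)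
    (h1 : ∀ a, f (gl a) = f0 (gl a)) (h2 : ∀ v, f (gr (gl v)) = f0 (gr v)) (i : ι)
    (h3 : ∀ a, f (gr (gr a)) = i) :
    (plg ((pp K H).ind {x | f0 x = i}) {x | iv x ∈ (pT S : Set (pp K H).V)} A).iso
      ((pp K (plg H S A)).ind {x | f x = i}) := by
  refine iso_ind (gelim (fun a => (gelim gl (fun v => gr (gl v)) : (pp K H).V → _) (iv a)) (fun a => gr (gr a))) ?_ ?_ ?_ ?_ ?_
  · have : ∀ x x' : (pp K H).V, (gelim gl (fun v => gr (gl v)) x : (pp K (plg H S A)).V) = gelim gl (fun v => gr (gl v)) x' → x = x' := by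
      simp only [glue_forall]; simp
    have h' : ∀ (x : (pp K H).V) (y : A.V), (gelim gl (fun v => gr (gl v)) x : (pp K (plg H S A)).V) ≠ gr (gr y) := by
      simp only [glue_forall]; simp
    simp only [glue_forall]
    refine ⟨fun a => ⟨fun b h => ?_, fun b h => (h' _ _ h).elim⟩, fun a => ⟨fun b h => (h' _ _ h.symm).elim, fun b h => ?_⟩⟩
    · rw [iv_inj (this _ _ h)]
    · simpa using h
  · have : ∀ x : (pp K H).V, f (gelim gl (fun v => gr (gl v)) x) = f0 x := by
      simp only [glue_forall]; exact ⟨h1, h2⟩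
    rw [glue_forall]
    refine ⟨fun a => ?_, h3⟩
    show f _ = i
    simp only [gelim_gl, this]
    exact iv_mem a
  · simp only [glue_forall]
    refine ⟨fun a ha => ⟨gl (im (gl a) ((h1 a).symm.trans ha)), rfl⟩, fun a ha => ⟨gl (im (gr a) ((h2 a).symm.trans ha)), rfl⟩, fun a ha => ⟨gr a, rfl⟩⟩
  · have k1 : ∀ x x' : (pp K H).V, (pp K H).adj x x' ↔ (pp K (plg H S A)).adj (gelim gl (fun v => gr (gl v)) x) (gelim gl (fun v => gr (gl v)) x') := by
      simp only [glue_forall]; simp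
    have k2 : ∀ (x : (pp K H).V) (a : A.V), x ∈ (pT S : Set (pp K H).V) ↔ (pp K (plg H S A)).adj (gelim gl (fun v => gr (gl v)) x) (gr (gr a)) := by
      simp only [glue_forall]; simp
    have k3 : ∀ (x : (pp K H).V) (a : A.V), x ∈ (pT S : Set (pp K H).V) ↔ (pp K (plg H S A)).adj (gr (gr a)) (gelim gl (fun v => gr (gl v)) x) := by
      simp only [glue_forall]; simp
    simp only [glue_forall]
    refine ⟨fun a => ⟨fun b => k1 _ _, fun b => ?_⟩, fun a => ⟨fun b => ?_, fun b => by simp⟩⟩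
    · simp only [glue_lr]; exact k2 _ _
    · simp only [glue_rl]; exact k3 _ _
  · have k1 : ∀ x : (pp K H).V, (pp K H).label x = (pp K (plg H S A)).label (gelim gl (fun v => gr (gl v)) x) := by
      simp only [glue_forall]; simp
    simp only [glue_forall]
    exact ⟨fun a => k1 _, fun a => by simp⟩

theorem fibA' {ι : Type} {K H A : LGraph} {S : Set H.V} (f : (pp K (plg H S A)).V → ι) (f0 : (pp K H).V → ι)
    (h1 : ∀ a, f (gl a) = f0 (gl a)) (h2 : ∀ v, f (gr (gl v)) = f0 (gr v)) (i : ι)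
    (h3 : ∀ a, f (gr (gr a)) ≠ i) :
    ((pp K H).ind {x | f0 x = i}).iso ((pp K (plg H S A)).ind {x | f x = i}) := by
  refine ind_iso (gelim gl (fun v => gr (gl v))) ?_ ?_ ?_ ?_ ?_
  · simp
  · simp [h1, h2]
  · simp only [glue_forall]
    exact ⟨fun a ha => ⟨gl a, (h1 a).symm.trans ha, rfl⟩, fun a ha => ⟨gr a, (h2 a).symm.trans ha, rfl⟩, fun a ha => (h3 a ha).elim⟩
  · simp
  · simp

theorem Good.goodP {G H A : LGraph} {S : Set H.V} (h : Good G (plg H S A) {x | ∃ a, x = gr a}) (a0 : A.V) :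
    GoodP G H S A := by
  rcases h with ⟨ι, K, f, q, hCG, hfib, hred, ⟨y1, y2, hy⟩, him, hA⟩ | ⟨s, X, Y, h1, h2, ⟨y, h3⟩, h4, h5, h6, h7⟩
  · left
    have hA' : ∀ a, f (gr (gr a)) = f (gr (gr a0)) := fun a => hA _ ⟨a, rfl⟩ _ ⟨a0, rfl⟩
    let f0 : (pp K H).V → ι := gelim (fun a => f (gl a)) (fun v => f (gr (gl v)))
    refine ⟨ι, K, f0, f (gr (gr a0)), q, CG_pp hCG.qs (fun a b hab => hCG.K a b hab) (fun a b hab => ?_), hred, ?_, ?_, ?_, ?_, ?_⟩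
    · have := hCG.H (gl a) (gl b) hab
      rw [glue_ll] at this
      exact this
    · have : ∃ y, f (gr y) ≠ f (gr (gr a0)) := by
        by_cases e : f (gr y1) = f (gr (gr a0))
        · exact ⟨y2, fun e' => hy (e.trans e'.symm)⟩
        · exact ⟨y1, e⟩
      obtain ⟨y, hy⟩ := this
      rcases glue_cases y with ⟨v, rfl⟩ | ⟨a, rfl⟩
      · exact ⟨v, hy⟩
      · exact (hy (hA' a)).elim
    · intro v hv
      have := hCG.H (gl v) (gr a0) hv
      rw [glue_lr] at this
      exact this
    · intro j hj
      exact (hfib j).iso (fibA' f f0 (fun _ => rfl) (fun _ => rfl) j (fun a => by rw [hA' a]; exact hj.symm)).symm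
    · exact (hfib _).iso (fibA f f0 (fun _ => rfl) (fun _ => rfl) _ hA').symm
    · intro a
      obtain ⟨x, hx⟩ := him a
      rcases glue_cases x with ⟨v, rfl⟩ | ⟨b, rfl⟩
      · exact Or.inr ⟨v, hx⟩
      · exact Or.inl (hx.trans (hA' b))
  · right
    rcases h7 with h7 | h7
    · left
      have h7 : ∀ a : A.V, gr a ∈ s := fun a => h7 _ ⟨a, rfl⟩
      refine ⟨{v | gl v ∈ s}, X, Y, ?_, ?_, h4, h5.iso (iso_par (iso.refl _) (plg_ind_l s _ (fun _ => Iff.rfl) h7).symm),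
        h6.iso (iso_par (iso.refl _) (plg_ind_r sᶜ {v | gl v ∈ s}ᶜ (fun _ => Iff.rfl) (fun a h => h (h7 a))).symm)⟩
      · intro v hv x hx
        have e1 := h1 (gl v) hv (gl x) hx (gr a0) (h7 a0)
        have e2 := h1 (gl v) hv (gr a0) (h7 a0) (gl x) hx
        simp only [glue_ll, glue_lr] at e1 e2
        exact ⟨e1, e2⟩
      · rcases glue_cases y with ⟨v, rfl⟩ | ⟨a, rfl⟩
        · exact ⟨v, h3⟩
        · exact (h3 (h7 a)).elim
    · right
      have h7 : ∀ a : A.V, gr a ∉ s := fun a => h7 _ ⟨a, rfl⟩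
      refine ⟨{v | gl v ∈ s}, X, Y, ?_, ?_, ?_, h4, h5.iso (iso_par (iso.refl _) (plg_ind_r s _ (fun _ => Iff.rfl) h7).symm),
        h6.iso (iso_par (iso.refl _) (plg_ind_l sᶜ {v | gl v ∈ s}ᶜ (fun _ => Iff.rfl) h7).symm)⟩
      · intro v hv x hx y hy
        have e1 := h1 (gl v) hv (gl x) hx (gl y) hy
        simpa using e1
      · intro x hx y hy
        have e1 := h1 (gr a0) (h7 a0) (gl x) hx (gl y) hy
        simpa using e1
      · obtain ⟨x, h2⟩ := h2
        rcases glue_cases x with ⟨v, rfl⟩ | ⟨a, rfl⟩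
        · exact ⟨v, h2⟩
        · exact (h7 a h2).elim

theorem GoodP.good {G H A : LGraph} {S : Set H.V} (h : GoodP G H S A) (a0 : A.V) :
    Good G (plg H S A) ∅ := by
  rcases h with ⟨ι, K, f, i0, q, hCG, hred, ⟨v, hv⟩, hS, h5, h6, him⟩ | ⟨s, X, Y, h1, ⟨v, h2⟩, h3, h4, h5⟩ | ⟨s, X, Y, h1, h2, ⟨v, h3⟩, h4, h5, h6⟩
  · left
    let f' : (pp K (plg H S A)).V → ι := gelim (fun a => f (gl a)) (gelim (fun v => f (gr v)) (fun _ => i0))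
    refine mkGoodA (f := f') (q := q) (CG_pp hCG.qs (fun a b hab => hCG.K a b hab) ?_) ?_ hred ⟨gl v, gr a0, hv⟩ (by simp)
    · simp only [glue_forall]
      refine ⟨fun a => ⟨fun b h => ?_, fun b h => ?_⟩, fun a => ⟨fun b h => ?_, fun b h => (h rfl).elim⟩⟩
      · rw [glue_ll]
        exact hCG.H a b h
      · rw [glue_lr]
        exact hS a h
      · have := hS b (Ne.symm h)
        simp only [glue_rl]
        exact this.trans ⟨hCG.qs _ _, hCG.qs _ _⟩
    · intro i
      by_cases hi : i = i0
      · subst hi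
        exact h6.iso (fibA f' f (fun _ => rfl) (fun _ => rfl) _ (fun _ => rfl))
      · exact (h5 i hi).iso (fibA' f' f (fun _ => rfl) (fun _ => rfl) _ (fun _ h => hi (Eq.symm h)))
  · right
    refine ⟨{x | gelim (fun v => v ∈ s) (fun _ => True) x}, X, Y, ?_, ⟨gr a0, trivial⟩, ⟨gl v, h2⟩, h3,
      h4.iso (iso_par (iso.refl _) (plg_ind_l _ s (fun _ => Iff.rfl) (fun _ => trivial))),
      h5.iso (iso_par (iso.refl _) (plg_ind_r _ sᶜ (fun _ => Iff.rfl) (fun _ h => h trivial))), Or.inl (by simp)⟩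
    intro v hv x hx y hy
    rcases glue_cases v with ⟨v, rfl⟩ | ⟨a, rfl⟩
    swap
    · exact (hv trivial).elim
    have : ∀ x : (plg H S A).V, x ∈ {x : (plg H S A).V | gelim (fun v => v ∈ s) (fun _ => True) x} → ((plg H S A).adj (gl v) x ↔ v ∈ S) := by
      simp only [glue_forall]
      refine ⟨fun a ha => ?_, fun a ha => by simp⟩
      simp only [glue_ll]
      exact h1 v hv a ha
    rw [this x hx, this y hy]; exact id
  · right
    refine ⟨{x | gelim (fun v => v ∈ s) (fun _ => False) x}, X, Y, ?_, ⟨gl v, h3⟩, ⟨gr a0, id⟩, h4,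
      h5.iso (iso_par (iso.refl _) (plg_ind_r _ s (fun _ => Iff.rfl) (fun _ => id))),
      h6.iso (iso_par (iso.refl _) (plg_ind_l _ sᶜ (fun _ => Iff.rfl) (fun _ => id))), Or.inl (by simp)⟩
    intro v hv x hx y hy
    rcases glue_cases x with ⟨x, rfl⟩ | ⟨a, rfl⟩
    swap
    · exact hx.elim
    rcases glue_cases y with ⟨y, rfl⟩ | ⟨a, rfl⟩
    swap
    · exact hy.elim
    rcases glue_cases v with ⟨v, rfl⟩ | ⟨a, rfl⟩
    · simp only [glue_ll]; exact h1 v hv x hx y hy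
    · simp only [glue_rl]; exact h2 x hx y hy

theorem Pull {ι : Type} {E : LGraph} {col : E.V → Bool} {f : E.V → ι} {q : ι → ι → Prop} {i0 : ι}
    (h : CG E col f q) (hp : ∀ j, j ≠ i0 → Pv (E.ind {x | f x = j})) (T : Set E.V)
    (hT : ∀ v, f v ≠ i0 → (v ∈ T ↔ col v = true ∧ q (f v) i0)) (hT0 : ∀ v ∈ T, col v = true)
    (hne : ∃ v, f v = i0) :
    URed (fun X : LGraph => plg (E.ind {x | f x = i0}) {x | iv x ∈ T} X) (fun X => plg E T X) := by
  obtain ⟨v0, hv0⟩ := hne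
  have hp' : ∀ i, Pv ((E.ind {x | f x ∈ ({i0}ᶜ : Set ι)}).ind {x | f (iv x) = i}) := by
    intro i
    by_cases hi : i = i0
    · refine Pv_of_isEmpty (ind_isEmpty fun x hx => iv_mem x ?_)
      exact Eq.trans hx hi
    · refine (hp i hi).iso (iso.symm (ind_ind' _ _ _ ?_ ?_))
      · intro x hx; exact fun h' => hi (Eq.trans (Eq.symm hx) h')
      · intro x; exact Iff.rfl
  obtain ⟨C, R, hC, hD⟩ := L1c (h.ind {x | f x ∈ ({i0}ᶜ : Set ι)}) hp' (fun j => q j i0)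
  refine ⟨C, R, hC, fun X => (hD (plg (E.ind {x | f x = i0}) {x | iv x ∈ T} X) (gelim (fun p => col (iv p)) (fun _ => true)) ?_ ⟨gl (im v0 hv0)⟩).trans (Dv.iso ?_)⟩
  · simp only [NC, glue_forall]
    refine ⟨fun a => ⟨fun b h' => h.nc _ _ h', fun b h' => hT0 _ h'⟩, fun a => ⟨fun b h' => (hT0 _ h').symm, fun b h' => rfl⟩⟩
  · refine iso_of_fun (gelim (fun e => gl (iv e)) (gelim (fun e => gl (iv e)) gr)) ?_ ?_ ?_ ?_
    · have : ∀ (a : (E.ind {x | f x ∈ ({i0}ᶜ : Set ι)}).V) (b : (E.ind {x | f x = i0}).V), iv a ≠ iv b :=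
        fun a b hab => iv_mem a (show f (iv a) = i0 by rw [hab]; exact iv_mem b)
      have h' : ∀ (a : (E.ind {x | f x ∈ ({i0}ᶜ : Set ι)}).V) (b : (E.ind {x | f x = i0}).V), iv b ≠ iv a :=
        fun a b hab => this a b hab.symm
      simp only [glue_forall]
      simp [this, h']
    · rw [glue_forall]
      refine ⟨fun a => ?_, fun a => ⟨gr (gr a), rfl⟩⟩
      by_cases ha : f a = i0
      · exact ⟨gr (gl (im a ha)), rfl⟩
      · exact ⟨gl (im a ha), rfl⟩
    · have k1 : ∀ (a : (E.ind {x | f x ∈ ({i0}ᶜ : Set ι)}).V) (b : (E.ind {x | f x = i0}).V),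
          (col (iv a) = col (iv b) ∧ (q (f (iv a)) i0 ↔ col (iv b) = true)) ↔ E.adj (iv a) (iv b) := by
        intro a b
        have hb : f (iv b) = i0 := iv_mem b
        rw [h.cr (iv a) (iv b) (by rw [hb]; exact iv_mem a), hb]
        refine and_congr_right fun e => ?_
        rw [e]
      have k2 : ∀ (a : (E.ind {x | f x ∈ ({i0}ᶜ : Set ι)}).V),
          (col (iv a) = true ∧ (q (f (iv a)) i0 ↔ true = true)) ↔ iv a ∈ T := by
        intro a
        rw [hT (iv a) (iv_mem a)]; simp
      simp only [glue_forall]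
      refine ⟨fun a => ⟨fun b => Iff.rfl, fun b => k1 a b, fun b => k2 a⟩, ⟨fun a => ⟨fun b => (k1 b a).trans ⟨fun h => E.symm h, fun h => E.symm h⟩, fun b => Iff.rfl, fun b => Iff.rfl⟩, fun a => ⟨fun b => k2 b, fun b => Iff.rfl, fun b => Iff.rfl⟩⟩⟩
    · simp only [glue_forall]
      simp

theorem Dv.absorb {H X : LGraph} (s t u : Set H.V) (hu : ∀ x, x ∈ u ↔ x ∈ s ∨ x ∈ t)
    (hd : ∀ x ∈ s, x ∉ t) (hm : ∀ v ∈ s, ∀ x ∈ t, ∀ y ∈ t, H.adj v x → H.adj v y)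
    (hX : Pv (pp X (H.ind t))) : Dv (H.ind s) (pp X (H.ind u)) :=
  (Dv.insert {v | ∃ x ∈ t, H.adj (iv v) x} hX).trans ((Dv.float _ _ _ _).trans
    (Dv.par_left _ (Dv.iso (ind_plug s t u hu hd hm))))

theorem URed.dv {α : Type*} {L G F : α → LGraph} (h : URed L G) (h' : ∀ x, Dv (G x) (F x)) : URed L F :=
  h.trans (URed.of_dv h')

theorem sz_empty : sz LGraph.empty = 0 := sz_eq_zero.2 inferInstance

theorem CR_triv {G A : LGraph} (S : Set G.V) (hG : Pv G) (hA : Pv A) :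
    URed (fun X : LGraph => pp LGraph.empty X) (fun X => plg G S X) ∧ Pv (pp LGraph.empty A) :=
  ⟨⟨G, S, hG, fun X => Dv.plug _ _ (Dv.iso (empty_glue inferInstance))⟩, Pv.par (Dv.refl _) hA⟩

/-- a module may be split off a plug -/
theorem plg_split1 {H : LGraph} {S : Set H.V} (s : Set H.V) (X : LGraph)
    (h : ∀ v, v ∉ s → ∀ x ∈ s, (H.adj v x ↔ v ∈ S)) :
    (plg (H.ind sᶜ) {x | iv x ∈ S} (plg (H.ind s) {x | iv x ∈ S} X)).iso (plg H S X) := by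
  refine iso_of_fun (gelim (fun e => gl (iv e)) (gelim (fun e => gl (iv e)) gr)) ?_ ?_ ?_ ?_
  · have k : ∀ (a : (H.ind sᶜ).V) (b : (H.ind s).V), iv a ≠ iv b :=
      fun a b hab => iv_mem a (show iv a ∈ s by rw [hab]; exact iv_mem b)
    have k' : ∀ (a : (H.ind sᶜ).V) (b : (H.ind s).V), iv b ≠ iv a := fun a b hab => k a b hab.symm
    simp only [glue_forall]
    simp [k, k']
  · rw [glue_forall]
    refine ⟨fun a => ?_, fun a => ⟨gr (gr a), rfl⟩⟩
    by_cases ha : a ∈ s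
    · exact ⟨gr (gl (im a ha)), rfl⟩
    · exact ⟨gl (im a ha), rfl⟩
  · have k1 : ∀ (a : (H.ind sᶜ).V) (b : (H.ind s).V), iv a ∈ S ↔ H.adj (iv a) (iv b) :=
      fun a b => (h _ (iv_mem a) _ (iv_mem b)).symm
    simp only [glue_forall]
    refine ⟨fun a => ⟨fun b => Iff.rfl, fun b => k1 a b, fun b => Iff.rfl⟩, ⟨fun a => ⟨fun b => (k1 b a).trans ⟨fun h => H.symm h, fun h => H.symm h⟩, fun b => Iff.rfl, fun b => Iff.rfl⟩, fun a => ⟨fun b => Iff.rfl, fun b => Iff.rfl, fun b => Iff.rfl⟩⟩⟩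
  · simp only [glue_forall]
    simp

/-- a provable piece can be inserted in a plug -/
theorem Dv.absorb_plg {H X : LGraph} {S : Set H.V} (s : Set H.V) (Z : LGraph) (hm : Mod H s)
    (hS : ∀ x ∈ s, ∀ y ∈ s, x ∈ S → y ∈ S) (hX : Pv (pp X (H.ind s))) :
    Dv (plg (H.ind sᶜ) {x | iv x ∈ S} Z) (pp X (plg H S Z)) := by
  have e : ∀ v, (gl v : (plg H S Z).V) ∈ {x : (plg H S Z).V | ∃ v ∈ s, x = gl v} ↔ v ∈ s := by
    intro v; simp
  refine (Dv.iso (plg_ind_l {x | ∃ v ∈ s, x = gl v}ᶜ sᶜ (fun v => not_congr (e v)) ?_)).trans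
    ((Dv.absorb {x | ∃ v ∈ s, x = gl v}ᶜ {x | ∃ v ∈ s, x = gl v} Set.univ ?_ ?_ ?_ (hX.iso (iso_par (iso.refl _) (plg_ind_r _ _ e ?_)))).trans
      (Dv.par_left _ (Dv.iso (ind_univ (fun _ => trivial)))))
  · rintro a ⟨v, _, h⟩; simp at h
  · intro x; simp only [Set.mem_univ, true_iff]; exact (Classical.em _).symm
  · intro x hx; exact hx
  · rintro v hv _ ⟨x, hx, rfl⟩ _ ⟨y, hy, rfl⟩
    rcases glue_cases v with ⟨v, rfl⟩ | ⟨v, rfl⟩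
    · have hv : v ∉ s := fun h => hv ((e v).2 h)
      simp only [glue_ll]
      exact hm v hv x hx y hy
    · simp only [glue_rl]; exact hS x hx y hy
  · rintro a ⟨v, _, h⟩; simp at h

theorem CR_P {n : ℕ} (hlt : Lt n) {G1 G2 A : LGraph} {S : Set G2.V} (hn : sz G1 + (sz G2 + sz A) ≤ n)
    (h : GoodP G1 G2 S A) :
    ∃ K', URed (fun X : LGraph => pp K' X) (fun X => pp G1 (plg G2 S X)) ∧ Pv (pp K' A) ∧
      sz K' < sz G1 + sz G2 := by
  rcases h with ⟨ι, K, f, i0, q, hCG, hred, ⟨v, hv⟩, hS, h5, h6, him⟩ | ⟨s, X, Y, h1, ⟨v, h2⟩, h3, h4, h5⟩ | ⟨s, X, Y, h1, h2, ⟨v, h3⟩, h4, h5, h6⟩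
  · have hszK := hred.sz_le
    have hpos : 0 < sz G2 := sz_pos.2 ⟨v⟩
    by_cases hne : ∃ x, f x = i0
    · have hPlt : sz ((pp K G2).ind {x | f x = i0}) < sz K + sz G2 := by
        rw [← sz_glue]; exact sz_ind_lt' (x := gr v) hv
      obtain ⟨K', k1, k2, k3, -⟩ := hlt.CR h6 (by omega)
      refine ⟨K', ?_, k2, by omega⟩
      refine (k1.trans (Pull hCG h5 (pT S) ?_ ?_ hne)).trans ((URed.of_dv fun X => Dv.iso (plug_pp _ _ _ _)).trans (hred.urd _))
      · rw [glue_forall]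
        refine ⟨fun a ha => by simp, fun a ha => ?_⟩
        rw [pT_r, hS a ha]; simp
      · rw [glue_forall]
        exact ⟨fun a ha => by simp at ha, fun a ha => rfl⟩
    · push Not at hne
      have hPe : IsEmpty ((pp K G2).ind {x | f x = i0}).V := ind_isEmpty hne
      have hA : Pv A := h6.iso (empty_glue hPe)
      have hE : Pv (pp K G2) := by
        refine L1 hCG fun i => ?_
        by_cases hi : i = i0
        · subst hi; exact Pv_of_isEmpty hPe
        · exact h5 i hi
      obtain ⟨e1, e2⟩ := CR_triv (pT S) hE hA
      refine ⟨LGraph.empty, ?_, e2, by rw [sz_empty]; omega⟩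
      exact e1.trans ((URed.of_dv fun X => Dv.iso (plug_pp _ _ _ _)).trans (hred.urd _))
  · have hszK := h3.sz_l
    have hlt' : sz (G2.ind s) < sz G2 := sz_ind_lt' h2
    obtain ⟨K', k1, k2, k3, -⟩ := hlt.CR (h4.iso (plug_pp _ _ _ _).symm) (by rw [sz_glue]; omega)
    rw [sz_glue] at k3
    refine ⟨K', ?_, k2, by omega⟩
    refine k1.trans ((URed.plug _ (pT {x | iv x ∈ S}) h5).trans (URed.trans (URed.of_dv fun Z => ?_) (h3.urd _)))
    refine (Dv.plug _ _ (Dv.iso (plug_pp _ _ _ _))).trans ((Dv.float _ _ _ _).trans ?_)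
    refine Dv.iso (iso.trans (iso_par (iso.refl _) (iso.trans (plug_pp _ _ _ _) (iso_par (iso.refl _) (plg_split1 s Z h1)))) (par_assoc _ _ _).symm)
  · have hszK := h4.sz_l
    have hlt' : sz (G2.ind sᶜ) < sz G2 := sz_ind_lt' (x := v) (fun h => h h3)
    obtain ⟨K', k1, k2, k3, -⟩ := hlt.CR (h6.iso (plug_pp _ _ _ _).symm) (by rw [sz_glue]; omega)
    rw [sz_glue] at k3
    refine ⟨K', ?_, k2, by omega⟩
    refine k1.trans (URed.trans (URed.of_dv fun Z => ?_) (h4.urd _))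
    refine (Dv.iso (plug_pp _ _ _ _)).trans ((Dv.par_left _ (Dv.absorb_plg s Z h1 h2 h5)).trans (Dv.iso ?_))
    exact (par_lcomm _ _ _).trans (par_assoc _ _ _).symm

/-- splitting a plug along a component -/
theorem plg_comp {G : LGraph} {S : Set G.V} (g : Set G.V) (hg : ∀ x ∈ g, ∀ y, G.adj x y → y ∈ g)
    (hS : ∀ x ∈ S, x ∈ g) (X : LGraph) :
    (pp (G.ind gᶜ) (plg (G.ind g) {x | iv x ∈ S} X)).iso (plg G S X) := by
  refine iso_of_fun (gelim (fun e => gl (iv e)) (gelim (fun e => gl (iv e)) gr)) ?_ ?_ ?_ ?_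
  · have k : ∀ (a : (G.ind gᶜ).V) (b : (G.ind g).V), iv a ≠ iv b :=
      fun a b hab => iv_mem a (show iv a ∈ g by rw [hab]; exact iv_mem b)
    have k' : ∀ (a : (G.ind gᶜ).V) (b : (G.ind g).V), iv b ≠ iv a := fun a b hab => k a b hab.symm
    simp only [glue_forall]
    simp [k, k']
  · rw [glue_forall]
    refine ⟨fun a => ?_, fun a => ⟨gr (gr a), rfl⟩⟩
    by_cases ha : a ∈ g
    · exact ⟨gr (gl (im a ha)), rfl⟩
    · exact ⟨gl (im a ha), rfl⟩
  · have k1 : ∀ (a : (G.ind gᶜ).V) (b : (G.ind g).V), False ↔ G.adj (iv a) (iv b) :=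
      fun a b => ⟨False.elim, fun h => iv_mem a (hg _ (iv_mem b) _ (G.symm h))⟩
    have k2 : ∀ (a : (G.ind gᶜ).V), False ↔ iv a ∈ S :=
      fun a => ⟨False.elim, fun h => iv_mem a (hS _ h)⟩
    simp only [glue_forall]
    refine ⟨fun a => ⟨fun b => Iff.rfl, fun b => k1 a b, fun b => k2 a⟩, ⟨fun a => ⟨fun b => (k1 b a).trans ⟨fun h => G.symm h, fun h => G.symm h⟩, fun b => Iff.rfl, fun b => Iff.rfl⟩, fun a => ⟨fun b => k2 b, fun b => Iff.rfl, fun b => Iff.rfl⟩⟩⟩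
  · simp only [glue_forall]
    simp

theorem CR_of {D : LGraph} (hp : Pv D) (hlt : Lt (sz D)) (hsw : SWS D) : CRS D := by
  intro G S A φ
  have hp' := hp.iso φ
  by_cases hA : Nonempty A.V
  swap
  · rw [not_nonempty_iff] at hA
    obtain ⟨e1, e2⟩ := CR_triv S (hp'.iso (glue_empty hA)) (Pv_of_isEmpty hA)
    refine ⟨LGraph.empty, e1, e2, by rw [sz_empty]; omega, ?_⟩
    rintro ⟨x, hx⟩
    rw [sz_empty]; exact sz_pos.2 ⟨x⟩
  by_cases hS : S.Nonempty
  swap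
  · rw [Set.not_nonempty_iff_eq_empty] at hS
    subst hS
    refine ⟨G, URed.of_dv fun X => Dv.refl _, hp', le_rfl, ?_⟩
    rintro ⟨x, hx⟩
    exact hx.elim
  obtain ⟨a0⟩ := hA
  obtain ⟨x0, hx0⟩ := hS
  obtain ⟨h, ha, hcl, hconn⟩ := Conn.comp (plg G S A) (gr a0)
  have hSg : ∀ x ∈ S, x ∈ {v : G.V | gl v ∈ h} := by
    intro x hx
    exact hcl _ ha _ (by simpa using hx)
  have hAh : ∀ a : A.V, gr a ∈ h := by
    intro a
    exact hcl _ (hSg x0 hx0) _ (by simpa using hx0)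
  have hiso := fun X => plg_comp {v : G.V | gl v ∈ h} (fun x hx y hxy => hcl _ hx _ (by simpa using hxy)) hSg X
  have hgood := hsw (G.ind {v : G.V | gl v ∈ h}ᶜ) (plg (G.ind {v : G.V | gl v ∈ h}) {x | iv x ∈ S} A) {x | ∃ a, x = gr a}
    (φ.trans (hiso A).symm) (hconn.iso (plg_ind_l h _ (fun _ => Iff.rfl) hAh).symm) ?_ ⟨_, a0, rfl⟩ ⟨gl (im x0 (hSg x0 hx0)), ?_⟩
  · have hn : sz D = sz (G.ind {v : G.V | gl v ∈ h}ᶜ) + (sz (G.ind {v : G.V | gl v ∈ h}) + sz A) := by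
      rw [sz_iso (φ.trans (hiso A).symm), sz_glue, sz_glue]
    have hn' : sz D = sz G + sz A := by rw [sz_iso φ, sz_glue]
    obtain ⟨K', k1, k2, k3⟩ := CR_P hlt hn.ge (hgood.goodP a0)
    exact ⟨K', k1.dv fun X => Dv.iso (hiso X), k2, by omega, fun _ => by omega⟩
  · rintro v hv _ ⟨x, rfl⟩ _ ⟨y, rfl⟩
    rcases glue_cases v with ⟨v, rfl⟩ | ⟨v, rfl⟩
    · simp only [glue_lr]; exact id
    · exact (hv ⟨_, rfl⟩).elim
  · rintro ⟨a, ha⟩; simp at ha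

theorem main1 {D : LGraph} (hp : Pv D) (hlt : Lt (sz D)) (hw : WS D) : Psi D := by
  have hT := T_of_W hp hlt hw
  have hSW := SW_of hlt hw hT
  exact ⟨hw, hT, hSW, CR_of hp hlt hSW⟩

def Cl (D : LGraph) (h : Set D.V) : Prop := ∀ x ∈ h, ∀ y, D.adj x y → y ∈ h

theorem ind_closed {D : LGraph} {h : Set D.V} (hc : Cl D h) : (pp (D.ind hᶜ) (D.ind h)).iso D :=
  (ind_par hᶜ h Set.univ (by intro x; simp; tauto) (fun x hx => hx)
    (fun v hv x hx hvx => hv (hc x hx v (D.symm hvx)))).trans (ind_univ fun _ => trivial)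

/-- closed sets inside an induced subgraph -/
theorem ind_closed' {D : LGraph} {h : Set D.V} (hc : Cl D h) (s : Set D.V) (hs : ∀ x ∈ h, x ∈ s) :
    (pp (D.ind {x | x ∈ s ∧ x ∉ h}) (D.ind h)).iso (D.ind s) :=
  ind_par _ _ _ (by intro x; have := hs x; simp; tauto) (fun x hx => hx.2)
    (fun v hv x hx hvx => hv.2 (hc x hx v (D.symm hvx)))

theorem Gp {D : LGraph} {n : ℕ} (hcr : CRS D) {E Z : LGraph} (hp : Pv D) {T : Set E.V} (φ : D.iso (plg E T Z))
    (hT : T.Nonempty) (hlt : Lt n) (hn : sz E + sz Z ≤ n) {L H : LGraph} (hd : Dv Z (pp L H))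
    (hsz : sz L + sz H ≤ sz Z) (hc : Conn H) (h2 : ∃ x y : H.V, x ≠ y) {G : LGraph}
    (hg : Dv (plg E T L) G) : Good G H ∅ := by
  obtain ⟨K, k1, k2, -, k3⟩ := hcr E T Z φ
  have k3 := k3 hT
  have hp2 : Pv (pp (pp K L) H) := (k2.dv (Dv.par_left _ hd)).iso (par_assoc _ _ _).symm
  have := hlt.W hp2 (by rw [sz_glue]; omega) hc h2
  exact (this.red (k1.red L)).red (Red.of_dv hg)

structure SD (n : ℕ) (G0 H0 A : LGraph) (S h : Set H0.V) : Prop where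
  hlt : Lt n
  hn : sz G0 + (sz H0 + sz A) ≤ n
  hp : Pv (pp G0 (plg H0 S A))
  hpsi : Psi (pp G0 (plg H0 S A))
  cl : Cl H0 h
  conn : Conn (H0.ind h)
  two : ∃ x y : (H0.ind h).V, x ≠ y
  cn : Conn (plg H0 S A)
  hA : Nonempty A.V
  hS : ∃ x ∈ h, x ∈ S
  hS' : ∃ x ∈ h, x ∉ S

theorem SD.cut {n : ℕ} {G0 H0 A : LGraph} {S h : Set H0.V} (d : SD n G0 H0 A S h) (u : Set H0.V)
    (h1 : ∃ x ∈ h, x ∈ u) (h2 : ∃ x ∈ h, x ∉ u) : ∃ x ∈ h, x ∈ u ∧ ∃ y ∈ h, y ∉ u ∧ H0.adj x y := by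
  obtain ⟨x, h1, h1'⟩ := h1
  obtain ⟨y, h2, h2'⟩ := h2
  obtain ⟨a, ha, b, hb, hab⟩ := d.conn {x | iv x ∈ u} ⟨im x h1, h1'⟩ ⟨im y h2, h2'⟩
  exact ⟨iv a, iv_mem a, ha, iv b, iv_mem b, hb, hab⟩

theorem SD.cutA {n : ℕ} {G0 H0 A : LGraph} {S h : Set H0.V} (d : SD n G0 H0 A S h) (u : Set H0.V)
    (h1 : ∃ x, x ∉ u) : ∃ x, x ∉ u ∧ (x ∈ S ∨ ∃ y ∈ u, H0.adj x y) := by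
  obtain ⟨x, h1⟩ := h1
  obtain ⟨a0⟩ := d.hA
  obtain ⟨a, ha, b, hb, hab⟩ := d.cn {x | ∃ v, v ∉ u ∧ x = gl v} ⟨gl x, x, h1, rfl⟩ ⟨gr a0, by simp⟩
  obtain ⟨v, hv, rfl⟩ := ha
  refine ⟨v, hv, ?_⟩
  rcases glue_cases b with ⟨b, rfl⟩ | ⟨b, rfl⟩
  · right
    refine ⟨b, ?_, by simpa using hab⟩
    by_contra h; exact hb ⟨b, h, rfl⟩
  · left; simpa using hab

theorem SD.G {n : ℕ} {G0 H0 A : LGraph} {S h : Set H0.V} (d : SD n G0 H0 A S h) (s : Set H0.V)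
    (h1 : ∀ v, v ∉ s → ∀ x ∈ s, (H0.adj v x ↔ v ∈ S)) (h2 : ∃ v, v ∉ s) (hs : ∀ x ∈ h, x ∈ s) :
    Good (pp G0 (pp (H0.ind hᶜ) A)) (H0.ind h) ∅ := by
  have hT : ∃ x, x ∉ s ∧ x ∈ S := by
    obtain ⟨x, hx, h | ⟨y, hy, hxy⟩⟩ := d.cutA s h2
    · exact ⟨x, hx, h⟩
    · exact ⟨x, hx, (h1 x hx y hy).1 hxy⟩
  obtain ⟨t, hts, htS⟩ := hT
  have hsplit : sz H0 = sz (H0.ind sᶜ) + sz (H0.ind s) := by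
    have := sz_iso (plg_split1 s LGraph.empty h1)
    rw [sz_glue, sz_glue, sz_glue, sz_empty] at this
    omega
  have e2 := sz_iso (ind_closed' d.cl s hs)
  rw [sz_glue] at e2
  refine Gp (E := pp G0 (H0.ind sᶜ)) (T := pT {x | iv x ∈ S}) (Z := plg (H0.ind s) {x | iv x ∈ S} A)
    (L := pp (H0.ind {x | x ∈ s ∧ x ∉ h}) A) d.hpsi.2.2.2 d.hp ?_ ⟨gr (im t hts), by simpa using htS⟩ d.hlt ?_ ?_ ?_ d.conn d.two ?_
  · exact (iso_par (iso.refl _) (plg_split1 s A h1).symm).trans (plug_pp _ _ _ _).symm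
  · rw [sz_glue, sz_glue]; have := d.hn; omega
  · refine (Dv.ss _ _ _).trans (Dv.iso ?_)
    exact (iso_par (ind_closed' d.cl s hs).symm (iso.refl _)).trans (par_rcomm _ _ _)
  · rw [sz_glue, sz_glue]; omega
  · refine (Dv.ss _ _ _).trans (Dv.iso ?_)
    refine (par_assoc _ _ _).trans (iso_par (iso.refl _) ((par_assoc _ _ _).symm.trans (iso_par ?_ (iso.refl _))))
    refine ind_par _ _ _ ?_ ?_ ?_
    · intro x; have := hs x
      simp; tauto
    · intro x hx hx'; exact hx hx'.1
    · intro v hv x hx hvx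
      have hvS := (h1 v hv x hx.1).1 hvx
      obtain ⟨y, hy⟩ := d.two
      exact hv (hs v (d.cl _ (iv_mem y) v (H0.symm ((h1 v hv _ (hs _ (iv_mem y))).2 hvS))))

theorem SD.full {n : ℕ} {G0 H0 A : LGraph} {S h : Set H0.V} (d : SD n G0 H0 A S h)
    (hh : ∀ x, x ∈ h) (hg : Good (pp G0 A) H0 ∅) : Good (pp G0 (pp (H0.ind hᶜ) A)) (H0.ind h) ∅ := by
  refine (hg.iso (ind_univ hh).symm).red (Red.iso (iso_par (iso.refl _) (iso.symm (empty_glue ?_))))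
  exact ind_isEmpty fun x hx => hx (hh x)

theorem SD.B1 {n : ℕ} {G0 H0 A : LGraph} {S h : Set H0.V} (d : SD n G0 H0 A S h)
    (hg : GPB1 G0 H0 S A) : Good (pp G0 (pp (H0.ind hᶜ) A)) (H0.ind h) ∅ := by
  obtain ⟨s, X, Y, h1, h2, h3, h4, h5⟩ := hg
  by_cases e1 : ∀ x ∈ h, x ∈ s
  · exact d.G s h1 h2 e1
  obtain ⟨x0, hx0, hx0S⟩ := d.hS
  have hsz := h3.sz_l
  have hAp := sz_pos.2 d.hA
  have hn := d.hn
  by_cases e2 : ∀ x ∈ h, x ∉ s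
  · have hs : ∀ x, x ∉ s := fun x hx => e2 x (d.cl x0 hx0 x ((h1 x0 (e2 _ hx0) x hx).2 hx0S)) hx
    have hXA : Pv (pp X A) := h4.iso (iso_par (iso.refl _) (empty_glue (ind_isEmpty hs)))
    have hY : Pv (pp (pp Y (H0.ind hᶜ)) (H0.ind h)) :=
      h5.iso (iso.trans (iso_par (iso.refl _) ((ind_univ (s := sᶜ) hs).trans (ind_closed d.cl).symm)) (par_assoc _ _ _).symm)
    have e := sz_iso (ind_closed d.cl)
    rw [sz_glue] at e
    have := d.hlt.W hY (by rw [sz_glue]; omega) d.conn d.two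
    refine this.red (Red.trans (Red.of_dv ((Dv.insert ∅ hXA).trans (Dv.iso ?_))) (h3.par _))
    exact iso_of_fun (gelim (gelim (fun a => gl (gr a)) (fun a => gr (gl a))) (gelim (fun a => gl (gl a)) (fun a => gr (gr a)))) (by simp) (by simp) (by simp) (by simp)
  · push Not at e1 e2
    obtain ⟨x, hx, hxs, v, hv, hvs, hxv⟩ := d.cut s e2 e1
    have hvS := (h1 v hvs x hxs).1 (H0.symm hxv)
    have hsh : ∀ y ∈ s, y ∈ h := fun y hy => d.cl v hv y ((h1 v hvs y hy).2 hvS)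
    have hh : ∀ y, y ∈ h := by
      by_contra hcon
      push Not at hcon
      obtain ⟨y, hy, hyS | ⟨z, hz, hyz⟩⟩ := d.cutA h hcon
      · exact hy (d.cl x hx y (H0.symm ((h1 y (fun h => hy (hsh y h)) x hxs).2 hyS)))
      · exact hy (d.cl z hz y (H0.symm hyz))
    refine d.full hh (Or.inr ⟨s, pp X A, Y, ?_, ⟨x, hxs⟩, ⟨v, hvs⟩, ?_, ?_, h5, Or.inl (by simp)⟩)
    · intro v hv x hx y hy; rw [h1 v hv x hx, h1 v hv y hy]; exact id
    · exact (Red.iso (par_rcomm _ _ _)).trans (h3.par _)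
    · refine (h4.dv (Dv.par_left _ (Dv.ss _ _ _))).iso ?_
      exact (par_assoc _ _ _).symm.trans (par_rcomm _ _ _)

theorem SD.B2 {n : ℕ} {G0 H0 A : LGraph} {S h : Set H0.V} (d : SD n G0 H0 A S h)
    (hg : GPB2 G0 H0 S A) : Good (pp G0 (pp (H0.ind hᶜ) A)) (H0.ind h) ∅ := by
  obtain ⟨s, X, Y, h1, h2, ⟨x1, h3⟩, h4, h5, h6⟩ := hg
  have hsz := h4.sz_l
  have hn := d.hn
  have h6' : Pv (pp Y (pp (H0.ind sᶜ) A)) := h6.dv (Dv.par_left _ (Dv.ss _ _ _))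
  by_cases e2 : ∀ x ∈ h, x ∉ s
  · have hp : Pv (pp (pp Y (pp (H0.ind {x | x ∈ sᶜ ∧ x ∉ h}) A)) (H0.ind h)) := by
      refine h6'.iso (iso.trans (iso_par (iso.refl _) (iso_par (ind_closed' d.cl sᶜ e2).symm (iso.refl _))) ?_)
      exact iso.trans (iso_par (iso.refl _) (par_rcomm _ _ _)) (par_assoc _ _ _).symm
    have e := sz_iso (ind_closed' d.cl sᶜ e2)
    rw [sz_glue] at e
    have e' : sz (H0.ind sᶜ) < sz H0 := sz_ind_lt' (x := x1) (fun h => h h3)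
    have := d.hlt.W hp (by rw [sz_glue, sz_glue]; omega) d.conn d.two
    refine this.red (Red.trans (Red.of_dv ?_) (h4.par _))
    have ha : Dv (H0.ind {x | x ∈ sᶜ ∧ x ∉ h}) (pp X (H0.ind hᶜ)) := by
      refine Dv.absorb _ s _ ?_ (fun x hx => hx.1) (fun v hv => h1 v hv.1) h5
      intro x
      have := e2 x
      simp; tauto
    refine (Dv.par_left _ (Dv.par_right _ ha)).trans (Dv.iso ?_)
    exact iso_of_fun (gelim (fun a => gl (gr a)) (gelim (gelim (fun a => gl (gl a)) (fun a => gr (gl a))) (fun a => gr (gr a)))) (by simp) (by simp) (by simp) (by simp)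
  by_cases e1 : ∀ x ∈ h, x ∈ s
  · obtain ⟨x, hx, hx'⟩ := d.hS
    obtain ⟨y, hy, hy'⟩ := d.hS'
    exact (hy' (h2 x (e1 x hx) y (e1 y hy) hx')).elim
  push Not at e1 e2
  obtain ⟨x, hx, hxs, v, hv, hvs, hxv⟩ := d.cut s e2 e1
  have hsh : ∀ y ∈ s, y ∈ h := fun y hy => d.cl v hv y (h1 v hvs x hxs y hy (H0.symm hxv))
  refine Or.inr ⟨{x | iv x ∈ s}, X, pp Y (pp (H0.ind hᶜ) A), ?_, ⟨im x hx, hxs⟩, ⟨im v hv, hvs⟩, ?_, ?_, ?_, Or.inl (by simp)⟩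
  · intro v hv x hx y hy; exact h1 _ hv _ hx _ hy
  · exact (Red.iso (par_assoc _ _ _).symm).trans (h4.par _)
  · exact h5.iso (iso_par (iso.refl _) (iso.symm (ind_ind' _ _ _ hsh (fun _ => Iff.rfl))))
  · refine h6'.iso (iso.trans (iso_par (iso.refl _) (iso_par (iso.symm (ind_par hᶜ {x | x ∈ h ∧ x ∉ s} sᶜ ?_ (fun x hx h => hx h.1) ?_)) (iso.refl _))) ?_)
    · intro x; have := hsh x; simp; tauto
    · intro v hv x hx hvx; exact hv (d.cl x hx.1 v (H0.symm hvx))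
    · refine iso.trans (iso_par (iso.refl _) (par_rcomm _ _ _)) (iso.trans (par_assoc _ _ _).symm (iso_par (iso.refl _) ?_))
      exact iso.symm (ind_ind' _ _ _ (fun x hx => hx.1) (fun x => ⟨fun h => ⟨iv_mem x, h⟩, fun h => h.2⟩))

theorem L1J {ι : Type} {E : LGraph} {col : E.V → Bool} {f : E.V → ι}
    {q : ι → ι → Prop} (h : CG E col f q) (J : Set ι) (hp : ∀ i ∈ J, Pv (E.ind {x | f x = i})) :
    Pv (E.ind {x | f x ∈ J}) := by
  refine L1 (h.ind _) fun i => ?_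
  by_cases hi : i ∈ J
  · refine (hp i hi).iso (iso.symm (ind_ind' _ _ _ ?_ (fun _ => Iff.rfl)))
    intro x hx; have hx : f x = i := hx
    show f x ∈ J
    rwa [hx]
  · refine Pv_of_isEmpty (ind_isEmpty fun x hx => hi ?_)
    have hx : f (iv x) = i := hx
    have h2 : f (iv x) ∈ J := iv_mem x
    rwa [hx] at h2

theorem SD.Aa {n : ℕ} {G0 H0 A : LGraph} {S h : Set H0.V} (d : SD n G0 H0 A S h)
    {ι : Type} {K : LGraph} {f : (pp K H0).V → ι} {i0 : ι} {q : ι → ι → Prop} (hcg : CG (pp K H0) kc f q)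
    (hred : Red K G0) (hq : ∀ v : H0.V, f (gr v) ≠ i0 → (v ∈ S ↔ q (f (gr v)) i0))
    (h5 : ∀ j, j ≠ i0 → Pv ((pp K H0).ind {x | f x = j}))
    (h6 : Pv (plg ((pp K H0).ind {x | f x = i0}) {x | iv x ∈ (pT S : Set (pp K H0).V)} A))
    (htwo : ∃ x ∈ h, ∃ y ∈ h, f (gr x) ≠ f (gr y))
    (pure : ∀ x ∈ h, ∀ y, f (gr y) = f (gr x) → y ∈ h) {x : H0.V} (hx : x ∈ h) (hxi : f (gr x) = i0) :
    Good (pp G0 (pp (H0.ind hᶜ) A)) (H0.ind h) ∅ := by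
  have hh : ∀ y, y ∈ h := by
    by_contra hcon
    push Not at hcon
    obtain ⟨y, hy, hyS | ⟨z, hz, hyz⟩⟩ := d.cutA h hcon
    · have hyi : f (gr y) ≠ i0 := fun e => hy (pure x hx y (e.trans hxi.symm))
      refine hy (d.cl x hx y (H0.symm ((hcg.H y x (by rwa [hxi])).2 ?_)))
      rw [hxi]; exact (hq y hyi).1 hyS
    · exact hy (d.cl z hz y (H0.symm hyz))
  refine d.full hh (Or.inl ?_)
  refine mkGoodA (K := plg K {a | f (gl a) ≠ i0 ∧ ¬ q (f (gl a)) i0} A)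
    (f := gelim (gelim (fun a => f (gl a)) (fun _ => i0)) (fun v => f (gr v))) (q := q) ?_ ?_ ?_ ?_ (by simp)
  · refine CG_pp hcg.qs ?_ ?_
    · simp only [glue_forall, gelim_gl, gelim_gr]
      refine ⟨fun a => ⟨fun b hb => ?_, fun b hb => ?_⟩, fun a => ⟨fun b hb => ?_, fun b hb => (hb rfl).elim⟩⟩
      · simpa using hcg.K a b hb
      · simp; exact fun _ => hb
      · have : q i0 (f (gl b)) ↔ q (f (gl b)) i0 := ⟨hcg.qs _ _, hcg.qs _ _⟩
        simp [this]; exact fun _ => Ne.symm hb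
    · intro a b hab; exact hcg.H a b hab
  · intro j
    by_cases hj : j = i0
    · subst hj
      refine (h6.dv (Dv.ss _ _ _)).iso ?_
      refine iso_ind (gelim (fun a => (gelim (fun a => gl (gl a)) gr : (pp K H0).V → _) (iv a)) (fun a => gl (gr a))) ?_ ?_ ?_ ?_ ?_
      · have : ∀ x x' : (pp K H0).V, (gelim (fun a => gl (gl a)) gr x : (pp (plg K {a | f (gl a) ≠ j ∧ ¬ q (f (gl a)) j} A) H0).V) = gelim (fun a => gl (gl a)) gr x' → x = x' := by
          simp only [glue_forall]; simp
        have h' : ∀ (x : (pp K H0).V) (y : A.V), (gelim (fun a => gl (gl a)) gr x : (pp (plg K {a | f (gl a) ≠ j ∧ ¬ q (f (gl a)) j} A) H0).V) ≠ gl (gr y) := by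
          simp only [glue_forall]; simp
        simp only [glue_forall]
        refine ⟨fun a => ⟨fun b hb => ?_, fun b hb => (h' _ _ hb).elim⟩, fun a => ⟨fun b hb => (h' _ _ hb.symm).elim, fun b hb => by simpa using hb⟩⟩
        rw [iv_inj (this _ _ hb)]
      · have : ∀ x : (pp K H0).V, f x = j → (gelim (fun a => gl (gl a)) gr x : (pp (plg K {a | f (gl a) ≠ j ∧ ¬ q (f (gl a)) j} A) H0).V) ∈ {x | (gelim (gelim (fun a => f (gl a)) (fun _ => j)) (fun v => f (gr v)) x) = j} := by
          simp only [glue_forall]; exact ⟨fun a h => h, fun a h => h⟩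
        rw [glue_forall]
        exact ⟨fun a => this _ (iv_mem a), fun a => rfl⟩
      · simp only [glue_forall]
        exact ⟨⟨fun a ha => ⟨gl (im (gl a) ha), rfl⟩, fun a ha => ⟨gr a, rfl⟩⟩, fun a ha => ⟨gl (im (gr a) ha), rfl⟩⟩
      · have : ∀ x x' : (pp K H0).V, ((pp K H0).adj x x' ↔ (pp (plg K {a | f (gl a) ≠ j ∧ ¬ q (f (gl a)) j} A) H0).adj (gelim (fun a => gl (gl a)) gr x) (gelim (fun a => gl (gl a)) gr x')) := by
          simp only [glue_forall]; simp
        have h' : ∀ (x : (pp K H0).V), f x = j → ∀ (y : A.V), ¬ (pp (plg K {a | f (gl a) ≠ j ∧ ¬ q (f (gl a)) j} A) H0).adj (gelim (fun a => gl (gl a)) gr x) (gl (gr y)) := by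
          simp only [glue_forall]; simp; tauto
        simp only [glue_forall]
        refine ⟨fun a => ⟨fun b => this _ _, fun b => ?_⟩, fun a => ⟨fun b => ?_, fun b => by simp⟩⟩
        · simpa using h' _ (iv_mem a) b
        · have := h' _ (iv_mem b) a
          simp only [gelim_gl, gelim_gr, glue_rl, false_iff]
          exact fun h => this (LGraph.symm _ h)
      · have : ∀ x : (pp K H0).V, (pp K H0).label x = (pp (plg K {a | f (gl a) ≠ j ∧ ¬ q (f (gl a)) j} A) H0).label (gelim (fun a => gl (gl a)) gr x) := by
          simp only [glue_forall]; simp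
        rw [glue_forall]
        exact ⟨fun a => this _, fun a => by simp⟩
    · refine (h5 j hj).iso (ind_iso (gelim (fun a => gl (gl a)) gr) ?_ ?_ ?_ ?_ ?_)
      · simp
      · simp only [glue_forall]; exact ⟨fun a h => h, fun a h => h⟩
      · simp only [glue_forall]
        exact ⟨⟨fun a ha => ⟨gl a, ha, rfl⟩, fun a ha => (hj (Eq.symm ha)).elim⟩, fun a ha => ⟨gr a, ha, rfl⟩⟩
      · simp
      · simp
  · exact (Red.of_dv (Dv.ss _ _ _)).trans (hred.par A)
  · obtain ⟨x, _, y, _, hxy⟩ := htwo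
    exact ⟨x, y, hxy⟩

theorem SD.Ab {n : ℕ} {G0 H0 A : LGraph} {S h : Set H0.V} (d : SD n G0 H0 A S h)
    {ι : Type} {K : LGraph} {f : (pp K H0).V → ι} {i0 : ι} {q : ι → ι → Prop} (hcg : CG (pp K H0) kc f q)
    (hred : Red K G0)
    (h5 : ∀ j, j ≠ i0 → Pv ((pp K H0).ind {x | f x = j}))
    (h6 : Pv (plg ((pp K H0).ind {x | f x = i0}) {x | iv x ∈ (pT S : Set (pp K H0).V)} A))
    (h7 : ∀ a : K.V, f (gl a) = i0 ∨ ∃ x : H0.V, f (gl a) = f (gr x))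
    (htwo : ∃ x ∈ h, ∃ y ∈ h, f (gr x) ≠ f (gr y))
    (pure : ∀ x ∈ h, ∀ y, f (gr y) = f (gr x) → y ∈ h) (hi : ∀ x : H0.V, f (gr x) ≠ i0) :
    Good (pp G0 (pp (H0.ind hᶜ) A)) (H0.ind h) ∅ := by
  have hred2 : Red (K.ind {a | ∃ x ∈ h, f (gl a) = f (gr x)}) (pp G0 (pp (H0.ind hᶜ) A)) := by
    have hnq : ∀ x ∈ h, ∀ y, y ∉ h → ¬ q (f (gr x)) (f (gr y)) := fun x hx y hy hh =>
      hy (d.cl x hx y ((hcg.H x y (fun e => hy (pure x hx y e.symm))).2 hh))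
    have r1 := Red.ctx (X := pp K H0) {x | f x ∈ {i | ∃ y, y ∉ h ∧ i = f (gr y)}} {x | ∃ a, x = gl a ∧ ∃ x ∈ h, f (gl a) = f (gr x)}
      {x | f x ∈ {i | ∃ y, y ∉ h ∧ i = f (gr y)} ∨ ∃ a, x = gl a ∧ ∃ x ∈ h, f (gl a) = f (gr x)} (fun x => Iff.rfl) ?_ ?_ ?_
    rotate_left
    · rintro _ ⟨y, hy, e⟩ ⟨a, rfl, x, hx, e'⟩
      exact hy (pure x hx y (e.symm.trans e'))
    · rintro v hv _ ⟨a, rfl, x, hx, e⟩ _ ⟨b, rfl, y, hy, e'⟩ hadj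
      rcases glue_cases v with ⟨v, rfl⟩ | ⟨v, rfl⟩
      · obtain ⟨z, hz, ez⟩ := hv
        rw [glue_ll, hcg.K v b ?_, ez, e']
        · exact fun h => hnq y hy z hz (hcg.qs _ _ h)
        · rw [ez, e']; exact fun h => hz (pure y hy z h)
      · simp at hadj
    · refine L1J hcg _ ?_
      rintro i ⟨y, hy, rfl⟩
      exact h5 _ (hi y)
    have r0 : (K.ind {a | ∃ x ∈ h, f (gl a) = f (gr x)}).iso ((pp K H0).ind {x | ∃ a, x = gl a ∧ ∃ x ∈ h, f (gl a) = f (gr x)}) := by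
      refine ind_iso gl (by simp) (fun x hx => ⟨x, rfl, hx⟩) ?_ (by simp) (by simp)
      rintro _ ⟨a, rfl, hh⟩
      exact ⟨a, hh, rfl⟩
    have r2 : ((pp K H0).ind {x | f x ∈ {i | ∃ y, y ∉ h ∧ i = f (gr y)} ∨ ∃ a, x = gl a ∧ ∃ x ∈ h, f (gl a) = f (gr x)}).iso
        ((pp (plg K {a | f (gl a) ≠ i0 ∧ ¬ q (f (gl a)) i0} A) (H0.ind hᶜ)).ind
          {x | gelim (gelim (fun a => f (gl a) ≠ i0) (fun _ => False)) (fun _ => True) x}) := by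
      refine iso.symm (ind_iso (gelim (gelim (fun a => gl a) (fun a => gr (d.hS.choose))) (fun a => gr (iv a))) ?_ ?_ ?_ ?_ ?_)
      · simp
      · simp only [glue_forall]
        refine ⟨⟨fun a ha => ?_, fun a ha => ha.elim⟩, fun a _ => ?_⟩
        · rcases h7 a with e | ⟨x, e⟩
          · exact (ha e).elim
          · by_cases hx : x ∈ h
            · exact Or.inr ⟨a, rfl, x, hx, e⟩
            · exact Or.inl ⟨x, hx, e⟩
        · exact Or.inl ⟨_, iv_mem a, rfl⟩
      · simp only [glue_forall]
        refine ⟨fun a ha => ⟨gl (gl a), ?_, rfl⟩, fun a ha => ⟨gr (im a ?_), trivial, rfl⟩⟩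
        · rcases ha with ⟨y, hy, e⟩ | ⟨b, hb, x, hx, e⟩
          · show f (gl a) ≠ i0
            rw [e]; exact hi y
          · show f (gl a) ≠ i0
            have : a = b := by simpa using hb
            rw [this, e]; exact hi x
        · rcases ha with ⟨y, hy, e⟩ | ⟨b, hb, x, hx, e⟩
          · exact fun ha => hy (pure a ha y e.symm)
          · simp at hb
      · simp
      · simp
    have r3 := Dv.ins (X := pp (plg K {a | f (gl a) ≠ i0 ∧ ¬ q (f (gl a)) i0} A) (H0.ind hᶜ))
      {x | gelim (gelim (fun a => f (gl a) ≠ i0) (fun _ => False)) (fun _ => True) x}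
      {x | gelim (gelim (fun a => f (gl a) = i0) (fun _ => True)) (fun _ => False) x} Set.univ ?_ ?_ ?_ ?_
    rotate_left
    · simp only [glue_forall]; simp; tauto
    · simp only [glue_forall]; simp
    · simp only [glue_forall]
      refine ⟨⟨fun a ha => ⟨⟨fun b hb => ⟨⟨fun c hc => ?_, fun c hc => ?_⟩, ?_⟩, fun b hb => ⟨⟨fun c hc => ?_, fun c hc => ?_⟩, ?_⟩⟩, ?_⟩, ?_⟩, ?_⟩
      · have ha : f (gl a) ≠ i0 := ha
        have hb : f (gl b) = i0 := hb
        have hc : f (gl c) = i0 := hc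
        simp only [glue_ll]
        rw [hcg.K a b (by rwa [hb]), hcg.K a c (by rwa [hc]), hb, hc]; exact id
      · have ha : f (gl a) ≠ i0 := ha
        have hb : f (gl b) = i0 := hb
        simp only [glue_ll, glue_lr]
        rw [hcg.K a b (by rwa [hb]), hb]; exact fun h => ⟨ha, h⟩
      · simp
      · have ha : f (gl a) ≠ i0 := ha
        have hc : f (gl c) = i0 := hc
        simp only [glue_ll, glue_lr]
        rw [hcg.K a c (by rwa [hc]), hc]; exact fun h => h.2
      · simp
      · simp
      · simp
      · simp
      · simp
    · refine (h6.dv (Dv.ss _ _ _)).iso ?_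
      refine iso.trans (iso_par (fib_pp1 f i0).symm (iso.refl _)) ?_
      refine iso.trans (iso_par (glue_empty (ind_isEmpty hi)) (iso.refl _)) ?_
      refine iso_ind (gelim (fun a => gl (gl (iv a))) (fun a => gl (gr a))) ?_ ?_ ?_ ?_ ?_
      · simp
      · simp only [glue_forall]; exact ⟨fun a => iv_mem a, fun a => trivial⟩
      · simp only [glue_forall]; exact ⟨⟨fun a ha => ⟨gl (im a ha), rfl⟩, fun a ha => ⟨gr a, rfl⟩⟩, fun a ha => ha.elim⟩
      · have hk : ∀ a : (K.ind {a | f (gl a) = i0}).V, f (gl (iv a)) = i0 := fun a => iv_mem a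
        simp [hk]
      · simp
    refine (Red.iso r0).trans (r1.trans ((Red.iso r2).trans ((Red.of_dv r3).trans ((Red.iso (ind_univ (by simp))).trans ?_))))
    refine (Red.of_dv (Dv.par_right _ (Dv.ss _ _ _))).trans (((hred.par A).par _).trans (Red.iso ?_))
    exact iso.trans (par_assoc _ _ _) (iso_par (iso.refl _) (par_comm _ _))
  refine Or.inl (mkGoodA (K := K.ind {a | ∃ x ∈ h, f (gl a) = f (gr x)}) (f := gelim (fun a => f (gl (iv a))) (fun a => f (gr (iv a)))) (q := q) ?_ ?_ hred2 ?_ (by simp))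
  · refine CG_pp hcg.qs ?_ ?_
    · intro a b hab; exact hcg.K _ _ hab
    · intro a b hab; exact hcg.H _ _ hab
  · intro i
    by_cases hii : ∃ x ∈ h, f (gr x) = i
    · obtain ⟨x0, hx0, rfl⟩ := hii
      refine (h5 _ (hi x0)).iso (iso.symm (ind_iso (gelim (fun a => gl (iv a)) (fun x => gr (iv x))) ?_ ?_ ?_ ?_ ?_))
      · simp only [glue_forall]
        refine ⟨fun a _ => ⟨fun b _ hb => ?_, by simp⟩, fun a _ => ⟨by simp, fun b _ hb => ?_⟩⟩
        · simp only [gelim_gl, gl_inj] at hb; rw [iv_inj hb]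
        · simp only [gelim_gr, gr_inj] at hb; rw [iv_inj hb]
      · simp only [glue_forall]; exact ⟨fun a ha => ha, fun a ha => ha⟩
      · simp only [glue_forall]
        exact ⟨fun a ha => ⟨gl (im a ⟨x0, hx0, ha⟩), ha, rfl⟩, fun a ha => ⟨gr (im a (pure x0 hx0 a ha)), ha, rfl⟩⟩
      · simp only [glue_forall]
        exact ⟨fun a _ => ⟨fun b _ => Iff.rfl, by simp⟩, fun a _ => ⟨by simp, fun b _ => Iff.rfl⟩⟩
      · simp only [glue_forall]
        exact ⟨fun a _ => rfl, fun a _ => rfl⟩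
    · refine Pv_of_isEmpty (ind_isEmpty ?_)
      rw [glue_forall]
      refine ⟨fun a ha => ?_, fun a ha => hii ⟨_, iv_mem a, ha⟩⟩
      obtain ⟨x, hx, e⟩ := iv_mem a
      exact hii ⟨x, hx, e.symm.trans ha⟩
  · obtain ⟨x, hx, y, hy, hxy⟩ := htwo
    exact ⟨im x hx, im y hy, hxy⟩

theorem SD.A {n : ℕ} {G0 H0 A : LGraph} {S h : Set H0.V} (d : SD n G0 H0 A S h)
    (hg : GPA G0 H0 S A) : Good (pp G0 (pp (H0.ind hᶜ) A)) (H0.ind h) ∅ := by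
  obtain ⟨ι, K, f, i0, q, hcg, hred, h3, h4, h5, h6, h7⟩ := hg
  by_cases e1 : ∀ x ∈ h, f (gr x) = i0
  · refine d.G {v | f (gr v) = i0} ?_ h3 e1
    intro v hv x hx
    have hx : f (gr x) = i0 := hx
    have hv : f (gr v) ≠ i0 := hv
    rw [hcg.H v x (by rwa [hx]), hx, h4 v hv]
  push Not at e1
  obtain ⟨x1, hx1, e1⟩ := e1
  have htwo : ∃ x ∈ h, ∃ y ∈ h, f (gr x) ≠ f (gr y) := by
    by_contra hcon
    push Not at hcon
    obtain ⟨x, hx, hxS⟩ := d.hS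
    obtain ⟨y, hy, hyS⟩ := d.hS'
    have hxi : f (gr x) ≠ i0 := by rw [hcon x hx x1 hx1]; exact e1
    have hyi : f (gr y) ≠ i0 := by rw [hcon y hy x1 hx1]; exact e1
    apply hyS
    rw [h4 y hyi, ← hcon x hx y hy, ← h4 x hxi]; exact hxS
  have pure : ∀ x ∈ h, ∀ y, f (gr y) = f (gr x) → y ∈ h := by
    intro x hx y hy
    have : ∃ z ∈ h, f (gr z) ≠ f (gr x) := by
      obtain ⟨a, ha, b, hb, hab⟩ := htwo
      by_cases e : f (gr a) = f (gr x)
      · exact ⟨b, hb, fun e' => hab (e.trans e'.symm)⟩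
      · exact ⟨a, ha, e⟩
    obtain ⟨x', hx', ex', z, hz, ez, hxz⟩ := d.cut {v | f (gr v) = f (gr x)} ⟨x, hx, rfl⟩ this
    have ex' : f (gr x') = f (gr x) := ex'
    have ez : f (gr z) ≠ f (gr x) := ez
    rw [hcg.H x' z (by rw [ex']; exact Ne.symm ez), ex', ← hy] at hxz
    exact d.cl z hz y (H0.symm ((hcg.H y z (by rw [hy]; exact Ne.symm ez)).2 hxz))
  by_cases e2 : ∃ x ∈ h, f (gr x) = i0
  · obtain ⟨x, hx, e⟩ := e2
    exact d.Aa hcg hred h4 h5 h6 htwo pure hx e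
  · refine d.Ab hcg hred h5 h6 h7 htwo pure ?_
    intro y hy
    push Not at e2
    obtain ⟨x, hx, hxS⟩ := d.hS
    have := (h4 x (e2 x hx)).1 hxS
    refine e2 y (d.cl x hx y ((hcg.H x y ?_).2 ?_)) hy
    · rw [hy]; exact e2 x hx
    · rw [hy]; exact this

theorem SSL {n : ℕ} {G0 H0 A : LGraph} {S h : Set H0.V} (d : SD n G0 H0 A S h) :
    Good (pp G0 (pp (H0.ind hᶜ) A)) (H0.ind h) ∅ := by
  obtain ⟨a0⟩ := d.hA
  have := d.hpsi.2.2.1 G0 (plg H0 S A) {x | ∃ a, x = gr a} (iso.refl _) d.cn ?_ ⟨gr a0, a0, rfl⟩ ?_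
  · rcases this.goodP a0 with h | h | h
    exacts [d.A h, d.B1 h, d.B2 h]
  · rintro v hv _ ⟨a, rfl⟩ _ ⟨b, rfl⟩
    rcases glue_cases v with ⟨v, rfl⟩ | ⟨v, rfl⟩
    · simp
    · exact (hv ⟨v, rfl⟩).elim
  · obtain ⟨x, hx, _⟩ := d.hS
    exact ⟨gl x, by simp⟩

theorem Psi.iso {D D' : LGraph} (h : Psi D) (φ : D.iso D') : Psi D' :=
  ⟨fun G H ψ => h.1 G H (φ.trans ψ), fun G H a ψ => h.2.1 G H a (φ.trans ψ),
    fun G H a ψ => h.2.2.1 G H a (φ.trans ψ), fun G S A ψ => h.2.2.2 G S A (φ.trans ψ)⟩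

theorem two_iso {H H' : LGraph} (h : ∃ x y : H.V, x ≠ y) (φ : H.iso H') : ∃ x y : H'.V, x ≠ y := by
  obtain ⟨φ⟩ := φ
  obtain ⟨x, y, hxy⟩ := h
  exact ⟨φ.toEquiv x, φ.toEquiv y, fun e => hxy (φ.toEquiv.injective e)⟩

theorem plg_pull {B : LGraph} {S : Set B.V} (h : Set B.V) (hc : Cl B h) (b : Prop) (hb : ∀ x ∈ h, (x ∈ S ↔ b))
    (A : LGraph) : (plg (plg (B.ind hᶜ) {x | iv x ∈ S} A) {x | b ∧ ∃ a, x = gr a} (B.ind h)).iso (plg B S A) := by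
  refine iso_of_fun (gelim (gelim (fun e => gl (iv e)) gr) (fun e => gl (iv e))) ?_ ?_ ?_ ?_
  · have k : ∀ (a : (B.ind hᶜ).V) (b : (B.ind h).V), iv a ≠ iv b :=
      fun a b hab => iv_mem a (show iv a ∈ h by rw [hab]; exact iv_mem b)
    simp only [glue_forall]
    simp
    exact ⟨k, fun a b => (k b a).symm⟩
  · rw [glue_forall]
    refine ⟨fun a => ?_, fun a => ⟨gl (gr a), rfl⟩⟩
    by_cases ha : a ∈ h
    · exact ⟨gr (im a ha), rfl⟩
    · exact ⟨gl (gl (im a ha)), rfl⟩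
  · have k1 : ∀ (a : (B.ind hᶜ).V) (b : (B.ind h).V), ¬ B.adj (iv a) (iv b) :=
      fun a b hab => iv_mem a (hc _ (iv_mem b) _ (B.symm hab))
    have k2 : ∀ (a : (B.ind hᶜ).V) (b : (B.ind h).V), ¬ B.adj (iv b) (iv a) :=
      fun a b hab => k1 a b (B.symm hab)
    have k3 : ∀ (a : (B.ind h).V), iv a ∈ S ↔ b := fun a => hb _ (iv_mem a)
    simp only [glue_forall]
    simp [k1, k2, k3]
  · simp only [glue_forall]
    simp

theorem plg_pull0 {B : LGraph} {S : Set B.V} (h : Set B.V) (hc : Cl B h) (hb : ∀ x ∈ h, x ∉ S)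
    (A : LGraph) : (pp (plg (B.ind hᶜ) {x | iv x ∈ S} A) (B.ind h)).iso (plg B S A) :=
  iso.trans (glue_congr (by simp)) (plg_pull h hc False (by simpa using hb) A)

theorem SSB {n : ℕ} {C B A : LGraph} {S : Set B.V} (hS : S.Nonempty) (hA : Nonempty A.V)
    (hp : Pv (pp C (plg B S A))) (hpsi : Psi (pp C (plg B S A))) (hlt : Lt n)
    (hn : sz C + (sz B + sz A) ≤ n) (h : Set B.V) (cl : Cl B h) (conn : Conn (B.ind h))
    (two : ∃ x y : (B.ind h).V, x ≠ y) : Good (pp C (pp (B.ind hᶜ) A)) (B.ind h) ∅ := by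
  obtain ⟨a0⟩ := hA
  have hszB := sz_iso (ind_closed cl)
  rw [sz_glue] at hszB
  by_cases e1 : ∀ x ∈ h, x ∉ S
  · refine (hpsi.1 (pp C (plg (B.ind hᶜ) {x | iv x ∈ S} A)) (B.ind h) ?_ conn two).red (Red.of_dv (Dv.par_left _ (Dv.ss _ _ _)))
    exact (iso_par (iso.refl _) (plg_pull0 h cl e1 A).symm).trans (par_assoc _ _ _).symm
  by_cases e2 : ∀ x ∈ h, x ∈ S
  · refine Gp (E := pp C (plg (B.ind hᶜ) {x | iv x ∈ S} A)) (T := pT {x | True ∧ ∃ a, x = gr a}) (Z := B.ind h) (L := LGraph.empty)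
      hpsi.2.2.2 hp ?_ ⟨gr (gr a0), by simp⟩ hlt ?_ ?_ ?_ conn two ?_
    · exact (iso_par (iso.refl _) (plg_pull h cl True (by simpa using e2) A).symm).trans (plug_pp _ _ _ _).symm
    · rw [sz_glue, sz_glue]; omega
    · exact Dv.iso (empty_glue inferInstance).symm
    · rw [sz_empty]; omega
    · exact (Dv.iso (glue_empty inferInstance)).trans (Dv.par_left _ (Dv.ss _ _ _))
  push Not at e1 e2
  obtain ⟨c, hc1, hc2, hc3⟩ := Conn.comp (plg B S A) (gr a0)
  have hSc : ∀ x ∈ S, gl x ∈ c := fun x hx => hc2 _ hc1 _ (by simpa using hx)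
  have hAc : ∀ a, gr a ∈ c := fun a => by
    obtain ⟨s, hs⟩ := hS
    exact hc2 _ (hSc s hs) _ (by simpa using hs)
  have hgc : Cl B {b | gl b ∈ c} := fun x hx y hxy => hc2 _ hx _ (by simpa using hxy)
  have hhg : ∀ x ∈ h, gl x ∈ c := by
    by_contra hcon
    push Not at hcon
    obtain ⟨x, hx, hx'⟩ := hcon
    obtain ⟨y, hy, hy'⟩ := e1
    obtain ⟨u, hu, v, hv, huv⟩ := conn {x | gl (iv x) ∈ c} ⟨im y hy, hSc y hy'⟩ ⟨im x hx, hx'⟩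
    exact hv (hc2 _ hu _ (by simpa using huv))
  have φ1 := plg_comp (S := S) {b | gl b ∈ c} hgc hSc A
  have φ : (pp C (plg B S A)).iso (pp (pp C (B.ind {b | gl b ∈ c}ᶜ)) (plg (B.ind {b | gl b ∈ c}) {x | iv x ∈ S} A)) :=
    (iso_par (iso.refl _) φ1.symm).trans (par_assoc _ _ _).symm
  have ψ : ((B.ind {b | gl b ∈ c}).ind {x | iv x ∈ h}).iso (B.ind h) := ind_ind' _ _ _ hhg (fun _ => Iff.rfl)
  have hszg := sz_iso (ind_closed hgc)
  rw [sz_glue] at hszg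
  have d : SD n (pp C (B.ind {b | gl b ∈ c}ᶜ)) (B.ind {b | gl b ∈ c}) A {x | iv x ∈ S} {x | iv x ∈ h} := by
    refine ⟨hlt, ?_, hp.iso φ, hpsi.iso φ, ?_, conn.iso ψ.symm, ?_, ?_, ⟨a0⟩, ?_, ?_⟩
    · rw [sz_glue]; omega
    · intro x hx y hxy; exact cl _ hx _ hxy
    · exact two_iso two ψ.symm
    · exact hc3.iso (plg_ind_l c {b | gl b ∈ c} (fun _ => Iff.rfl) hAc).symm
    · obtain ⟨x, hx, hx'⟩ := e1
      exact ⟨im x (hhg x hx), hx, hx'⟩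
    · obtain ⟨x, hx, hx'⟩ := e2
      exact ⟨im x (hhg x hx), hx, hx'⟩
  refine ((SSL d).iso ψ).red (Red.iso ?_)
  have k : (pp (B.ind {b | gl b ∈ c}ᶜ) ((B.ind {b | gl b ∈ c}).ind {x | iv x ∈ h}ᶜ)).iso (B.ind hᶜ) := by
    refine (iso_par (iso.refl _) (ind_ind' _ _ {b | gl b ∈ c ∧ b ∉ h} (fun x hx => hx.1) (fun x => ⟨fun hx => ⟨iv_mem x, hx⟩, fun hx => hx.2⟩))).trans ?_
    refine ind_par _ _ _ ?_ (fun x hx hx' => hx hx'.1) ?_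
    · intro x; have := hhg x; simp; tauto
    · intro v hv x hx hvx; exact hv (hgc x hx.1 v (B.symm hvx))
  refine (par_assoc _ _ _).trans (iso_par (iso.refl _) ((par_assoc _ _ _).symm.trans (iso_par k (iso.refl _))))

theorem SSR {n : ℕ} {C B A : LGraph} {S : Set B.V} (hS : S.Nonempty)
    (hp : Pv (pp C (plg B S A))) (hpsi : Psi (pp C (plg B S A))) (hlt : Lt n)
    (hn : sz C + (sz B + sz A) ≤ n) (h : Set A.V) (cl : Cl A h) (conn : Conn (A.ind h))
    (two : ∃ x y : (A.ind h).V, x ≠ y) : Good (pp C (pp B (A.ind hᶜ))) (A.ind h) ∅ := by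
  obtain ⟨s, hs⟩ := hS
  have hszB := sz_iso (ind_closed cl)
  rw [sz_glue] at hszB
  refine Gp (E := pp C B) (T := pT S) (Z := A) (L := A.ind hᶜ) hpsi.2.2.2 hp (plug_pp _ _ _ _).symm ⟨gr s, by simpa using hs⟩ hlt ?_ ?_ ?_ conn two ?_
  · rw [sz_glue]; omega
  · exact Dv.iso (ind_closed cl).symm
  · omega
  · exact (Dv.ss _ _ _).trans (Dv.iso (par_assoc _ _ _))

theorem SS {n : ℕ} {C B A : LGraph} {S : Set B.V} (hS : S.Nonempty) (hA : Nonempty A.V)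
    (hp : Pv (pp C (plg B S A))) (hpsi : Psi (pp C (plg B S A))) (hlt : Lt n)
    (hn : sz C + (sz B + sz A) ≤ n) (h : Set (pp B A).V) (cl : Cl (pp B A) h) (conn : Conn ((pp B A).ind h))
    (two : ∃ x y : ((pp B A).ind h).V, x ≠ y) : Good (pp C ((pp B A).ind hᶜ)) ((pp B A).ind h) ∅ := by
  have φ : (pp (B.ind {b | gl b ∈ h}) (A.ind {b | gr b ∈ h})).iso ((pp B A).ind h) :=
    glue_ind (r := fun _ _ => False) _ _ h (fun _ => Iff.rfl) (fun _ => Iff.rfl) (fun _ _ => Iff.rfl)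
  have φ' : (pp (B.ind {b | gl b ∈ h}ᶜ) (A.ind {b | gr b ∈ h}ᶜ)).iso ((pp B A).ind hᶜ) :=
    glue_ind (r := fun _ _ => False) _ _ hᶜ (fun _ => Iff.rfl) (fun _ => Iff.rfl) (fun _ _ => Iff.rfl)
  by_cases e1 : ∃ b, gl b ∈ h
  · obtain ⟨b, hb⟩ := e1
    have e2 : ∀ a, gr a ∉ h := by
      intro a ha
      obtain ⟨x, ⟨y, hy⟩, z, hz, hxz⟩ := conn {x | ∃ y, iv x = gl y} ⟨im _ hb, b, rfl⟩ ⟨im _ ha, by simp⟩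
      have hxz : (pp B A).adj (iv x) (iv z) := hxz
      rcases glue_cases (iv z) with ⟨w, e⟩ | ⟨w, e⟩
      · exact hz ⟨w, e⟩
      · rw [hy, e] at hxz; simp at hxz
    have ψ := (iso.trans (glue_empty (r := fun _ _ => False) (ind_isEmpty e2)).symm φ)
    refine ((SSB hS hA hp hpsi hlt hn {b | gl b ∈ h} ?_ (conn.iso ψ.symm) (two_iso two ψ.symm)).iso ψ).red (Red.iso (iso_par (iso.refl _) ?_))
    · intro x hx y hxy; exact cl _ hx _ (by simpa using hxy)
    · exact iso.trans (iso_par (iso.refl _) (ind_univ (s := {b | gr b ∈ h}ᶜ) e2).symm) φ'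
  · have e2 : ∀ a, gl a ∉ h := fun a ha => e1 ⟨a, ha⟩
    have ψ := (iso.trans (empty_glue (r := fun _ _ => False) (ind_isEmpty e2)).symm φ)
    refine ((SSR hS hp hpsi hlt hn {b | gr b ∈ h} ?_ (conn.iso ψ.symm) (two_iso two ψ.symm)).iso ψ).red (Red.iso (iso_par (iso.refl _) ?_))
    · intro x hx y hxy; exact cl _ hx _ (by simpa using hxy)
    · exact iso.trans (iso_par (ind_univ (s := {b | gl b ∈ h}ᶜ) e2).symm (iso.refl _)) φ'

theorem tens_ind_in {ι : Type} {c : LGraph} (f : c.V → ι) (i : ι) :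
    ((tens c f).ind {x | f ((tv c f).symm x) = i}).iso (c.ind {x | f x = i}) := by
  refine iso.symm (ind_iso (tv c f) ?_ ?_ ?_ ?_ ?_)
  · simp
  · intro x hx; exact hx
  · intro y hy; exact ⟨(tv c f).symm y, hy, by simp⟩
  · intro x hx y hy
    have hx : f x = i := hx
    have hy : f y = i := hy
    simp [hx, hy]
  · simp

theorem tens_ind_out {ι : Type} {c : LGraph} (f : c.V → ι) (s : Set c.V) :
    ((tens c f).ind {x | (tv c f).symm x ∈ s}).iso (tens (c.ind s) (fun x => f (iv x))) := by
  refine iso.symm (iso_ind (fun x => tv c f (iv ((tv _ _).symm x))) ?_ ?_ ?_ ?_ ?_)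
  · intro x y h; simpa using h
  · intro x; exact iv_mem ((tv _ _).symm x)
  · intro y hy
    exact ⟨tv _ _ (im ((tv c f).symm y) hy), by simp⟩
  · intro x y
    obtain ⟨x, rfl⟩ := (tv _ _).surjective x
    obtain ⟨y, rfl⟩ := (tv _ _).surjective y
    simp
  · intro x
    obtain ⟨x, rfl⟩ := (tv _ _).surjective x
    simp

theorem sz_tens {ι : Type} (c : LGraph) (f : c.V → ι) : sz (tens c f) = sz c := rfl

theorem TT {n : ℕ} (hlt : Lt n) {ι : Type} (m : ℕ) : ∀ (c : LGraph) (f : c.V → ι) (G : LGraph), sz c ≤ m →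
    Pv (pp G (tens c f)) → TS (pp G (tens c f)) → sz G + sz c ≤ n →
    ∃ (K : LGraph) (g : K.V → ι), Red K G ∧ (∀ a b, K.adj a b → g a = g b) ∧
      ∀ i, Pv (pp (K.ind {x | g x = i}) (c.ind {x | f x = i})) := by
  induction m with
  | zero =>
    intro c f G hc hp _ _
    have hc : IsEmpty c.V := sz_eq_zero.1 (by omega)
    have hp := hp.iso (glue_empty (H := tens c f) hc)
    refine ⟨LGraph.empty, fun x => Empty.elim x, Red.of_empty (inferInstanceAs (IsEmpty Empty)) hp, fun x => Empty.elim x, fun i => ?_⟩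
    refine Pv_of_isEmpty ⟨fun x => ?_⟩
    rcases glue_cases x with ⟨a, rfl⟩ | ⟨a, rfl⟩
    · exact Empty.elim (iv a)
    · exact hc.elim (iv a)
  | succ m ih =>
    intro c f G hc hp hT hn
    by_cases hE : Nonempty c.V
    swap
    · have hE := not_nonempty_iff.1 hE
      have : sz c = 0 := sz_eq_zero.2 hE
      exact ih c f G (by omega) hp hT hn
    obtain ⟨x0⟩ := hE
    obtain ⟨KA, KB, hr, hA, hB⟩ := hT G (tens c f) {x | f ((tv c f).symm x) = f x0} (iso.refl _) (by
      intro x hx y hy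
      obtain ⟨x, rfl⟩ := (tv _ _).surjective x
      obtain ⟨y, rfl⟩ := (tv _ _).surjective y
      have hx : f x = f x0 := hx
      have hy : f y ≠ f x0 := hy
      rw [tens_adj]; right; rw [hx]; exact hy.symm)
    have hA := hA.iso (iso_par (iso.refl _) (tens_ind_in f (f x0)))
    have hB : Pv (pp KB (tens (c.ind {x | f x ≠ f x0}) (fun x => f (iv x)))) :=
      hB.iso (iso_par (iso.refl _) (tens_ind_out f {x | f x ≠ f x0}))
    have hs := hr.sz_l
    have hlt' : sz (c.ind {x | f x ≠ f x0}) < sz c := sz_ind_lt' (x := x0) (fun h => h rfl)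
    obtain ⟨K', g', hr', hpar, hK⟩ := ih (c.ind {x | f x ≠ f x0}) (fun x => f (iv x)) KB (by omega) hB
      (hlt _ hB (by rw [sz_glue, sz_tens]; omega)).2.1 (by omega)
    refine ⟨pp KA K', gelim (fun _ => f x0) g', (hr'.par' KA).trans hr, ?_, ?_⟩
    · simp only [glue_forall]
      exact ⟨fun a => ⟨fun b _ => rfl, fun b h => h.elim⟩, fun a => ⟨fun b h => h.elim, fun b h => hpar _ _ h⟩⟩
    · intro i
      by_cases hi : i = f x0
      · subst hi
        have h1 := hK (f x0)
        have he : IsEmpty ((c.ind {x | f x ≠ f x0}).ind {x | f (iv x) = f x0}).V := ind_isEmpty fun x hx => iv_mem x hx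
        have h1 := h1.iso (glue_empty he)
        have h2 := (hA.par h1).iso (par_rcomm _ _ _)
        refine h2.iso (iso_par ?_ (iso.refl _))
        refine iso.trans (iso_par (ind_univ (s := {x | True}) fun _ => trivial).symm (iso.refl _)) ?_
        exact glue_ind (r := fun _ _ => False) {x | True} {x | g' x = f x0}
          {x | gelim (fun _ => f x0) g' x = f x0} (fun _ => ⟨fun _ => trivial, fun _ => rfl⟩)
          (fun _ => Iff.rfl) (fun _ _ => Iff.rfl)
      · refine (hK i).iso (iso_par ?_ ?_)
        · refine ind_iso gr (by simp) (fun x hx => hx) ?_ (by simp) (by simp)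
          simp only [glue_forall]
          exact ⟨fun a ha => (hi (Eq.symm ha)).elim, fun a ha => ⟨a, ha, rfl⟩⟩
        · refine ind_ind' _ _ _ ?_ (fun x => Iff.rfl)
          intro x hx
          have hx : f x = i := hx
          show f x ≠ f x0
          rw [hx]; exact hi

/-- the fibre `i` reduces to the whole coloured graph, if the other fibres are provable -/
theorem L1red {ι : Type} {E : LGraph} {col : E.V → Bool} {f : E.V → ι}
    {q : ι → ι → Prop} (h : CG E col f q) (i : ι) (hp : ∀ j, j ≠ i → Pv (E.ind {x | f x = j})) :
    Red (E.ind {x | f x = i}) E := by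
  by_cases hE : Nonempty (E.ind {x | f x = i}).V
  · obtain ⟨C, R, hC, hZ⟩ := L1c (h.ind {x | f x ∈ ({i}ᶜ : Set ι)}) (fun j => by
      by_cases hj : j = i
      · refine Pv_of_isEmpty (ind_isEmpty fun x hx => iv_mem x ?_)
        exact Eq.trans hx hj
      · refine (hp j hj).iso (iso.symm (ind_ind' _ _ _ ?_ (fun _ => Iff.rfl)))
        intro x hx; have hx : f x = j := hx
        show ¬ f x = i
        rwa [hx]) (fun j => q j i)
    have h1 := hZ (E.ind {x | f x = i}) (fun x => col (iv x)) (fun x y hxy => h.nc _ _ hxy) hE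
    refine (Red.plug R hC).trans ((Red.of_dv h1).trans (Red.iso ?_))
    refine iso.trans (glue_congr ?_) ((ind_glue {x | f x ∈ ({i}ᶜ : Set ι)} {x | f x = i} Set.univ
      ?_ ?_).trans (ind_univ (by simp)))
    · intro x y
      have h1 : f (iv x) ≠ i := iv_mem x
      have h2 : f (iv y) = i := iv_mem y
      rw [h.cr (iv x) (iv y) (by rw [h2]; exact h1), h2]
      refine and_congr_right fun h3 => ?_
      have h3 : col (iv x) = col (iv y) := h3
      show (q (f (iv x)) i ↔ col (iv y) = true) ↔ _
      rw [h3]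
    · intro x; simp; tauto
    · intro x hx hx'; exact hx hx'
  · have hE := not_nonempty_iff.1 hE
    refine Red.of_empty hE (L1 h fun j => ?_)
    by_cases hj : j = i
    · rw [hj]; exact Pv_of_isEmpty hE
    · exact hp j hj

/-! adding the cross edges of colour `false` -/
section EF
variable {ι : Type} {K c : LGraph} (g : K.V → ι) (col : c.V → Bool) (f : c.V → ι) (q : ι → ι → Prop)
def EFf : (pp K c).V → ι := gelim g f
def EFc : (pp K c).V → Bool := gelim (fun _ => false) col
def EF (qs : ∀ i j, q i j → q j i) : LGraph :=
  (pp K c).re (fun x y => (pp K c).adj x y ∨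
      (EFf g f x ≠ EFf g f y ∧ EFc col x = false ∧ EFc col y = false ∧ ¬ q (EFf g f x) (EFf g f y)))
    (fun x y h => by
      rcases h with h | ⟨h1, h2, h3, h4⟩
      exacts [Or.inl ((pp K c).symm h), Or.inr ⟨h1.symm, h3, h2, fun h => h4 (qs _ _ h)⟩])
    (fun x h => by
      rcases h with h | h
      exacts [(pp K c).irrefl x h, h.1 rfl])
def EFv (qs : ∀ i j, q i j → q j i) : (EF g col f q qs).V → (pp K c).V := fun x => x
variable {g col f q} (qs : ∀ i j, q i j → q j i)
theorem EF_forall {p : (EF g col f q qs).V → Prop} (h : ∀ x : (pp K c).V, p x) (x) : p x := h x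

theorem EF_CG (h : CG c col f q) (hpar : ∀ a b, K.adj a b → g a = g b) :
    CG (EF g col f q qs) (fun x => EFc col (EFv g col f q qs x)) (fun x => EFf g f (EFv g col f q qs x)) q := by
  have nc : ∀ x y : (pp K c).V, (pp K c).adj x y → EFc col x = EFc col y := by
    simp only [glue_forall]
    exact ⟨fun a => ⟨fun b _ => rfl, fun b h => h.elim⟩, fun a => ⟨fun b h => h.elim, fun b hb => h.nc _ _ hb⟩⟩
  have cr : ∀ x y : (pp K c).V, EFf g f x ≠ EFf g f y → (((pp K c).adj x y ∨
      (EFf g f x ≠ EFf g f y ∧ EFc col x = false ∧ EFc col y = false ∧ ¬ q (EFf g f x) (EFf g f y))) ↔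
      EFc col x = EFc col y ∧ (q (EFf g f x) (EFf g f y) ↔ EFc col x = true)) := by
    simp only [glue_forall]
    refine ⟨fun a => ⟨fun b hab => ?_, fun b hab => ?_⟩, fun a => ⟨fun b hab => ?_, fun b hab => ?_⟩⟩
    · have hab : g a ≠ g b := hab
      have : ¬ K.adj a b := fun h => hab (hpar _ _ h)
      simp [EFf, EFc, hab, this]
    · have hab : g a ≠ f b := hab
      simp [EFf, EFc, hab]
    · have hab : f a ≠ g b := hab
      simp [EFf, EFc, hab]
      cases col a <;> simp
    · have hab : f a ≠ f b := hab
      have := h.cr a b hab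
      simp [EFf, EFc, hab, this]
      cases col a <;> cases col b <;> simp
  refine ⟨qs, ?_, cr⟩
  intro x y hxy
  rcases hxy with hxy | ⟨_, h1, h2, _⟩
  · exact nc x y hxy
  · exact h1.trans h2.symm

theorem EF_Dv (h : CG c col f q) (hpar : ∀ a b, K.adj a b → g a = g b) :
    Dv (EF g col f q qs) (pp K c) := by
  refine Dv.ext (ι := ι) (E := EF g col f q qs) (E' := pp K c) (Equiv.refl _) (fun _ => rfl)
    (gelim (H := c) (r := fun _ _ => False) (fun a => some (g a)) (fun _ => none)) ?_ ?_
  · intro i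
    refine EF_forall qs ?_
    intro v hv
    refine EF_forall qs ?_
    intro x hx
    refine EF_forall qs ?_
    intro y hy hvx
    rcases glue_cases x with ⟨x, rfl⟩ | ⟨x, rfl⟩
    swap
    · simp at hx
    rcases glue_cases y with ⟨y, rfl⟩ | ⟨y, rfl⟩
    swap
    · simp at hy
    have hx : g x = i := by simpa using hx
    have hy : g y = i := by simpa using hy
    rcases hvx with hvx | ⟨h1, h2, h3, h4⟩
    · rcases glue_cases v with ⟨v, rfl⟩ | ⟨v, rfl⟩
      · have := hpar v x hvx
        exact (hv (by simp [this, hx])).elim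
      · exact hvx.elim
    · right
      refine ⟨?_, h2, rfl, ?_⟩
      · show EFf g f v ≠ g y
        rw [hy, ← hx]; exact h1
      · show ¬ q (EFf g f v) (g y)
        rw [hy, ← hx]; exact h4
  · refine EF_forall qs ?_
    have : ∀ v w : (pp K c).V, (pp K c).adj v w ↔ ((pp K c).adj v w ∨
      (EFf g f v ≠ EFf g f w ∧ EFc col v = false ∧ EFc col w = false ∧ ¬ q (EFf g f v) (EFf g f w))) ∧
      (gelim (H := c) (r := fun _ _ => False) (fun a => some (g a)) (fun _ => none) v = gelim (H := c) (r := fun _ _ => False) (fun a => some (g a)) (fun _ => none) w) := by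
      simp only [glue_forall]
      refine ⟨fun a => ⟨fun b => ?_, fun b => ?_⟩, fun a => ⟨fun b => ?_, fun b => ?_⟩⟩
      · have := hpar a b
        simp [EFf, EFc]; tauto
      · simp
      · simp
      · simp [EFf, EFc]
        intro h1 h2 h3 h4
        rw [h.cr _ _ h1, h2, h3]; simp [h4]
    intro v w
    exact this v w

theorem EF_fib (i : ι) : ((EF g col f q qs).ind {x | EFf g f (EFv g col f q qs x) = i}).iso
    (pp (K.ind {x | g x = i}) (c.ind {x | f x = i})) := by
  refine iso.trans ?_ (fib_pp1 (EFf g f) i).symm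
  refine ind_iso (EFv g col f q qs) (fun _ _ _ _ h => h) (fun x hx => hx) (fun y hy => ⟨y, hy, rfl⟩) ?_ (fun _ _ => rfl)
  intro x hx y hy
  have hx : EFf g f (EFv g col f q qs x) = i := hx
  have hy : EFf g f (EFv g col f q qs y) = i := hy
  refine ⟨fun h => ?_, fun h => Or.inl h⟩
  rcases h with h | h
  · exact h
  · exact (h.1 (hx.trans hy.symm)).elim
end EF

/-- the pure case -/
theorem PLE {ι : Type} {c E : LGraph} {col : c.V → Bool} {f : c.V → ι} {ce : E.V → Bool} {F : E.V → ι}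
    {q : ι → ι → Prop} (hc : CG c col f q) (hE : CG E ce F q) (h : Set c.V)
    (hcol : ∀ x ∈ h, col x = true) (htwo : ∃ x ∈ h, ∃ y ∈ h, f x ≠ f y)
    (hW : ∀ x, F x ∈ {i | ∃ y ∈ h, f y = i} → ce x = false)
    (hW' : ∀ x, F x ∉ {i | ∃ y ∈ h, f y = i} → ce x = true → ∀ y ∈ h, ¬ q (F x) (f y))
    (hp : ∀ y ∈ h, Pv (pp (E.ind {x | F x = f y}) ((c.ind h).ind {x | f (iv x) = f y})))
    (hp' : ∀ i, i ∉ {i | ∃ y ∈ h, f y = i} → Pv (E.ind {x | F x = i})) : Good E (c.ind h) ∅ := by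
  obtain ⟨W, hWd⟩ : ∃ W : Set ι, W = {i | ∃ y ∈ h, f y = i} := ⟨_, rfl⟩
  rw [← hWd] at hW hW' hp'
  have hred : Red (E.ind {x | F x ∈ W}) E := by
    have r1 := Red.ctx (X := E) {x | F x ∈ {j | j ∉ W ∧ ∃ y, F y = j ∧ ce y = true}} {x | F x ∈ W}
      {x | F x ∉ {j | j ∉ W ∧ ¬ ∃ y, F y = j ∧ ce y = true}} ?_ ?_ ?_ ?_
    · refine r1.trans (Red.of_dv (Dv.insmulti F _ ?_ (fun z hz => hp' z hz.1)))
      rintro z ⟨hz1, hz2⟩ v hv x hx y hy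
      push Not at hz2
      rw [hE.cr v x (by rwa [hx]), hE.cr v y (by rwa [hy]), hx, hy]
      have h1 := hz2 x hx
      have h2 := hz2 y hy
      simp only [ne_eq, Bool.not_eq_true] at h1 h2
      rw [h1, h2]; exact id
    · intro x; simp only [Set.mem_ofPred_eq]
      by_cases h1 : F x ∈ W <;> simp [h1]
    · intro x hx; exact hx.1
    · intro v hv x hx y hy
      obtain ⟨hv1, u, hu, hu'⟩ := hv
      have hx : F x ∈ W := hx
      have hy : F y ∈ W := hy
      rw [hE.cr v x (fun e => hv1 (by rwa [e])), hE.cr v y (fun e => hv1 (by rwa [e])), hW x hx, hW y hy]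
      rintro ⟨h1, h2⟩
      refine ⟨h1, ?_⟩
      rw [h1]
      have hy2 := hy
      rw [hWd] at hy2
      obtain ⟨z, hz, e⟩ := hy2
      have := hW' u (by rwa [hu]) hu' z hz
      rw [hu, e] at this
      simp [this]
    · exact L1J hE _ fun i hi => hp' i hi.1
  refine Or.inl (mkGoodA (K := E.ind {x | F x ∈ W}) (f := gelim (fun a => F (iv a)) (fun a => f (iv a))) (q := q) ?_ ?_ hred ?_ (by simp))
  · refine CG_pp hE.qs ?_ ?_
    · intro a b hab
      have := hE.cr (iv a) (iv b) hab
      rw [hW _ (iv_mem a), hW _ (iv_mem b)] at this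
      simpa using this
    · intro a b hab
      have := hc.cr (iv a) (iv b) hab
      rw [hcol _ (iv_mem a), hcol _ (iv_mem b)] at this
      simpa using this
  · intro i
    by_cases hi : i ∈ W
    · have hi' := hi
      rw [hWd] at hi'
      obtain ⟨y, hy, rfl⟩ := hi'
      refine (hp y hy).iso (iso.trans (iso_par (iso.symm (ind_ind' {x | F x ∈ W} {x | F (iv x) = f y} _ ?_ (fun _ => Iff.rfl))) (iso.refl _))
        (fib_pp1 (gelim (fun a => F (iv a)) (fun a => f (iv a))) (f y)))
      intro x hx
      have hx : F x = f y := hx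
      show F x ∈ W
      rwa [hx]
    · refine Pv_of_isEmpty (ind_isEmpty ?_)
      rw [glue_forall]
      refine ⟨fun a ha => hi ?_, fun a ha => hi ?_⟩
      · have ha : F (iv a) = i := ha
        rw [← ha]; exact iv_mem a
      · rw [hWd]; exact ⟨_, iv_mem a, ha⟩
  · obtain ⟨x, hx, y, hy, hxy⟩ := htwo
    exact ⟨im x hx, im y hy, hxy⟩

theorem PL1 {n : ℕ} (hlt : Lt n) {ι : Type} {C c : LGraph} {col : c.V → Bool} {f : c.V → ι}
    {q : ι → ι → Prop} (hc : CG c col f q) (hne : ∀ i, ∃ x, f x ≠ i) (hp : Pv (pp C (tens c f)))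
    (hpsi : Psi (pp C (tens c f))) (hn : sz C + sz c ≤ n) (h : Set c.V) (cl : Cl c h)
    (conn : Conn (c.ind h)) (two : ∃ x y : (c.ind h).V, x ≠ y) (hcol : ∀ x ∈ h, col x = true) :
    Good (pp C (c.ind hᶜ)) (c.ind h) ∅ := by
  obtain ⟨K, g, hr, hpar, hK⟩ := TT hlt (sz c) c f C le_rfl hp hpsi.2.1 hn
  have hc' := hc.ind hᶜ
  have qs := hc.qs
  have d1 : Red (EF g (fun x : (c.ind hᶜ).V => col (iv x)) (fun x => f (iv x)) q qs) (pp C (c.ind hᶜ)) :=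
    (Red.of_dv (EF_Dv qs hc' hpar)).trans (hr.par _)
  have cg := EF_CG qs hc' hpar
  have fib0 : ∀ j, (∀ x ∈ h, f x ≠ j) → Pv ((EF g (fun x : (c.ind hᶜ).V => col (iv x)) (fun x => f (iv x)) q qs).ind
      {x | EFf g (fun x => f (iv x)) (EFv g (fun x : (c.ind hᶜ).V => col (iv x)) (fun x => f (iv x)) q qs x) = j}) := by
    intro j hj
    refine (hK j).iso (iso.trans (iso_par (iso.refl _) (iso.symm (ind_ind' _ _ _ ?_ (fun _ => Iff.rfl)))) (EF_fib qs j).symm)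
    intro x hx hxh
    exact hj x hxh hx
  by_cases hone : ∃ i, ∀ x ∈ h, f x = i
  · obtain ⟨i, hi⟩ := hone
    refine Good.red ?_ ((L1red cg i (fun j hj => fib0 j fun x hx e => hj (e.symm.trans (hi x hx)))).trans d1)
    refine Good.red ?_ (Red.iso (EF_fib qs i).symm)
    obtain ⟨x0, hx0⟩ := hne i
    have e1 := ind_closed' cl {x | f x = i} hi
    have e2 : ((c.ind hᶜ).ind {x | f (iv x) = i}).iso (c.ind {x | x ∈ {x | f x = i} ∧ x ∉ h}) :=
      ind_ind' _ _ _ (fun x hx => hx.2) (fun x => ⟨fun hx => ⟨hx, iv_mem x⟩, fun hx => hx.1⟩)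
    refine hlt.W ?_ ?_ conn two
    · refine (hK i).iso (iso.trans ?_ (par_assoc _ _ _).symm)
      exact iso_par (iso.refl _) (e1.symm.trans (iso_par e2.symm (iso.refl _)))
    · have s1 := sz_iso e1
      have s2 := sz_iso e2
      rw [sz_glue] at s1
      have s3 : sz (c.ind {x | f x = i}) < sz c := sz_ind_lt' (x := x0) hx0
      have s4 : sz (K.ind {x | g x = i}) ≤ sz K := sz_ind_le'
      have s5 := hr.sz_le
      rw [sz_glue]; omega
  · push Not at hone
    have htwo : ∃ x ∈ h, ∃ y ∈ h, f x ≠ f y := by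
      obtain ⟨⟨x, hx⟩, _, _⟩ := two
      obtain ⟨y, hy, e⟩ := hone (f x)
      exact ⟨x, hx, y, hy, e.symm⟩
    have pure : ∀ x ∈ h, ∀ y, f y = f x → col y = true → y ∈ h := by
      intro x hx y hy hyc
      obtain ⟨w, hw, ew⟩ := hone (f x)
      obtain ⟨x', ex', z, ez, hxz⟩ := conn {v | f (iv v) = f x} ⟨im x hx, rfl⟩ ⟨im w hw, ew⟩
      have ex' : f (iv x') = f x := ex'
      have ez : f (iv z) ≠ f x := ez
      have hxz : c.adj (iv x') (iv z) := hxz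
      rw [hc.cr _ _ (by rw [ex']; exact Ne.symm ez), ex', ← hy, hcol _ (iv_mem x')] at hxz
      refine cl (iv z) (iv_mem z) y (c.symm ((hc.cr _ _ (by rw [hy]; exact Ne.symm ez)).2 ?_))
      rw [hyc]; exact hxz
    have hfor : ∀ (p : (EF g (fun x : (c.ind hᶜ).V => col (iv x)) (fun x => f (iv x)) q qs).V → Prop), (∀ a : K.V, p (gl a : (pp K (c.ind hᶜ)).V)) →
        (∀ a : (c.ind hᶜ).V, p (gr a : (pp K (c.ind hᶜ)).V)) → ∀ x, p x := by
      intro p h1 h2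
      refine EF_forall qs ?_
      intro x
      rcases glue_cases x with ⟨a, rfl⟩ | ⟨a, rfl⟩
      exacts [h1 a, h2 a]
    refine Good.red (PLE hc cg h hcol htwo ?_ ?_ ?_ ?_) d1
    · refine hfor _ (fun a _ => rfl) ?_
      rintro a ⟨y, hy, e⟩
      have e : f y = f (iv a) := e
      show col (iv a) = false
      by_contra hcon
      exact iv_mem a (pure y hy _ e.symm (by simpa using hcon))
    · refine hfor _ (fun a _ h => by cases h) ?_
      rintro a ha hca y hy hq
      have hca : col (iv a) = true := hca
      have hq : q (f (iv a)) (f y) := hq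
      have hne : f (iv a) ≠ f y := fun e => ha ⟨y, hy, e.symm⟩
      refine iv_mem a (cl y hy _ (c.symm ((hc.cr _ _ hne).2 ?_)))
      rw [hca, hcol y hy]; simp [hq]
    · intro y hy
      refine (hK (f y)).iso ?_
      refine iso.trans ?_ (iso_par (EF_fib qs (f y)).symm (iso.refl _))
      refine iso.trans (iso_par (iso.refl _) ?_) (par_assoc _ _ _).symm
      refine iso.symm (iso.trans (iso_par (ind_ind' _ _ {x | f x = f y ∧ x ∉ h} (fun x hx => hx.2) (fun x => ⟨fun hx => ⟨hx, iv_mem x⟩, fun hx => hx.1⟩))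
        (ind_ind' _ _ {x | f x = f y ∧ x ∈ h} (fun x hx => hx.2) (fun x => ⟨fun hx => ⟨hx, iv_mem x⟩, fun hx => hx.1⟩))) ?_)
      refine ind_par _ _ _ ?_ ?_ ?_
      · intro x; simp only [Set.mem_ofPred_eq]; tauto
      · intro x hx hx'; exact hx.2 hx'.2
      · intro v hv x hx hvx
        exact hv.2 (cl x hx.2 v (c.symm hvx))
    · intro i hi
      exact fib0 i fun x hx e => hi ⟨x, hx, e⟩

theorem PL {n : ℕ} (hlt : Lt n) {ι : Type} {C c : LGraph} {col : c.V → Bool} {f : c.V → ι}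
    {q : ι → ι → Prop} (hc : CG c col f q) (hne : ∀ i, ∃ x, f x ≠ i) (hp : Pv (pp C (tens c f)))
    (hpsi : Psi (pp C (tens c f))) (hn : sz C + sz c ≤ n) (h : Set c.V) (cl : Cl c h)
    (conn : Conn (c.ind h)) (two : ∃ x y : (c.ind h).V, x ≠ y) :
    Good (pp C (c.ind hᶜ)) (c.ind h) ∅ := by
  obtain ⟨x0, _⟩ := id two
  have key : ∀ x ∈ h, col x = col (iv x0) := by
    intro x hx
    by_contra hcon
    obtain ⟨a, ha, b, hb, hab⟩ := conn {v | col (iv v) = col (iv x0)} ⟨x0, rfl⟩ ⟨im x hx, hcon⟩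
    have ha : col (iv a) = col (iv x0) := ha
    refine hb ?_
    show col (iv b) = col (iv x0)
    rw [← ha]; exact (hc.nc _ _ hab).symm
  rcases hh : col (iv x0) with _ | _
  · refine PL1 hlt hc.not hne hp hpsi hn h cl conn two ?_
    intro x hx; rw [key x hx, hh]; rfl
  · refine PL1 hlt hc hne hp hpsi hn h cl conn two ?_
    intro x hx; rw [key x hx, hh]

theorem comp_adj_ne {P : LGraph} {H : P.V → LGraph} {x y : (P.comp H).V} (h : x.1 ≠ y.1) :
    (P.comp H).adj x y ↔ P.adj x.1 y.1 := by
  constructor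
  · rintro (⟨v, a, b, rfl, rfl, _⟩ | h)
    · exact (h rfl).elim
    · exact h.2
  · exact fun h' => Or.inr ⟨h, h'⟩

theorem comp_fib {P : LGraph} {n : ℕ} (e : P.V ≃ Fin n) (M : Fin n → LGraph) (i : Fin n) :
    (M i).iso ((P.comp fun v => M (e v)).ind {x | e x.1 = i}) := by
  obtain ⟨v, rfl⟩ := e.surjective i
  refine iso_ind (fun a => ⟨v, a⟩) ?_ ?_ ?_ ?_ ?_
  · intro x x' h
    have h : (⟨v, x⟩ : Σ v : P.V, (M (e v)).V) = ⟨v, x'⟩ := h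
    simpa using h
  · intro x; rfl
  · rintro ⟨w, y⟩ hy
    have : w = v := e.injective hy
    subst this
    exact ⟨y, rfl⟩
  · intro x x'
    constructor
    · intro h; exact Or.inl ⟨v, x, x', rfl, rfl, h⟩
    · rintro (⟨w, a, b, ha, hb, h⟩ | h)
      · obtain rfl : v = w := congrArg Sigma.fst ha
        have ha : (⟨v, x⟩ : Σ v : P.V, (M (e v)).V) = ⟨v, a⟩ := ha
        have hb : (⟨v, x'⟩ : Σ v : P.V, (M (e v)).V) = ⟨v, b⟩ := hb
        obtain rfl : x = a := by simpa using ha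
        obtain rfl : x' = b := by simpa using hb
        exact h
      · exact (h.1 rfl).elim
  · intro x; rfl

theorem p_setup (n : ℕ) (P : LGraph) (e : P.V ≃ Fin n) (M N : Fin n → LGraph) (hn : 4 ≤ n)
    (hM : ∀ i, Nonempty (M i).V) :
    ∃ (f : (pp (P.dual.comp fun v => M (e v)) (P.comp fun v => N (e v))).V → Fin n) (q : Fin n → Fin n → Prop),
      CG _ kc f q ∧ (bigTensor n fun i => (M i).par (N i)).iso (tens _ f) ∧ ∀ i, ∃ x, f x ≠ i := by
  refine ⟨gelim (fun x => e x.1) (fun x => e x.1), fun i j => P.adj (e.symm i) (e.symm j), ?_, ?_, ?_⟩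
  · refine CG_pp ?_ ?_ ?_
    · intro i j h; exact P.symm h
    · intro a b hab
      have hab : e a.1 ≠ e b.1 := hab
      have hab : a.1 ≠ b.1 := fun h => hab (by rw [h])
      rw [comp_adj_ne hab]
      have key : ∀ u v : P.V, u ≠ v → ((u ≠ v ∧ ¬ P.adj u v) ↔ ¬ P.adj (e.symm (e u)) (e.symm (e v))) := by
        intro u v huv; simp [huv]
      exact key _ _ hab
    · intro a b hab
      have hab : e a.1 ≠ e b.1 := hab
      have hab : a.1 ≠ b.1 := fun h => hab (by rw [h])
      rw [comp_adj_ne hab]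
      simp only [gelim_gr, Equiv.symm_apply_apply]
  · refine tens_bigTensor n _ _ _ fun i => ?_
    rw [par_eq]
    refine iso.trans (iso_par (comp_fib (P := P.dual) e M i) (comp_fib e N i)) ?_
    exact fib_pp1 (K := P.dual.comp fun v => M (e v)) (H := P.comp fun v => N (e v))
      (gelim (fun x => e x.1) (fun x => e x.1)) i
  · intro i
    have : ∃ j : Fin n, j ≠ i := by
      by_cases h : i = ⟨0, by omega⟩
      · exact ⟨⟨1, by omega⟩, by rw [h]; simp⟩
      · exact ⟨_, Ne.symm h⟩
    obtain ⟨j, hj⟩ := this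
    obtain ⟨v, rfl⟩ := e.surjective j
    obtain ⟨a⟩ := hM (e v)
    exact ⟨gl ⟨v, a⟩, hj⟩

theorem rule_ne {p c : LGraph} (h : GSRule p c) : Nonempty c.V := by
  cases h with
  | ai a => exact ⟨Sum.inl ()⟩
  | ss A B S hA hS =>
    obtain ⟨a⟩ := hA
    exact ⟨Sum.inr a⟩
  | p n P e M N hP hn hM =>
    obtain ⟨a⟩ := hM (e (e.symm ⟨0, by omega⟩))
    exact ⟨Sum.inl ⟨e.symm ⟨0, by omega⟩, a⟩⟩

/-- a connected closed set inside the conclusion of a rule -/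
theorem rule_in {C p c : LGraph} (hr : GSRule p c) (hp : Pv (pp C p)) (hpsi : Psi (pp C p)) {n : ℕ}
    (hlt : Lt n) (hn : sz C + sz c ≤ n) : ∀ (h : Set c.V) (cl : Cl c h) (conn : Conn (c.ind h))
    (two : ∃ x y : (c.ind h).V, x ≠ y), Good (pp C (c.ind hᶜ)) (c.ind h) ∅ := by
  cases hr with
  | ai a =>
    intro h cl conn two
    exfalso
    obtain ⟨x, y, hxy⟩ := two
    obtain ⟨u, _, v, _, huv⟩ := conn {x} ⟨x, rfl⟩ ⟨y, fun e => hxy e.symm⟩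
    have huv : parAdj _ _ (iv u) (iv v) := huv
    revert huv
    generalize iv u = u'
    generalize iv v = v'
    intro huv
    rcases u' with u | u <;> rcases v' with v | v <;> exact huv
  | ss A B S hA hS =>
    rw [par_eq] at hn ⊢
    intro h cl conn two
    rw [plug_eq] at hp hpsi
    exact SS (Set.nonempty_iff_ne_empty.2 hS) hA hp hpsi hlt (by rwa [sz_glue] at hn) h cl conn two
  | p m P e M N hP hm hM =>
    obtain ⟨f, q, h1, h2, h3⟩ := p_setup m P e M N hm hM
    rw [par_eq] at hn ⊢
    intro h cl conn two
    exact PL hlt h1 h3 (hp.iso (iso_par (iso.refl _) h2)) (hpsi.iso (iso_par (iso.refl _) h2)) hn h cl conn two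

theorem conn_plg {H p c : LGraph} {S : Set H.V} (h : Conn (plg H S c)) (hp : Nonempty p.V) (hc : Nonempty c.V)
    (hS : S.Nonempty) : Conn (plg H S p) := by
  obtain ⟨p0⟩ := hp
  obtain ⟨c0⟩ := hc
  obtain ⟨v0, hv0⟩ := hS
  intro s ⟨x, hx⟩ ⟨y, hy⟩
  by_contra hcon
  push Not at hcon
  have hcon' : ∀ x ∈ s, ∀ y, y ∉ s → ¬ (plg H S p).adj y x := fun x hx y hy h => hcon x hx y hy (LGraph.symm _ h)
  have k1 : ∀ b v, v ∈ S → ((gr b : (plg H S p).V) ∈ s ↔ (gl v : (plg H S p).V) ∈ s) := by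
    intro b v hv
    constructor
    · intro h1; by_contra h2; exact hcon _ h1 _ h2 (by simpa using hv)
    · intro h1; by_contra h2; exact hcon _ h1 _ h2 (by simpa using hv)
  have key : ∀ t : Prop, (∃ v : H.V, ((gl v : (plg H S p).V) ∈ s ↔ t)) → (t ↔ (gr p0 : (plg H S p).V) ∈ s) := by
    rintro t ⟨v, hv⟩
    by_contra hne
    obtain ⟨a, ha, b, hb, hab⟩ := h {z | gelim (fun v => ((gl v : (plg H S p).V) ∈ s ↔ t)) (fun _ => False) z} ⟨gl v, hv⟩ ⟨gr c0, id⟩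
    rcases glue_cases a with ⟨a, rfl⟩ | ⟨a, rfl⟩
    swap
    · exact ha
    have ha : ((gl a : (plg H S p).V) ∈ s ↔ t) := ha
    rcases glue_cases b with ⟨b, rfl⟩ | ⟨b, rfl⟩
    · have hb : ¬ ((gl b : (plg H S p).V) ∈ s ↔ t) := hb
      have hab : H.adj a b := by simpa using hab
      by_cases h1 : (gl a : (plg H S p).V) ∈ s
      · by_cases h2 : (gl b : (plg H S p).V) ∈ s
        · tauto
        · exact hcon _ h1 _ h2 (by simpa using hab)
      · by_cases h2 : (gl b : (plg H S p).V) ∈ s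
        · exact hcon' _ h2 _ h1 (by simpa using hab)
        · tauto
    · have hab : a ∈ S := by simpa using hab
      exact hne (ha.symm.trans (k1 p0 a hab).symm)
  have all : ∀ z : (plg H S p).V, z ∈ s ↔ (gr p0 : (plg H S p).V) ∈ s := by
    rw [glue_forall]
    exact ⟨fun v => key _ ⟨v, Iff.rfl⟩, fun b => (k1 b v0 hv0).trans (k1 p0 v0 hv0).symm⟩
  exact hy ((all y).2 ((all x).1 hx))

theorem W_step {C p c : LGraph} {R : Set C.V} (hr : GSRule p c) (hp : Pv (plg C R p)) (hpsi : Psi (plg C R p))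
    {n : ℕ} (hlt : Lt n) (hn : sz C + sz c ≤ n) (h : Set (plg C R c).V) (cl : Cl (plg C R c) h)
    (conn : Conn ((plg C R c).ind h)) (two : ∃ x y : ((plg C R c).ind h).V, x ≠ y) :
    Good ((plg C R c).ind hᶜ) ((plg C R c).ind h) ∅ := by
  obtain ⟨c0⟩ := rule_ne hr
  have hd := Dv.rule hr
  have cl0 : Cl C {v | gl v ∈ h} := by
    intro x hx y hxy
    exact cl (gl x) hx (gl y) (by simpa using hxy)
  by_cases e1 : ∃ b, gr b ∈ h
  swap
  · push Not at e1
    have hR : ∀ v, (gl v : (plg C R c).V) ∈ h → v ∉ R := fun v hv hvR =>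
      e1 c0 (cl (gl v) hv (gr c0) (by simpa using hvR))
    have φ : (C.ind {v | gl v ∈ h}).iso ((plg C R c).ind h) := plg_ind_r _ _ (fun _ => Iff.rfl) e1
    have ψ : (plg (C.ind {v | gl v ∈ h}ᶜ) {x | iv x ∈ R} c).iso ((plg C R c).ind hᶜ) :=
      plg_ind_l _ _ (fun _ => Iff.rfl) e1
    have w := hpsi.1 _ _ (plg_pull0 {v | gl v ∈ h} cl0 hR p).symm (conn.iso φ.symm) (two_iso two φ.symm)
    exact ((w.red (Red.of_dv (Dv.plug _ _ hd))).red (Red.iso ψ)).iso φ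
  obtain ⟨b0, hb0⟩ := e1
  by_cases e2 : ∃ v, gl v ∈ h
  · obtain ⟨v1, hv1⟩ := e2
    obtain ⟨x, hx, y, hy, hxy⟩ := conn {z | gelim (fun _ => True) (fun _ => False) (iv z)} ⟨im (gl v1) hv1, trivial⟩ ⟨im (gr b0) hb0, id⟩
    have hxh := iv_mem x
    have hyh := iv_mem y
    have hx : gelim (fun _ => True) (fun _ => False) (iv x) := hx
    have hy : ¬ gelim (fun _ => True) (fun _ => False) (iv y) := hy
    have hxy : (plg C R c).adj (iv x) (iv y) := hxy
    obtain ⟨v, hv⟩ : ∃ v, iv x = gl v := by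
      rcases glue_cases (iv x) with ⟨v, e⟩ | ⟨v, e⟩
      · exact ⟨v, e⟩
      · rw [e] at hx; exact hx.elim
    obtain ⟨b, hb⟩ : ∃ v, iv y = gr v := by
      rcases glue_cases (iv y) with ⟨v, e⟩ | ⟨v, e⟩
      · rw [e] at hy; exact (hy trivial).elim
      · exact ⟨v, e⟩
    rw [hv] at hxy hxh
    rw [hb] at hxy hyh
    have hvR : v ∈ R := by simpa using hxy
    have hall : ∀ b, gr b ∈ h := fun b => cl _ hxh _ (by simpa using hvR)
    have hRh : ∀ u ∈ R, gl u ∈ h := fun u hu => cl _ hb0 _ (by simpa using hu)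
    have φ : (plg (C.ind {v | gl v ∈ h}) {x | iv x ∈ R} c).iso ((plg C R c).ind h) :=
      plg_ind_l _ _ (fun _ => Iff.rfl) hall
    have ψ : (C.ind {v | gl v ∈ h}ᶜ).iso ((plg C R c).ind hᶜ) :=
      plg_ind_r _ _ (fun _ => Iff.rfl) (fun b hb => hb (hall b))
    have χ := plg_comp (S := R) {v | gl v ∈ h} cl0 hRh p
    have gp : GoodP (C.ind {v | gl v ∈ h}ᶜ) (C.ind {v | gl v ∈ h}) {x | iv x ∈ R} p := by
      by_cases hpe : Nonempty p.V
      · obtain ⟨p0⟩ := id hpe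
        refine Good.goodP ?_ p0
        refine hpsi.2.2.1 _ _ _ χ.symm (conn_plg (conn.iso φ.symm) hpe ⟨c0⟩ ⟨im v hxh, hvR⟩) ?_ ⟨gr p0, p0, rfl⟩ ⟨gl (im v hxh), by simp⟩
        rintro v hv _ ⟨a, rfl⟩ _ ⟨b, rfl⟩
        rcases glue_cases v with ⟨v, rfl⟩ | ⟨v, rfl⟩
        · simp
        · exact (hv ⟨v, rfl⟩).elim
      · have hpe := not_nonempty_iff.1 hpe
        refine Or.inr (Or.inl ⟨∅, LGraph.empty, C.ind {v | gl v ∈ h}ᶜ, ?_, ⟨im v hxh, id⟩, Red.iso (empty_glue inferInstance), ?_, ?_⟩)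
        · intro _ _ x hx; exact hx.elim
        · refine Pv_of_isEmpty ⟨fun x => ?_⟩
          rcases glue_cases x with ⟨v, rfl⟩ | ⟨v, rfl⟩
          · exact Empty.elim v
          · rcases glue_cases v with ⟨v, rfl⟩ | ⟨v, rfl⟩
            · exact iv_mem v
            · exact hpe.elim v
        · refine hp.iso (χ.symm.trans (iso_par (iso.refl _) ((glue_empty hpe).trans (ind_univ ?_).symm)))
          intro x hx; exact hx
    exact (((gp.mono hd).good c0).red (Red.iso ψ)).iso φ
  · push Not at e2
    have hR : ∀ v, v ∉ R := fun v hv => e2 v (cl _ hb0 _ (by simpa using hv))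
    have hg : ∀ X : LGraph, (plg C R X).iso (pp C X) := fun X => glue_congr (by simpa using fun x (_ : X.V) => hR x)
    have φ : (c.ind {b | gr b ∈ h}).iso ((plg C R c).ind h) := by
      refine ind_iso gr (by simp) (fun x hx => hx) ?_ (by simp) (by simp)
      rw [glue_forall]
      exact ⟨fun v hv => (e2 v hv).elim, fun b hb => ⟨b, hb, rfl⟩⟩
    have ψ : (pp C (c.ind {b | gr b ∈ h}ᶜ)).iso ((plg C R c).ind hᶜ) := by
      refine iso_ind (gelim gl (fun b => gr (iv b))) (by simp) ?_ ?_ (by simp [hR]) (by simp)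
      · rw [glue_forall]; exact ⟨fun v hv => e2 v hv, fun b => iv_mem b⟩
      · rw [glue_forall]; exact ⟨fun v hv => ⟨gl v, rfl⟩, fun b hb => ⟨gr (im b hb), rfl⟩⟩
    refine Good.iso (Good.red ?_ (Red.iso ψ)) φ
    refine rule_in hr (hp.iso (hg p)) (hpsi.iso (hg p)) hlt hn _ ?_ (conn.iso φ.symm) (two_iso two φ.symm)
    intro x hx y hxy
    exact cl (gr x) hx (gr y) (by simpa using hxy)

theorem main2 {D1 D : LGraph} (hp : Pv D1) (hpsi : Psi D1) (hlt : Lt (sz D)) (hs : Step GSRule D1 D) : WS D := by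
  obtain ⟨C, R, p, c, hr, h1, h2⟩ := hs
  rw [plug_eq] at h1 h2
  intro G H φ conn two
  obtain ⟨χ⟩ := h2.symm.trans φ
  have hsz : sz D = sz C + sz c := by rw [sz_iso h2, sz_glue]
  have fH : H.iso ((plg C R c).ind {x | ∃ a, χ.toEquiv x = gr a}) := by
    refine iso_ind (fun a => χ.toEquiv.symm (gr a)) (by simp) ?_ ?_ ?_ ?_
    · intro x; exact ⟨x, by simp⟩
    · rintro y ⟨a, ha⟩; exact ⟨a, by rw [← ha]; simp⟩
    · intro x x'; rw [χ.adj_iff]; simp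
    · intro x; rw [← χ.label_eq]; simp
  have fG : G.iso ((plg C R c).ind {x | ∃ a, χ.toEquiv x = gr a}ᶜ) := by
    refine iso_ind (fun a => χ.toEquiv.symm (gl a)) (by simp) ?_ ?_ ?_ ?_
    · rintro x ⟨a, ha⟩; simp at ha
    · intro y hy
      rcases hz : glue_cases (χ.toEquiv y) with ⟨v, e⟩ | ⟨v, e⟩
      · exact ⟨v, by rw [← e]; simp⟩
      · exact (hy ⟨v, e⟩).elim
    · intro x x'; rw [χ.adj_iff]; simp
    · intro x; rw [← χ.label_eq]; simp
  refine Good.iso (Good.red ?_ (Red.iso fG.symm)) fH.symm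
  refine W_step hr (hp.iso h1) (hpsi.iso h1) hlt hsz.ge _ ?_ (conn.iso fH) (two_iso two fH)
  rintro x ⟨a, ha⟩ y hxy
  rw [χ.adj_iff, ha] at hxy
  rcases glue_cases (χ.toEquiv y) with ⟨v, e⟩ | ⟨v, e⟩
  · rw [e] at hxy; simp at hxy
  · exact ⟨v, e⟩

theorem WS_empty {D : LGraph} (h : IsEmpty D.V) : WS D := by
  intro G H φ _ two
  obtain ⟨φ⟩ := φ
  obtain ⟨x, _⟩ := two
  exact h.elim (φ.toEquiv.symm (gr x))

theorem Lt_all (n : ℕ) : Lt n := by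
  induction n with
  | zero => intro D _ h; omega
  | succ n ih =>
    have key : ∀ D, Pv D → sz D ≤ n → Psi D := by
      intro D hD
      induction hD with
      | refl =>
        intro _
        exact main1 (Dv.refl _) (fun D _ h => by rw [sz_empty] at h; omega) (WS_empty inferInstance)
      | tail h1 h2 ih2 =>
        intro hn
        rcases h2 with h2 | h2
        · exact (ih2 (by rwa [sz_iso h2])).iso h2
        · have hlt : Lt (sz _) := fun D hD hD' => ih D hD (lt_of_lt_of_le hD' hn)
          refine main1 (Pv.dv h1 (Dv.step h2)) hlt (main2 h1 (ih2 ?_) hlt h2)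
          exact le_trans (Step.sz_le h2) hn
    intro D hD h
    exact key D hD (by omega)

/-- **Context reduction.** Let `A` be a graph and `G[·]_S` a context
such that `G[A]_S` is provable in GS. Then there exist a context `C[·]_R` and a
graph `K` such that: for every graph `X` there is a GS derivation from
`C[K ⅋ X]_R` to `G[X]_S`; `K ⅋ A` is provable in GS; and `C` is provable in GS. -/
theorem context_reduction (A G : LGraph) (S : Set G.V)
    (h : Provable GSRule (G.plug S A)) :
    ∃ (C : LGraph) (R : Set C.V) (K : LGraph),
      (∀ X : LGraph, Deriv GSRule (C.plug R (K.par X)) (G.plug S X)) ∧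
      Provable GSRule (K.par A) ∧
      Provable GSRule C := by
  have psi := Lt_all (sz (G.plug S A) + 1) (G.plug S A) h (by omega)
  obtain ⟨K, ⟨C, R, hC, hX⟩, hK, _⟩ :=
    psi.2.2.2 G S A (by rw [plug_eq]; exact iso.refl _)
  refine ⟨C, R, K, fun X => ?_, ?_, hC⟩
  · rw [par_eq, plug_eq, plug_eq]; exact hX X
  · rw [par_eq]; exact hK
end GSP
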